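/- Fix an integer n ≥ 1. For admissible T → ∞, ∑_{0<γ≤T} ζ^{(n)}(ρ) = (−1)^{n+1} (1/(n+1)) (T/2π) log^{n+1}(T/2π) + O(T log^{n} T). -/

import Mathlib

open Complex Filter Finset

/-- The order of vanishing of the Riemann zeta function at a point `ρ`:
the least `k` such that the `k`-th derivative of `ζ` is nonzero at `ρ`. -/
noncomputable def zetaZeroOrder (ρ : ℂ) : ℕ :=
  sInf {k : ℕ | iteratedDeriv k riemannZeta ρ ≠ 0}

/-- A non-trivial zero of the Riemann zeta function. -/
def IsNontrivialZero (ρ : ℂ) : Prop :=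
  riemannZeta ρ = 0 ∧ 0 < ρ.re ∧ ρ.re < 1

/-- `∑_{0<γ≤T} ζ^{(n)}(ρ)`, the sum of the `n`-th derivative of `ζ` over the
non-trivial zeros `ρ = β + iγ` with `0 < γ ≤ T`, counted with multiplicity. -/
noncomputable def zetaZeroSum (n : ℕ) (T : ℝ) : ℂ :=
  ∑ᶠ ρ ∈ {ρ : ℂ | IsNontrivialZero ρ ∧ 0 < ρ.im ∧ ρ.im ≤ T},
    (zetaZeroOrder ρ : ℂ) * iteratedDeriv n riemannZeta ρ

/-- `T` is admissible: `|T - γ| ≥ δ / log T` for every ordinate `γ` of a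
non-trivial zero of `ζ`. -/
def AdmissibleHeight (δ T : ℝ) : Prop :=
  ∀ ρ : ℂ, IsNontrivialZero ρ → δ / Real.log T ≤ |T - ρ.im|

/-! ## Part 1: elementary sums -/

namespace KKY

open ArithmeticFunction in
lemma log_factorial_eq (N : ℕ) :
    Real.log (N.factorial : ℝ) = ∑ d ∈ Ioc 0 N, vonMangoldt d * ((N / d : ℕ) : ℝ) := by
  rw [← ArithmeticFunction.sum_Ioc_mul_zeta_eq_sum, vonMangoldt_mul_zeta]
  induction N with
  | zero => simp
  | succ N ih =>
    rw [Nat.factorial_succ, Finset.sum_Ioc_succ_top (by omega), ← ih]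
    push_cast
    rw [Real.log_mul (by positivity) (by positivity), ArithmeticFunction.log_apply]
    push_cast
    ring

lemma psi_bound (N : ℕ) :
    ∑ d ∈ Ioc 0 N, ArithmeticFunction.vonMangoldt d ≤ (Real.log 4 + 4) * N := by
  have := Chebyshev.psi_le_const_mul_self (x := (N : ℝ)) (by positivity)
  simpa [Chebyshev.psi] using this

lemma mertens (N : ℕ) (hN : 1 ≤ N) :
    |∑ d ∈ Ioc 0 N, ArithmeticFunction.vonMangoldt d / d - Real.log N| ≤ Real.log 4 + 4 := by
  have hN' : (0 : ℝ) < N := by exact_mod_cast hN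
  have h1 := log_factorial_eq N
  have h2 : N * Real.log N - N ≤ Real.log (N.factorial : ℝ) := by
    have := Stirling.le_log_factorial_stirling (n := N) (by omega)
    have h3 : 0 ≤ Real.log N := Real.log_natCast_nonneg N
    have h4 : 0 ≤ Real.log (2 * Real.pi) := Real.log_nonneg (by linarith [Real.pi_gt_three])
    linarith
  have h3 : Real.log (N.factorial : ℝ) ≤ N * Real.log N := by
    rw [← Real.log_pow]
    apply Real.log_le_log (by positivity)
    exact_mod_cast Nat.factorial_le_pow N
  set S := ∑ d ∈ Ioc 0 N, ArithmeticFunction.vonMangoldt d / d with hS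
  have h4 : N * S = ∑ d ∈ Ioc 0 N, ArithmeticFunction.vonMangoldt d * ((N : ℝ) / d) := by
    rw [hS, Finset.mul_sum]; exact Finset.sum_congr rfl fun d _ => by ring
  have h5 : Real.log (N.factorial : ℝ) ≤ N * S := by
    rw [h1, h4]
    refine Finset.sum_le_sum fun d hd => ?_
    exact mul_le_mul_of_nonneg_left Nat.cast_div_le ArithmeticFunction.vonMangoldt_nonneg
  have h6 : N * S ≤ Real.log (N.factorial : ℝ) + (Real.log 4 + 4) * N := by
    refine le_trans ?_ (add_le_add_right (psi_bound N) _)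
    rw [h1, h4, ← Finset.sum_add_distrib]
    refine Finset.sum_le_sum fun d hd => ?_
    have hd' : 0 < d := (Finset.mem_Ioc.mp hd).1
    have : (N : ℝ) / d ≤ ((N / d : ℕ) : ℝ) + 1 := by
      rw [← Nat.floor_div_eq_div (K := ℝ)]
      exact (Nat.lt_floor_add_one _).le
    nlinarith [@ArithmeticFunction.vonMangoldt_nonneg d]
  have h7 : 0 ≤ Real.log 4 := Real.log_nonneg (by norm_num)
  rw [abs_le]
  constructor
  · have : N * (Real.log N - 1) ≤ N * S := by linarith
    have := le_of_mul_le_mul_left this hN'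
    linarith
  · have : N * S ≤ N * (Real.log N + (Real.log 4 + 4)) := by linarith
    have := le_of_mul_le_mul_left this hN'
    linarith

lemma amgm (n : ℕ) {x y : ℝ} (hx : 0 ≤ x) (hy : 0 ≤ y) :
    (n + 1) * x * y ^ n ≤ x ^ (n + 1) + n * y ^ (n + 1) := by
  induction n with
  | zero => simp
  | succ n ih =>
    have h1 := mul_le_mul_of_nonneg_left ih hx
    have h2 : 0 ≤ (n + 1) * y ^ n * (x - y) ^ 2 := by positivity
    push_cast
    have e1 : x * (x ^ (n + 1) + n * y ^ (n + 1)) = x ^ (n+1+1) + n * x * (y ^ n * y) := by ring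
    have e2 : y ^ (n+1+1) = y ^ n * y * y := by ring
    have e3 : y ^ (n+1) = y ^ n * y := by ring
    rw [e1] at h1
    rw [e2, e3]
    nlinarith

lemma mertens_pow (n : ℕ) (hn : 1 ≤ n) (N : ℕ) (hN : 1 ≤ N) :
    |∑ k ∈ Ioc 0 N, ArithmeticFunction.vonMangoldt k * Real.log k ^ n / k
      - Real.log N ^ (n + 1) / (n + 1)| ≤ 2 * (Real.log 4 + 5) * Real.log N ^ n := by
  set S : ℕ → ℝ := fun N => ∑ d ∈ Ioc 0 N, ArithmeticFunction.vonMangoldt d / d with hS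
  have key : |∑ k ∈ Ioc 0 N, ArithmeticFunction.vonMangoldt k * Real.log k ^ n / k
      - S N * Real.log N ^ n + n / (n + 1) * Real.log N ^ (n + 1)|
        ≤ (Real.log 4 + 5) * Real.log N ^ n := by
    induction N, hN using Nat.le_induction with
    | base => simp [hS, show n ≠ 0 by omega]
    | succ N hN ih =>
      have hm := mertens N hN
      change |S N - _| ≤ _ at hm
      have hSs : S (N + 1) = S N + ArithmeticFunction.vonMangoldt (N + 1) / ((N + 1 : ℕ) : ℝ) := by
        simp only [hS]; rw [Finset.sum_Ioc_succ_top (by omega)]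
      rw [Finset.sum_Ioc_succ_top (by omega)]
      set a := Real.log N with ha
      set c := Real.log ((N + 1 : ℕ) : ℝ) with hc
      have hN' : (1 : ℝ) ≤ N := by exact_mod_cast hN
      have ha0 : 0 ≤ a := Real.log_nonneg hN'
      have hac : a ≤ c := Real.log_le_log (by linarith) (by push_cast; linarith)
      have hc1 : c - a ≤ 1 := by
        rw [hc, ha, ← Real.log_div (by positivity) (by positivity)]
        refine (Real.log_le_sub_one_of_pos (by positivity)).trans ?_
        rw [sub_le_iff_le_add, div_le_iff₀ (by linarith)]; push_cast; linarith
      have hpow : a ^ n ≤ c ^ n := pow_le_pow_left₀ ha0 hac n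
      have hb1 : a * (c ^ n - a ^ n) ≤ n / (n + 1) * (c ^ (n + 1) - a ^ (n + 1)) := by
        rw [div_mul_eq_mul_div, le_div_iff₀ (by positivity)]
        have := amgm n ha0 (ha0.trans hac)
        rw [pow_succ, pow_succ] at this ⊢
        nlinarith
      have hb2 : n / (n + 1) * (c ^ (n + 1) - a ^ (n + 1)) ≤ c * (c ^ n - a ^ n) := by
        rw [div_mul_eq_mul_div, div_le_iff₀ (by positivity)]
        have := amgm n (ha0.trans hac) ha0
        rw [pow_succ, pow_succ] at this ⊢
        nlinarith
      rw [hSs]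
      set W := ∑ k ∈ Ioc 0 N, ArithmeticFunction.vonMangoldt k * Real.log k ^ n / k
      set v := ArithmeticFunction.vonMangoldt (N + 1)
      have e : W + v * c ^ n / ((N + 1 : ℕ) : ℝ) - (S N + v / ((N + 1 : ℕ) : ℝ)) * c ^ n
          + n / (n + 1) * c ^ (n + 1) =
          (W - S N * a ^ n + n / (n + 1) * a ^ (n + 1)) - (S N - a) * (c ^ n - a ^ n)
          + (n / (n + 1) * (c ^ (n + 1) - a ^ (n + 1)) - a * (c ^ n - a ^ n)) := by ring
      rw [e]
      have hp : 0 ≤ c ^ n - a ^ n := by linarith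
      have g1 : |(S N - a) * (c ^ n - a ^ n)| ≤ (Real.log 4 + 4) * (c ^ n - a ^ n) := by
        rw [abs_mul, abs_of_nonneg hp]
        exact mul_le_mul_of_nonneg_right hm hp
      have g2 : |n / (n + 1) * (c ^ (n + 1) - a ^ (n + 1)) - a * (c ^ n - a ^ n)| ≤
          1 * (c ^ n - a ^ n) := by
        rw [abs_of_nonneg (by linarith)]
        nlinarith [mul_le_mul_of_nonneg_right hc1 hp]
      have := abs_add_le ((W - S N * a ^ n + n / (n + 1) * a ^ (n + 1)) - (S N - a) * (c ^ n - a ^ n))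
        (n / (n + 1) * (c ^ (n + 1) - a ^ (n + 1)) - a * (c ^ n - a ^ n))
      have := abs_sub (W - S N * a ^ n + n / (n + 1) * a ^ (n + 1)) ((S N - a) * (c ^ n - a ^ n))
      linarith
  have hm := mertens N hN
  change |S N - _| ≤ _ at hm
  have ha0 : 0 ≤ Real.log N := Real.log_natCast_nonneg N
  set a := Real.log N
  set W := ∑ k ∈ Ioc 0 N, ArithmeticFunction.vonMangoldt k * Real.log k ^ n / k
  have e : W - a ^ (n + 1) / (n + 1) = (W - S N * a ^ n + n / (n + 1) * a ^ (n + 1))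
      + (S N - a) * a ^ n := by
    field_simp; ring
  rw [e]
  have g1 : |(S N - a) * a ^ n| ≤ (Real.log 4 + 4) * a ^ n := by
    rw [abs_mul, abs_of_nonneg (pow_nonneg ha0 n)]
    exact mul_le_mul_of_nonneg_right hm (pow_nonneg ha0 n)
  have := abs_add_le (W - S N * a ^ n + n / (n + 1) * a ^ (n + 1)) ((S N - a) * a ^ n)
  have := pow_nonneg ha0 n
  linarith

/-! sine sums -/

lemma abs_sin_nat_mul (d : ℕ) (x : ℝ) : |Real.sin (d * x)| ≤ d * |Real.sin x| := by
  induction d with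
  | zero => simp
  | succ d ih =>
    push_cast
    rw [add_mul, one_mul, Real.sin_add]
    refine (abs_add_le _ _).trans ?_
    rw [abs_mul, abs_mul]
    nlinarith [Real.abs_cos_le_one x, Real.abs_cos_le_one (d * x), abs_nonneg (Real.sin (d * x)),
      abs_nonneg (Real.sin x)]

lemma sin_partial (θ : ℝ) (D : ℕ) :
    2 * Real.sin (θ / 2) * ∑ d ∈ Ioc 0 D, Real.sin (d * θ)
      = Real.cos (θ / 2) - Real.cos (D * θ + θ / 2) := by
  induction D with
  | zero => simp
  | succ D ih =>
    rw [Finset.sum_Ioc_succ_top (by omega), mul_add, ih]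
    have e1 : Real.cos (D * θ + θ / 2) = Real.cos (((D + 1 : ℕ) : ℝ) * θ - θ / 2) := by
      congr 1; push_cast; ring
    rw [e1, Real.cos_sub, Real.cos_add]
    ring

lemma sine_sum (θ : ℝ) (D : ℕ) : |∑ d ∈ Ioc 0 D, Real.sin (d * θ) / d| ≤ 5 := by
  set s := |Real.sin (θ / 2)| with hs
  have hs0 : 0 ≤ s := abs_nonneg _
  have small : ∀ d : ℕ, |Real.sin (d * θ) / d| ≤ 2 * s := by
    intro d
    rcases Nat.eq_zero_or_pos d with rfl | hd
    · simpa using hs0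
    · have hd' : (0 : ℝ) < d := by exact_mod_cast hd
      rw [abs_div, abs_of_pos hd', div_le_iff₀ hd']
      have h1 := abs_sin_nat_mul d θ
      have h2 : |Real.sin θ| ≤ 2 * s := by
        have := abs_sin_nat_mul 2 (θ / 2)
        simpa [mul_div_cancel₀] using this
      nlinarith
  have small' : ∀ D : ℕ, |∑ d ∈ Ioc 0 D, Real.sin (d * θ) / d| ≤ 2 * s * D := by
    intro D
    refine (Finset.abs_sum_le_sum_abs _ _).trans ((Finset.sum_le_card_nsmul _ _ _ fun d _ => small d).trans ?_)
    simp; linarith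
  rcases hs0.eq_or_lt with h0 | hpos
  · have := small' D
    rw [← h0] at this
    linarith
  set P : ℕ → ℝ := fun D => ∑ d ∈ Ioc 0 D, Real.sin (d * θ) with hP
  have hPb : ∀ D, |P D| ≤ 1 / s := by
    intro D
    have h := sin_partial θ D
    rw [le_div_iff₀ hpos]
    have h1 : |2 * Real.sin (θ / 2) * P D| ≤ 2 := by
      rw [hP]; simp only; rw [h]
      refine (abs_sub _ _).trans ?_
      linarith [Real.abs_cos_le_one (θ / 2), Real.abs_cos_le_one (D * θ + θ / 2)]
    rw [abs_mul, abs_mul, abs_two] at h1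
    nlinarith
  set K := ⌊1 / s⌋₊ with hK
  have hK1 : (K : ℝ) ≤ 1 / s := Nat.floor_le (by positivity)
  have hK2 : 1 / s < K + 1 := Nat.lt_floor_add_one _
  have hKs : s * K ≤ 1 := by
    rw [le_div_iff₀ hpos] at hK1; linarith
  rcases le_total D K with hDK | hDK
  · have h1 := small' D
    have : (D : ℝ) ≤ K := by exact_mod_cast hDK
    nlinarith
  · set V : ℕ → ℝ := fun D => ∑ d ∈ Ioc 0 D, Real.sin (d * θ) / d - P D / (D + 1) with hV
    have step : ∀ D, K ≤ D → |V D| ≤ |V K| + (1 / s) * (1 / (K + 1) - 1 / (D + 1)) := by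
      intro D hD
      induction D, hD using Nat.le_induction with
      | base => simp
      | succ D hD ih =>
        have e : V (D + 1) = V D + P (D + 1) * (1 / (D + 1) - 1 / (D + 2)) := by
          simp only [hV, hP]
          rw [Finset.sum_Ioc_succ_top (by omega), Finset.sum_Ioc_succ_top (by omega)]
          push_cast
          generalize ∑ x ∈ Ioc 0 D, Real.sin (x * θ) / x = A
          generalize ∑ x ∈ Ioc 0 D, Real.sin (x * θ) = B
          generalize Real.sin ((D + 1) * θ) = c
          field_simp
          ring
        rw [e]
        have h2 : (0 : ℝ) ≤ 1 / (D + 1) - 1 / (D + 2) := by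
          rw [sub_nonneg]; exact one_div_le_one_div_of_le (by positivity) (by linarith)
        have h3 : |P (D + 1) * (1 / (D + 1) - 1 / (D + 2))| ≤ (1 / s) * (1 / (D + 1) - 1 / (D + 2)) := by
          rw [abs_mul, abs_of_nonneg h2]
          exact mul_le_mul_of_nonneg_right (hPb _) h2
        have h4 := abs_add_le (V D) (P (D + 1) * (1 / (D + 1) - 1 / (D + 2)))
        push_cast
        have e5 : (D : ℝ) + 1 + 1 = D + 2 := by ring
        rw [e5]
        linarith
    have hq : ∀ D : ℕ, K ≤ D → |P D / (D + 1)| ≤ 1 := by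
      intro D hD
      have : (K : ℝ) ≤ D := by exact_mod_cast hD
      rw [abs_div, abs_of_pos (by positivity : (0 : ℝ) < D + 1), div_le_one (by positivity)]
      linarith [hPb D]
    have hVK : |V K| ≤ 3 := by
      simp only [hV]
      refine (abs_sub _ _).trans ?_
      have := small' K
      have := hq K le_rfl
      nlinarith
    have h6 : (1 / s) * (1 / (K + 1) - 1 / (D + 1)) ≤ 1 := by
      have a1 : (0 : ℝ) ≤ 1 / (D + 1) := by positivity
      have a2 : (1 / s) * (1 / (K + 1)) ≤ 1 := by
        rw [mul_one_div, div_le_one (by positivity)]; exact hK2.le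
      have a3 : 0 ≤ 1 / s * (1 / ((D : ℝ) + 1)) := by positivity
      nlinarith
    have h7 := step D hDK
    have h8 := hq D hDK
    have h9 : ∑ d ∈ Ioc 0 D, Real.sin (d * θ) / d = V D + P D / (D + 1) := by simp [hV]
    rw [h9]
    refine (abs_add_le _ _).trans ?_
    linarith

/-! sums of k^{-1-ε} log^q k -/

lemma zsum_step (η : ℝ) (hη : 0 < η) (k : ℕ) (hk : 1 ≤ k) :
    ((k + 1 : ℕ) : ℝ) ^ (-(1 + η)) ≤ ((k : ℝ) ^ (-η) - ((k + 1 : ℕ) : ℝ) ^ (-η)) / η := by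
  have hk' : (0 : ℝ) < k := by exact_mod_cast hk
  have hk1 : (0 : ℝ) < ((k + 1 : ℕ) : ℝ) := by positivity
  rw [le_div_iff₀ hη]
  have e1 : ((k + 1 : ℕ) : ℝ) ^ (-(1 + η)) = ((k + 1 : ℕ) : ℝ) ^ (-η) * (1 / ((k + 1 : ℕ) : ℝ)) := by
    rw [show -(1 + η) = -η + -1 by ring, Real.rpow_add hk1, Real.rpow_neg_one, one_div]
  have e2 : (k : ℝ) ^ (-η) = ((k + 1 : ℕ) : ℝ) ^ (-η) * ((k : ℝ) / ((k + 1 : ℕ) : ℝ)) ^ (-η) := by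
    rw [← Real.mul_rpow hk1.le (by positivity)]
    congr 1; field_simp
  have e3 : 1 + η * (1 / ((k + 1 : ℕ) : ℝ)) ≤ ((k : ℝ) / ((k + 1 : ℕ) : ℝ)) ^ (-η) := by
    rw [Real.rpow_def_of_pos (by positivity)]
    have h1 : Real.log ((k : ℝ) / ((k + 1 : ℕ) : ℝ)) ≤ -(1 / ((k + 1 : ℕ) : ℝ)) := by
      refine (Real.log_le_sub_one_of_pos (by positivity)).trans (le_of_eq ?_)
      field_simp; push_cast; ring
    have h2 : η * (1 / ((k + 1 : ℕ) : ℝ)) ≤ Real.log ((k : ℝ) / ((k + 1 : ℕ) : ℝ)) * (-η) := by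
      nlinarith
    have := Real.add_one_le_exp (Real.log ((k : ℝ) / ((k + 1 : ℕ) : ℝ)) * (-η))
    linarith
  rw [e1, e2]
  have := Real.rpow_pos_of_pos hk1 (-η)
  nlinarith

lemma zsum (η : ℝ) (hη : 0 < η) (N : ℕ) :
    ∑ k ∈ Ioc 0 N, (k : ℝ) ^ (-(1 + η)) ≤ 1 + 1 / η := by
  rcases Nat.eq_zero_or_pos N with rfl | hN
  · simp; positivity
  have : ∑ k ∈ Ioc 0 N, (k : ℝ) ^ (-(1 + η)) ≤ 1 + 1 / η - (N : ℝ) ^ (-η) / η := by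
    induction N, hN using Nat.le_induction with
    | base => simp
    | succ N hN ih =>
      rw [Finset.sum_Ioc_succ_top (by omega)]
      have := zsum_step η hη N hN
      rw [sub_div] at this
      linarith
  have h2 : 0 ≤ (N : ℝ) ^ (-η) / η := by positivity
  linarith

/-- pointwise: `(1+log k)^q ≤ C ε^{-q} k^{ε/2}`. -/
lemma log_pow_le (q : ℕ) : ∃ C > (0 : ℝ), ∀ ε : ℝ, 0 < ε → ε ≤ 1 → ∀ x : ℝ, 1 ≤ x →
    (1 + Real.log x) ^ q ≤ C / ε ^ q * x ^ (ε / 2) := by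
  refine ⟨Real.exp 1 * (2 * q + 2) ^ q, by positivity, fun ε hε hε1 x hx => ?_⟩
  have hx0 : 0 < x := by linarith
  set c := ε / (2 * q + 2) with hc
  have hc0 : 0 < c := by positivity
  have h1 : 1 + Real.log x ≤ (Real.exp 1 * x) ^ c / c := by
    have := Real.log_le_rpow_div (x := Real.exp 1 * x) (by positivity) hc0
    rwa [Real.log_mul (by positivity) hx0.ne', Real.log_exp] at this
  have h0 : 0 ≤ 1 + Real.log x := by linarith [Real.log_nonneg hx]
  have hq0 : (0:ℝ) ≤ q := by positivity
  have hcq : c * q ≤ ε / 2 := by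
    rw [hc, div_mul_eq_mul_div, div_le_div_iff₀ (by positivity) (by norm_num)]
    nlinarith
  calc (1 + Real.log x) ^ q ≤ ((Real.exp 1 * x) ^ c / c) ^ q := pow_le_pow_left₀ h0 h1 q
    _ = (Real.exp 1 * x) ^ (c * q) / c ^ q := by
      rw [div_pow, ← Real.rpow_natCast, ← Real.rpow_mul (by positivity)]
    _ ≤ (Real.exp 1 * x) ^ (ε / 2) / c ^ q := by
      gcongr
      have := Real.one_le_exp (show (0:ℝ) ≤ 1 by norm_num)
      nlinarith
    _ ≤ (Real.exp 1 * x ^ (ε / 2)) / c ^ q := by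
      gcongr
      rw [Real.mul_rpow (by positivity) hx0.le]
      gcongr
      rw [← Real.exp_mul]
      apply Real.exp_le_exp.mpr; linarith
    _ = _ := by
      rw [hc, div_pow]; field_simp

lemma zlogsum (q : ℕ) : ∃ C > (0 : ℝ), ∀ ε : ℝ, 0 < ε → ε ≤ 1 → ∀ N : ℕ,
    ∑ k ∈ Ioc 0 N, (1 + Real.log k) ^ q * (k : ℝ) ^ (-(1 + ε)) ≤ C / ε ^ (q + 1) := by
  obtain ⟨C, hC, h⟩ := log_pow_le q
  refine ⟨C * 3, by positivity, fun ε hε hε1 N => ?_⟩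
  calc _ ≤ ∑ k ∈ Ioc 0 N, C / ε ^ q * (k : ℝ) ^ (-(1 + ε / 2)) := by
        refine Finset.sum_le_sum fun k hk => ?_
        have hk' : (1 : ℝ) ≤ k := by exact_mod_cast (Finset.mem_Ioc.mp hk).1
        have := h ε hε hε1 k hk'
        rw [show -(1 + ε / 2) = ε / 2 + -(1 + ε) by ring, Real.rpow_add (by linarith), ← mul_assoc]
        gcongr
    _ ≤ C / ε ^ q * (1 + 1 / (ε / 2)) := by
        rw [← Finset.mul_sum]
        gcongr
        exact zsum _ (by positivity) N
    _ ≤ C / ε ^ q * (3 / ε) := by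
        gcongr
        rw [le_div_iff₀ hε]; field_simp; linarith
    _ = _ := by rw [pow_succ]; field_simp

lemma zlogsum_summable (q : ℕ) (ε : ℝ) (hε : 0 < ε) (hε1 : ε ≤ 1) :
    Summable fun k : ℕ => (1 + Real.log k) ^ q * (k : ℝ) ^ (-(1 + ε)) := by
  obtain ⟨C, hC, h⟩ := zlogsum q
  have hnn : ∀ k : ℕ, 0 ≤ (1 + Real.log k) ^ q * (k : ℝ) ^ (-(1 + ε)) := fun k => by
    have := Real.log_natCast_nonneg k
    positivity
  refine summable_of_sum_range_le (c := (C / ε ^ (q + 1))) hnn fun n => ?_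
  refine le_trans ?_ (h ε hε hε1 n)
  have : ∑ k ∈ Finset.range n, (1 + Real.log k) ^ q * (k : ℝ) ^ (-(1 + ε)) ≤
    ∑ k ∈ Icc 0 n, (1 + Real.log k) ^ q * (k : ℝ) ^ (-(1 + ε)) :=
    Finset.sum_le_sum_of_subset_of_nonneg (fun k hk => by simp at hk ⊢; omega) fun k _ _ => hnn k
  refine this.trans (le_of_eq ?_)
  rw [← Finset.add_sum_Ioc_eq_sum_Icc (Nat.zero_le n)]
  simp [Real.zero_rpow (by linarith : -ε + -1 ≠ 0)]

lemma zlogsum_tsum (q : ℕ) : ∃ C > (0 : ℝ), ∀ ε : ℝ, 0 < ε → ε ≤ 1 →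
    ∑' k : ℕ, (1 + Real.log k) ^ q * (k : ℝ) ^ (-(1 + ε)) ≤ C / ε ^ (q + 1) := by
  obtain ⟨C, hC, h⟩ := zlogsum q
  refine ⟨C, hC, fun ε hε hε1 => ?_⟩
  have hnn : ∀ k : ℕ, 0 ≤ (1 + Real.log k) ^ q * (k : ℝ) ^ (-(1 + ε)) := fun k => by
    have := Real.log_natCast_nonneg k
    positivity
  refine Real.tsum_le_of_sum_range_le hnn fun n => ?_
  refine le_trans ?_ (h ε hε hε1 n)
  have : ∑ k ∈ Finset.range n, (1 + Real.log k) ^ q * (k : ℝ) ^ (-(1 + ε)) ≤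
    ∑ k ∈ Icc 0 n, (1 + Real.log k) ^ q * (k : ℝ) ^ (-(1 + ε)) :=
    Finset.sum_le_sum_of_subset_of_nonneg (fun k hk => by simp at hk ⊢; omega) fun k _ _ => hnn k
  refine this.trans (le_of_eq ?_)
  rw [← Finset.add_sum_Ioc_eq_sum_Icc (Nat.zero_le n)]
  simp [Real.zero_rpow (by linarith : -ε + -1 ≠ 0)]

end KKY

/-! ## Part 2: rectangles and the argument principle -/

namespace KKY

/-- Integral over the (positively oriented) boundary of the rectangle `[a,c] × [b,d]`. -/
noncomputable def rectInt (F : ℂ → ℂ) (a c b d : ℝ) : ℂ :=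
  (∫ x : ℝ in a..c, F (x + b * I)) - (∫ x : ℝ in a..c, F (x + d * I)) +
      I * (∫ y : ℝ in b..d, F (c + y * I)) -
      I * (∫ y : ℝ in b..d, F (a + y * I))

/-- boundary of rectangle -/
def rectBd (a c b d : ℝ) : Set ℂ :=
  {z | (a ≤ z.re ∧ z.re ≤ c ∧ b ≤ z.im ∧ z.im ≤ d) ∧ (z.re = a ∨ z.re = c ∨ z.im = b ∨ z.im = d)}

/-- closed rectangle -/
def rect (a c b d : ℝ) : Set ℂ := {z | a ≤ z.re ∧ z.re ≤ c ∧ b ≤ z.im ∧ z.im ≤ d}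

lemma rect_eq {a c b d : ℝ} (hac : a ≤ c) (hbd : b ≤ d) :
    rect a c b d = Set.uIcc a c ×ℂ Set.uIcc b d := by
  ext z
  simp [rect, mem_reProdIm, Set.uIcc_of_le hac, Set.uIcc_of_le hbd]
  tauto

lemma rectBd_sub (a c b d : ℝ) : rectBd a c b d ⊆ rect a c b d := fun _ hz => hz.1

lemma rectInt_eq_zero {F : ℂ → ℂ} {a c b d : ℝ} (hac : a ≤ c) (hbd : b ≤ d)
    (hF : DifferentiableOn ℂ F (rect a c b d)) : rectInt F a c b d = 0 := by
  rw [rect_eq hac hbd] at hF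
  have := Complex.integral_boundary_rect_eq_zero_of_differentiableOn F (⟨a, b⟩ : ℂ) (⟨c, d⟩ : ℂ) hF
  simpa [rectInt] using this

section
variable {a c b d : ℝ}

lemma bd_bot (hac : a ≤ c) (hbd : b ≤ d) {x : ℝ} (hx : x ∈ Set.uIcc a c) : (x + b * I : ℂ) ∈ rectBd a c b d := by
  rw [Set.uIcc_of_le hac] at hx
  refine ⟨?_, ?_⟩ <;> simp [hx.1, hx.2, hbd]
lemma bd_top (hac : a ≤ c) (hbd : b ≤ d) {x : ℝ} (hx : x ∈ Set.uIcc a c) : (x + d * I : ℂ) ∈ rectBd a c b d := by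
  rw [Set.uIcc_of_le hac] at hx
  refine ⟨?_, ?_⟩ <;> simp [hx.1, hx.2, hbd]
lemma bd_right (hac : a ≤ c) (hbd : b ≤ d) {y : ℝ} (hy : y ∈ Set.uIcc b d) : (c + y * I : ℂ) ∈ rectBd a c b d := by
  rw [Set.uIcc_of_le hbd] at hy
  refine ⟨?_, ?_⟩ <;> simp [hy.1, hy.2, hac]
lemma bd_left (hac : a ≤ c) (hbd : b ≤ d) {y : ℝ} (hy : y ∈ Set.uIcc b d) : (a + y * I : ℂ) ∈ rectBd a c b d := by
  rw [Set.uIcc_of_le hbd] at hy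
  refine ⟨?_, ?_⟩ <;> simp [hy.1, hy.2, hac]

lemma rectInt_congr {F G : ℂ → ℂ} (hac : a ≤ c) (hbd : b ≤ d)
    (h : Set.EqOn F G (rectBd a c b d)) : rectInt F a c b d = rectInt G a c b d := by
  unfold rectInt
  congr 1
  · congr 1
    · congr 1
      · exact intervalIntegral.integral_congr fun x hx => h (bd_bot hac hbd hx)
      · exact intervalIntegral.integral_congr fun x hx => h (bd_top hac hbd hx)
    · congr 1
      exact intervalIntegral.integral_congr fun x hx => h (bd_right hac hbd hx)
  · congr 1
    exact intervalIntegral.integral_congr fun x hx => h (bd_left hac hbd hx)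

lemma rectInt_add {F G : ℂ → ℂ} (hac : a ≤ c) (hbd : b ≤ d)
    (hF : ContinuousOn F (rectBd a c b d)) (hG : ContinuousOn G (rectBd a c b d)) :
    rectInt (fun z => F z + G z) a c b d = rectInt F a c b d + rectInt G a c b d := by
  have key : ∀ {F : ℂ → ℂ}, ContinuousOn F (rectBd a c b d) →
      IntervalIntegrable (fun x : ℝ => F (x + b * I)) MeasureTheory.volume a c ∧
      IntervalIntegrable (fun x : ℝ => F (x + d * I)) MeasureTheory.volume a c ∧
      IntervalIntegrable (fun x : ℝ => F (c + x * I)) MeasureTheory.volume b d ∧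
      IntervalIntegrable (fun x : ℝ => F (a + x * I)) MeasureTheory.volume b d := by
    intro F hF
    refine ⟨?_, ?_, ?_, ?_⟩ <;> apply ContinuousOn.intervalIntegrable
    · exact hF.comp (Continuous.continuousOn (by fun_prop)) fun x hx => bd_bot hac hbd hx
    · exact hF.comp (Continuous.continuousOn (by fun_prop)) fun x hx => bd_top hac hbd hx
    · exact hF.comp (Continuous.continuousOn (by fun_prop)) fun x hx => bd_right hac hbd hx
    · exact hF.comp (Continuous.continuousOn (by fun_prop)) fun x hx => bd_left hac hbd hx
  obtain ⟨f1, f2, f3, f4⟩ := key hF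
  obtain ⟨g1, g2, g3, g4⟩ := key hG
  unfold rectInt
  rw [intervalIntegral.integral_add f1 g1, intervalIntegral.integral_add f2 g2,
    intervalIntegral.integral_add f3 g3, intervalIntegral.integral_add f4 g4]
  ring

lemma rectInt_const_mul (F : ℂ → ℂ) (k : ℂ) :
    rectInt (fun z => k * F z) a c b d = k * rectInt F a c b d := by
  unfold rectInt
  simp only [intervalIntegral.integral_const_mul]
  ring

lemma log_neg_sub_of_im_pos {z : ℂ} (hz : 0 < z.im) : Complex.log (-z) = Complex.log z - Real.pi * I := by
  apply Complex.ext <;> simp [Complex.log_re, Complex.log_im, Complex.arg_neg_eq_arg_sub_pi_of_im_pos hz]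

lemma log_neg_add_of_im_neg {z : ℂ} (hz : z.im < 0) : Complex.log (-z) = Complex.log z + Real.pi * I := by
  apply Complex.ext <;> simp [Complex.log_re, Complex.log_im, Complex.arg_neg_eq_arg_add_pi_of_im_neg hz]

lemma ftc_hor (p q y : ℝ) (ρ : ℂ) (hy : y ≠ ρ.im) :
    ∫ x : ℝ in p..q, ((x + y * I : ℂ) - ρ)⁻¹ =
      Complex.log ((q + y * I : ℂ) - ρ) - Complex.log ((p + y * I : ℂ) - ρ) := by
  have hne : ∀ x : ℝ, ((x + y * I : ℂ) - ρ).im ≠ 0 := fun x => by simpa [sub_eq_zero] using hy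
  have hne' : ∀ x : ℝ, (x + y * I : ℂ) - ρ ≠ 0 := fun x h => hne x (by rw [h]; simp)
  refine intervalIntegral.integral_eq_sub_of_hasDerivAt (f := fun x : ℝ => Complex.log ((x + y * I : ℂ) - ρ)) (fun x _ => ?_) ?_
  · have h1 : HasDerivAt (fun x : ℝ => (x + y * I : ℂ) - ρ) 1 x :=
      ((Complex.ofRealCLM.hasDerivAt (x := x)).add_const _).sub_const _
    have := h1.clog_real (Or.inr (hne x))
    simpa using this
  · apply Continuous.intervalIntegrable
    exact Continuous.inv₀ (by fun_prop) hne'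

lemma ftc_ver_right (p q x : ℝ) (ρ : ℂ) (hx : ρ.re < x) :
    I * ∫ y : ℝ in p..q, ((x + y * I : ℂ) - ρ)⁻¹ =
      Complex.log ((x + q * I : ℂ) - ρ) - Complex.log ((x + p * I : ℂ) - ρ) := by
  have hne : ∀ y : ℝ, 0 < ((x + y * I : ℂ) - ρ).re := fun y => by simpa using hx
  have hne' : ∀ y : ℝ, (x + y * I : ℂ) - ρ ≠ 0 := fun y h => (hne y).ne' (by rw [h]; simp)
  rw [← intervalIntegral.integral_const_mul]
  refine intervalIntegral.integral_eq_sub_of_hasDerivAt (f := fun y : ℝ => Complex.log ((x + y * I : ℂ) - ρ)) (fun y _ => ?_) ?_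
  · have h1 : HasDerivAt (fun y : ℝ => (x + y * I : ℂ) - ρ) I y := by
      have := (((Complex.ofRealCLM.hasDerivAt (x := y)).mul_const I).const_add (x : ℂ)).sub_const ρ
      simpa using this
    have := h1.clog_real (Or.inl (hne y))
    simpa [div_eq_mul_inv] using this
  · apply Continuous.intervalIntegrable
    exact continuous_const.mul (Continuous.inv₀ (by fun_prop) hne')

lemma ftc_ver_left (p q x : ℝ) (ρ : ℂ) (hx : x < ρ.re) :
    I * ∫ y : ℝ in p..q, ((x + y * I : ℂ) - ρ)⁻¹ =
      Complex.log (-((x + q * I : ℂ) - ρ)) - Complex.log (-((x + p * I : ℂ) - ρ)) := by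
  have hne : ∀ y : ℝ, 0 < (-((x + y * I : ℂ) - ρ)).re := fun y => by simpa using hx
  have hne' : ∀ y : ℝ, (x + y * I : ℂ) - ρ ≠ 0 := fun y h => (hne y).ne' (by rw [h]; simp)
  rw [← intervalIntegral.integral_const_mul]
  refine intervalIntegral.integral_eq_sub_of_hasDerivAt (f := fun y : ℝ => Complex.log (-((x + y * I : ℂ) - ρ))) (fun y _ => ?_) ?_
  · have h1 : HasDerivAt (fun y : ℝ => -((x + y * I : ℂ) - ρ)) (-I) y := by
      have := ((((Complex.ofRealCLM.hasDerivAt (x := y)).mul_const I).const_add (x : ℂ)).sub_const ρ).neg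
      simp only [Complex.ofRealCLM_apply, Complex.ofReal_one, one_mul] at this
      exact this
    have := h1.clog_real (Or.inl (hne y))
    rw [neg_div_neg_eq, div_eq_mul_inv] at this
    exact this
  · apply Continuous.intervalIntegrable
    exact continuous_const.mul (Continuous.inv₀ (by fun_prop) hne')

lemma rectInt_inv (ρ : ℂ) (h1 : a < ρ.re) (h2 : ρ.re < c) (h3 : b < ρ.im) (h4 : ρ.im < d) :
    rectInt (fun z => (z - ρ)⁻¹) a c b d = 2 * Real.pi * I := by
  unfold rectInt
  rw [ftc_hor a c b ρ h3.ne, ftc_hor a c d ρ h4.ne', ftc_ver_right b d c ρ h2, ftc_ver_left b d a ρ h1,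
    log_neg_sub_of_im_pos (by simpa using h4), log_neg_add_of_im_neg (by simpa using h3)]
  ring

end

/-- factoring out a zero -/
lemma factor_zero {U : Set ℂ} (hU : IsOpen U) {g : ℂ → ℂ} (hg : DifferentiableOn ℂ g U) {ρ : ℂ}
    (hρ : ρ ∈ U) (hord : analyticOrderAt g ρ ≠ ⊤) :
    ∃ h : ℂ → ℂ, DifferentiableOn ℂ h U ∧ h ρ ≠ 0 ∧
      ∀ z ∈ U, g z = (z - ρ) ^ (analyticOrderNatAt g ρ) * h z := by
  have hga : AnalyticAt ℂ g ρ := hg.analyticAt (hU.mem_nhds hρ)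
  set m := analyticOrderNatAt g ρ with hm
  have hm' : analyticOrderAt g ρ = (m : ℕ∞) := (Nat.cast_analyticOrderNatAt hord).symm
  obtain ⟨h0, h0a, h0ne, h0eq⟩ := (hga.analyticOrderAt_eq_natCast).mp hm'
  classical
  refine ⟨Function.update (fun z => g z / (z - ρ) ^ m) ρ (h0 ρ), ?_, by simpa using h0ne, ?_⟩
  · intro z hz
    rcases eq_or_ne z ρ with rfl | hne
    · have : (Function.update (fun w => g w / (w - z) ^ m) z (h0 z)) =ᶠ[nhds z] h0 := by
        filter_upwards [h0eq] with w hw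
        rcases eq_or_ne w z with rfl | hwz
        · simp
        · rw [Function.update_of_ne hwz, hw, smul_eq_mul, mul_div_cancel_left₀]
          exact pow_ne_zero _ (sub_ne_zero.mpr hwz)
      exact (this.differentiableAt_iff.mpr h0a.differentiableAt).differentiableWithinAt
    · have : (Function.update (fun w => g w / (w - ρ) ^ m) ρ (h0 ρ)) =ᶠ[nhds z] fun w => g w / (w - ρ) ^ m := by
        filter_upwards [isOpen_ne.mem_nhds hne] with w hw
        rw [Function.update_of_ne hw]
      refine (this.differentiableAt_iff.mpr ?_).differentiableWithinAt
      refine (hg.differentiableAt (hU.mem_nhds hz)).div (by fun_prop) ?_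
      exact pow_ne_zero _ (sub_ne_zero.mpr hne)
  · intro z hz
    rcases eq_or_ne z ρ with rfl | hne
    · have := h0eq.self_of_nhds
      simpa using this
    · rw [Function.update_of_ne hne, mul_div_cancel₀]
      exact pow_ne_zero _ (sub_ne_zero.mpr hne)

lemma arg_principle {U : Set ℂ} (hU : IsOpen U) {f : ℂ → ℂ} (hf : DifferentiableOn ℂ f U)
    {a c b d : ℝ} (hac : a < c) (hbd : b < d) (hK : rect a c b d ⊆ U) (Z : Finset ℂ) :
    ∀ g : ℂ → ℂ, DifferentiableOn ℂ g U → 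
    (∀ ρ ∈ Z, a < ρ.re ∧ ρ.re < c ∧ b < ρ.im ∧ ρ.im < d) →
    (∀ z ∈ rect a c b d, g z = 0 → z ∈ Z) → 
    (∀ ρ ∈ Z, analyticOrderAt g ρ ≠ ⊤) →
    rectInt (fun z => deriv g z / g z * f z) a c b d =
      2 * Real.pi * I * ∑ ρ ∈ Z, (analyticOrderNatAt g ρ : ℂ) * f ρ := by
  classical
  induction Z using Finset.induction_on with
  | empty =>
    intro g hg _ hz _
    simp only [Finset.sum_empty, mul_zero]
    apply rectInt_eq_zero hac.le hbd.le
    refine DifferentiableOn.mul (DifferentiableOn.div ((hg.deriv hU).mono hK) (hg.mono hK) ?_) (hf.mono hK)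
    intro z hz' h0
    simpa using hz z hz' h0
  | insert ρ Z hρZ ih =>
    intro g hg hZ hz hord
    have hρ := hZ ρ (Finset.mem_insert_self _ _)
    have hρK : ρ ∈ rect a c b d := ⟨hρ.1.le, hρ.2.1.le, hρ.2.2.1.le, hρ.2.2.2.le⟩
    obtain ⟨h, hh, hhρ, hfac⟩ := factor_zero hU hg (hK hρK) (hord ρ (Finset.mem_insert_self _ _))
    set m := analyticOrderNatAt g ρ with hm
    have hordh : ∀ ρ' ∈ Z, analyticOrderAt h ρ' = analyticOrderAt g ρ' := by
      intro ρ' hρ'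
      have hne : ρ' ≠ ρ := fun e => hρZ (e ▸ hρ')
      have hin := hZ ρ' (Finset.mem_insert_of_mem hρ')
      have hU' : ρ' ∈ U := hK ⟨hin.1.le, hin.2.1.le, hin.2.2.1.le, hin.2.2.2.le⟩
      have e : g =ᶠ[nhds ρ'] (fun z => (z - ρ) ^ m) * h := by
        filter_upwards [hU.mem_nhds hU'] with z hz
        simpa using hfac z hz
      rw [analyticOrderAt_congr e, analyticOrderAt_mul (by fun_prop) (hh.analyticAt (hU.mem_nhds hU'))]
      have : analyticOrderAt (fun z => (z - ρ) ^ m) ρ' = 0 := by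
        rw [AnalyticAt.analyticOrderAt_eq_zero (by fun_prop)]
        exact pow_ne_zero _ (sub_ne_zero.mpr hne)
      rw [this, zero_add]
    have ih' := ih h hh (fun ρ' hρ' => hZ ρ' (Finset.mem_insert_of_mem hρ'))
      (fun z hzK hz0 => by
        have := hz z hzK (by rw [hfac z (hK hzK), hz0, mul_zero])
        rcases Finset.mem_insert.mp this with rfl | h'
        · exact absurd hz0 hhρ
        · exact h') (fun ρ' hρ' => by rw [hordh ρ' hρ']; exact hord ρ' (Finset.mem_insert_of_mem hρ'))
    have hbdne : ∀ z ∈ rectBd a c b d, z ∉ insert ρ Z := by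
      intro z hzb hzZ
      have := hZ z hzZ
      rcases hzb.2 with h | h | h | h <;> linarith [this.1, this.2.1, this.2.2.1, this.2.2.2]
    have hgne : ∀ z ∈ rectBd a c b d, g z ≠ 0 := fun z hzb h0 => hbdne z hzb (hz z hzb.1 h0)
    have hzρ : ∀ z ∈ rectBd a c b d, z - ρ ≠ 0 := fun z hzb h0 =>
      hbdne z hzb (by rw [sub_eq_zero.mp h0]; exact Finset.mem_insert_self _ _)
    have hhne : ∀ z ∈ rectBd a c b d, h z ≠ 0 := fun z hzb h0 => hgne z hzb (by
      rw [hfac z (hK hzb.1), h0, mul_zero])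
    have hsub : rectBd a c b d ⊆ U := (rectBd_sub a c b d).trans hK
    have hdf : DifferentiableOn ℂ (dslope f ρ) U :=
      (Complex.differentiableOn_dslope (hU.mem_nhds (hK hρK))).mpr hf
    have e : Set.EqOn (fun z => deriv g z / g z * f z)
        (fun z => deriv h z / h z * f z + ((m : ℂ) * dslope f ρ z + ((m : ℂ) * f ρ) * (z - ρ)⁻¹))
        (rectBd a c b d) := by
      intro z hzb
      have hzU := hsub hzb
      have e1 : g =ᶠ[nhds z] (fun z => (z - ρ) ^ m * h z) := by
        filter_upwards [hU.mem_nhds hzU] with w hw using hfac w hw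
      have hhd := (hh.differentiableAt (hU.mem_nhds hzU)).hasDerivAt
      have hpd : HasDerivAt (fun z => (z - ρ) ^ m) (m * (z - ρ) ^ (m - 1) * 1) z :=
        ((hasDerivAt_id z).sub_const ρ).pow m
      have e2 : deriv g z = m * (z - ρ) ^ (m - 1) * 1 * h z + (z - ρ) ^ m * deriv h z := by
        rw [e1.deriv_eq]; exact (hpd.mul hhd).deriv
      have hne := hzρ z hzb
      have hhn := hhne z hzb
      have e3 : deriv g z / g z = deriv h z / h z + m * (z - ρ)⁻¹ := by
        rw [e2, hfac z hzU]
        rcases Nat.eq_zero_or_pos m with h0 | hpos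
        · rw [h0]; simp
        · obtain ⟨k, hk⟩ : ∃ k, m = k + 1 := ⟨m - 1, by omega⟩
          rw [hk, Nat.add_sub_cancel, pow_succ]
          have := pow_ne_zero k hne
          field_simp
          ring
      simp only
      rw [e3, dslope_of_ne f (sub_ne_zero.mp hne), slope_def_field]
      field_simp
      ring
    have c1 : ContinuousOn (fun z => deriv h z / h z * f z) (rectBd a c b d) :=
      (((hh.deriv hU).continuousOn.mono hsub).div (hh.continuousOn.mono hsub) hhne).mul
        (hf.continuousOn.mono hsub)
    have c2 : ContinuousOn (fun z => (m : ℂ) * dslope f ρ z) (rectBd a c b d) :=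
      continuousOn_const.mul (hdf.continuousOn.mono hsub)
    have c3 : ContinuousOn (fun z => ((m : ℂ) * f ρ) * (z - ρ)⁻¹) (rectBd a c b d) :=
      continuousOn_const.mul (ContinuousOn.inv₀ (by fun_prop) hzρ)
    have c23 : ContinuousOn (fun z => (m : ℂ) * dslope f ρ z + ((m : ℂ) * f ρ) * (z - ρ)⁻¹)
      (rectBd a c b d) := c2.add c3
    rw [rectInt_congr hac.le hbd.le e, rectInt_add hac.le hbd.le c1 c23,
      rectInt_add hac.le hbd.le c2 c3, ih', rectInt_const_mul, rectInt_const_mul,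
      rectInt_inv ρ hρ.1 hρ.2.1 hρ.2.2.1 hρ.2.2.2, rectInt_eq_zero hac.le hbd.le (hdf.mono hK),
      Finset.sum_insert hρZ, ← hm]
    have : ∑ x ∈ Z, (analyticOrderNatAt h x : ℂ) * f x = ∑ x ∈ Z, (analyticOrderNatAt g x : ℂ) * f x :=
      Finset.sum_congr rfl fun x hx => by rw [analyticOrderNatAt, hordh x hx, ← analyticOrderNatAt]
    rw [this]
    ring

end KKY

/-! ## Part 3: Borel–Carathéodory for log-derivatives, three lines with Gaussian weight -/

namespace KKY

lemma bc_logderiv {f : ℂ → ℂ} {c : ℂ} {R r M : ℝ} (hr : 0 < r) (hrR : r < R) (hM : 0 < M)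
    (hf : DifferentiableOn ℂ f (Metric.ball c R)) (hne : ∀ z ∈ Metric.ball c R, f z ≠ 0)
    (hb : ∀ z ∈ Metric.ball c R, ‖f z‖ ≤ Real.exp M * ‖f c‖) :
    ∀ z ∈ Metric.closedBall c r, ‖deriv f z / f z‖ ≤ 8 * R / (R - r) ^ 2 * M := by
  have hR : 0 < R := hr.trans hrR
  have hcb : c ∈ Metric.ball c R := Metric.mem_ball_self hR
  have hld : DifferentiableOn ℂ (fun z => deriv f z / f z) (Metric.ball c R) :=
    (hf.deriv Metric.isOpen_ball).div hf hne
  obtain ⟨G, hG⟩ := hld.isExactOn_ball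
  set g : ℂ → ℂ := fun z => G z - G c with hg
  have hgd : ∀ z ∈ Metric.ball c R, HasDerivAt g (deriv f z / f z) z := fun z hz =>
    (hG z hz).sub_const _
  have hexp : ∀ z ∈ Metric.ball c R, f z = f c * Complex.exp (g z) := by
    have hd : ∀ z ∈ Metric.ball c R, HasDerivAt (fun z => f z * Complex.exp (-g z)) 0 z := by
      intro z hz
      have h1 := (hf.differentiableAt (Metric.isOpen_ball.mem_nhds hz)).hasDerivAt
      have h2 := h1.mul ((hgd z hz).neg.cexp)
      have h0 := hne z hz
      have e : deriv f z * Complex.exp (-g z) + f z * (Complex.exp (-g z) * -(deriv f z / f z)) = 0 := by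
        field_simp
        ring
      exact h2.congr_deriv e
    intro z hz
    have := (convex_ball c R).is_const_of_fderivWithin_eq_zero (𝕜 := ℂ)
      (fun w hw => (hd w hw).differentiableAt.differentiableWithinAt)
      (fun w hw => by
        rw [fderivWithin_of_isOpen Metric.isOpen_ball hw]
        ext; simp [(hd w hw).hasFDerivAt.fderiv]) hz hcb
    simp only [hg, sub_self, neg_zero, Complex.exp_zero, mul_one] at this
    rw [← this, mul_assoc, ← Complex.exp_add]
    simp [hg]
  set r' := (r + R) / 2 with hr'
  have hgb : ∀ z ∈ Metric.closedBall c r', ‖g z‖ ≤ 2 * M * R / (R - r') := by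
    intro z hz
    have hzR : z ∈ Metric.ball c R := Metric.closedBall_subset_ball (by linarith) hz
    have := Complex.borelCaratheodory_zero (f := fun w => g (c + w)) (M := M) (R := R) (z := z - c) hM
      (by
        intro w hw
        have hw' : c + w ∈ Metric.ball c R := by simpa using hw
        exact (((hgd _ hw').differentiableAt).comp w (by fun_prop)).differentiableWithinAt)
      (by
        intro w hw
        have hw' : c + w ∈ Metric.ball c R := by simpa using hw
        have h1 := hb _ hw'
        rw [hexp _ hw', norm_mul, Complex.norm_exp, mul_comm] at h1
        have h2 := le_of_mul_le_mul_right h1 (norm_pos_iff.mpr (hne c hcb))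
        exact Real.exp_le_exp.mp h2) hR (by simpa [dist_eq_norm] using hzR) (by simp [hg])
    simp only [add_sub_cancel] at this
    have hz1 : ‖z - c‖ ≤ r' := by simpa [dist_eq_norm] using hz
    refine this.trans ?_
    have : 0 < R - r' := by linarith
    gcongr
    linarith
  intro z hz
  have hz1 : dist z c ≤ r := hz
  have hsub : Metric.closedBall z ((R - r) / 2) ⊆ Metric.closedBall c r' := by
    apply Metric.closedBall_subset_closedBall'
    rw [hr']; linarith
  have hzR : z ∈ Metric.ball c R := Metric.closedBall_subset_ball hrR hz
  have hdc : DiffContOnCl ℂ g (Metric.ball z ((R - r) / 2)) := by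
    apply DifferentiableOn.diffContOnCl
    intro w hw
    have : w ∈ Metric.ball c R :=
      Metric.closedBall_subset_ball (by linarith) (hsub (Metric.closure_ball_subset_closedBall hw))
    exact (hgd w this).differentiableAt.differentiableWithinAt
  have := Complex.norm_deriv_le_of_forall_mem_sphere_norm_le (by linarith : 0 < (R - r) / 2) hdc
    (fun w hw => hgb w (hsub (Metric.sphere_subset_closedBall hw)))
  rw [(hgd z hzR).deriv] at this
  refine this.trans (le_of_eq ?_)
  have h1 : R - r ≠ 0 := by linarith
  have h2 : R - r' = (R - r) / 2 := by rw [hr']; ring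
  rw [h2]
  field_simp
  ring

lemma gauss3 {f : ℂ → ℂ} {a b T A Q C0 B K : ℝ} (hab : a < b) (ha2 : |a| ≤ 2) (hb2 : |b| ≤ 2)
    (hQ : 0 < Q) (hA : 0 ≤ A) (hB : 0 ≤ B)
    (hf : DiffContOnCl ℂ f (re ⁻¹' Set.Ioo a b))
    (hgrow : ∀ z : ℂ, a < z.re → z.re < b → ‖f z‖ ≤ C0 * Real.exp (B * |z.im|))
    (hfa : ∀ t : ℝ, ‖f (a + t * I)‖ ≤ A * Real.exp (K * |t - T|))
    (hfb : ∀ t : ℝ, ‖f (b + t * I)‖ ≤ A * Q ^ (b - a) * Real.exp (K * |t - T|)) :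
    ∀ σ : ℝ, a ≤ σ → σ ≤ b → ‖f (σ + T * I)‖ ≤ Real.exp (4 + K ^ 2) * A * Q ^ (σ - a) := by
  intro σ hσa hσb
  set g : ℂ → ℂ := fun s => f s * (Complex.exp (-(s - a) * Real.log Q) * Complex.exp ((s - T * I) ^ 2)) with hg
  have hn1 : ∀ s : ℂ, ‖Complex.exp (-(s - a) * Real.log Q)‖ = Q ^ (-(s.re - a)) := by
    intro s
    rw [Complex.norm_exp, Real.rpow_def_of_pos hQ]
    congr 1
    simp [Complex.mul_re]
    ring
  have hn2 : ∀ s : ℂ, ‖Complex.exp ((s - T * I) ^ 2)‖ = Real.exp (s.re ^ 2 - (s.im - T) ^ 2) := by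
    intro s
    rw [Complex.norm_exp]
    congr 1
    simp [pow_two, Complex.mul_re]
  have hsq : ∀ x : ℝ, a ≤ x → x ≤ b → x ^ 2 ≤ 4 := by
    intro x h1 h2
    have := abs_le.mp ha2
    have := abs_le.mp hb2
    nlinarith
  have hK : ∀ x : ℝ, K * |x| - x ^ 2 ≤ K ^ 2 := by
    intro x
    rw [← sq_abs x]
    nlinarith [sq_nonneg (|x| - K / 2), sq_nonneg K]
  have key : ‖g (σ + T * I)‖ ≤ Real.exp (4 + K ^ 2) * A := by
    refine PhragmenLindelof.vertical_strip (a := a) (b := b) (f := g) ?_ ?_ ?_ ?_ (by simpa using hσa) (by simpa using hσb)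
    · refine DiffContOnCl.smul hf (Differentiable.diffContOnCl ?_)
      fun_prop
    · refine ⟨Real.pi / (2 * (b - a)), ?_, B / (Real.pi / (2 * (b - a))), ?_⟩
      · apply div_lt_div_of_pos_left Real.pi_pos (by linarith) (by linarith)
      · set c := Real.pi / (2 * (b - a)) with hc
        have hc0 : 0 < c := by
          have : 0 < b - a := by linarith
          have := Real.pi_pos
          positivity
        apply Asymptotics.IsBigO.of_bound (|C0| * ((Q ^ (-(b - a)) + 1) * Real.exp 4))
        refine eventually_inf_principal.mpr (Eventually.of_forall fun z hz => ?_)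
        have hz1 : a < z.re := hz.1
        have hz2 : z.re < b := hz.2
        simp only [hg, norm_mul, hn1, hn2, Real.norm_eq_abs, Real.abs_exp]
        have e1 : ‖f z‖ ≤ |C0| * Real.exp (B / c * Real.exp (c * |z.im|)) := by
          refine (hgrow z hz1 hz2).trans ?_
          refine mul_le_mul (le_abs_self _) ?_ (by positivity) (by positivity)
          apply Real.exp_le_exp.mpr
          rw [div_mul_eq_mul_div, le_div_iff₀ hc0]
          have := Real.add_one_le_exp (c * |z.im|)
          nlinarith
        have e2 : Q ^ (-(z.re - a)) ≤ Q ^ (-(b - a)) + 1 := by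
          rcases le_total 1 Q with h | h
          · have : Q ^ (-(z.re - a)) ≤ 1 := Real.rpow_le_one_of_one_le_of_nonpos h (by linarith)
            have : 0 < Q ^ (-(b - a)) := Real.rpow_pos_of_pos hQ _
            linarith
          · have : Q ^ (-(z.re - a)) ≤ Q ^ (-(b - a)) :=
              Real.rpow_le_rpow_of_exponent_ge hQ h (by linarith)
            linarith
        have e3 : Real.exp (z.re ^ 2 - (z.im - T) ^ 2) ≤ Real.exp 4 := by
          apply Real.exp_le_exp.mpr
          nlinarith [hsq z.re hz1.le hz2.le, sq_nonneg (z.im - T)]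
        calc _ ≤ (|C0| * Real.exp (B / c * Real.exp (c * |z.im|))) * ((Q ^ (-(b - a)) + 1) * Real.exp 4) := by
              gcongr
          _ = _ := by ring
    · intro z hz
      simp only [hg, norm_mul, hn1, hn2]
      have hz' : z = a + z.im * I := by rw [← hz]; exact (Complex.re_add_im z).symm
      have h1 := hfa z.im
      rw [← hz'] at h1
      rw [hz, sub_self, neg_zero, Real.rpow_zero, one_mul]
      calc _ ≤ A * Real.exp (K * |z.im - T|) * Real.exp (a ^ 2 - (z.im - T) ^ 2) := by gcongr
        _ = A * Real.exp (K * |z.im - T| - (z.im - T) ^ 2 + a ^ 2) := by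
            rw [mul_assoc, ← Real.exp_add]; congr 2; ring
        _ ≤ A * Real.exp (4 + K ^ 2) := by
            refine mul_le_mul_of_nonneg_left (Real.exp_le_exp.mpr ?_) hA
            linarith [hK (z.im - T), hsq a le_rfl hab.le]
        _ = _ := by ring
    · intro z hz
      simp only [hg, norm_mul, hn1, hn2]
      have hz' : z = b + z.im * I := by rw [← hz]; exact (Complex.re_add_im z).symm
      have h1 := hfb z.im
      rw [← hz'] at h1
      rw [hz]
      calc _ ≤ A * Q ^ (b - a) * Real.exp (K * |z.im - T|) * (Q ^ (-(b - a)) * Real.exp (b ^ 2 - (z.im - T) ^ 2)) := by gcongr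
        _ = A * (Q ^ (b - a) * Q ^ (-(b - a))) * (Real.exp (K * |z.im - T|) * Real.exp (b ^ 2 - (z.im - T) ^ 2)) := by ring
        _ = A * Real.exp (K * |z.im - T| - (z.im - T) ^ 2 + b ^ 2) := by
            rw [← Real.rpow_add hQ, ← Real.exp_add]; simp; left; ring
        _ ≤ A * Real.exp (4 + K ^ 2) := by
            refine mul_le_mul_of_nonneg_left (Real.exp_le_exp.mpr ?_) hA
            linarith [hK (z.im - T), hsq b hab.le le_rfl]
        _ = _ := by ring
  simp only [hg, norm_mul, hn1, hn2] at key
  simp only [Complex.add_re, Complex.ofReal_re, Complex.mul_re, Complex.I_re, mul_zero, Complex.ofReal_im,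
    Complex.I_im, mul_one, sub_self, add_zero, Complex.add_im, Complex.mul_im, zero_add] at key
  have e1 : (1 : ℝ) ≤ Real.exp (σ ^ 2 - 0 ^ 2) := Real.one_le_exp (by nlinarith [sq_nonneg σ])
  have hQp := Real.rpow_pos_of_pos hQ (-(σ - a))
  have e2 : ‖f (σ + T * I)‖ * Q ^ (-(σ - a)) ≤ Real.exp (4 + K ^ 2) * A := by
    refine le_trans ?_ key
    rw [← mul_assoc]
    exact le_mul_of_one_le_right (by positivity) e1
  rw [Real.rpow_neg hQ.le, ← div_eq_mul_inv, div_le_iff₀ (Real.rpow_pos_of_pos hQ _)] at e2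
  exact e2

end KKY

namespace KKY

lemma mellin_bdd {f : ℝ → ℂ} {a b : ℝ} (ha : MellinConvergent f a) (hb : MellinConvergent f b) :
    ∃ C : ℝ, ∀ s : ℂ, a ≤ s.re → s.re ≤ b → ‖mellin f s‖ ≤ C := by
  have ha' := ha.norm
  have hb' := hb.norm
  refine ⟨∫ t in Set.Ioi (0:ℝ), (‖(t:ℂ) ^ ((a:ℂ) - 1) • f t‖ + ‖(t:ℂ) ^ ((b:ℂ) - 1) • f t‖),
    fun s h1 h2 => ?_⟩
  unfold mellin
  refine MeasureTheory.norm_integral_le_of_norm_le (ha'.add hb') ?_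
  refine (MeasureTheory.ae_restrict_iff' measurableSet_Ioi).mpr (Eventually.of_forall ?_)
  intro t ht
  have ht' : (0:ℝ) < t := ht
  simp only [norm_smul, Pi.add_apply]
  rw [norm_cpow_eq_rpow_re_of_pos ht', norm_cpow_eq_rpow_re_of_pos ht',
    norm_cpow_eq_rpow_re_of_pos ht', ← add_mul]
  refine mul_le_mul_of_nonneg_right ?_ (norm_nonneg _)
  simp only [sub_re, ofReal_re, one_re]
  have p1 := Real.rpow_nonneg ht'.le (a-1)
  have p2 := Real.rpow_nonneg ht'.le (b-1)
  rcases le_total 1 t with h | h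
  · have := Real.rpow_le_rpow_of_exponent_le h (sub_le_sub_right h2 1)
    linarith
  · have := Real.rpow_le_rpow_of_exponent_ge ht' h (sub_le_sub_right h1 1)
    linarith

lemma gamma_bdd {a b : ℝ} (ha : 0 < a) (hb : 0 < b) :
    ∃ C : ℝ, ∀ s : ℂ, a ≤ s.re → s.re ≤ b → ‖Gamma s‖ ≤ C := by
  have hc : ∀ c : ℝ, 0 < c → MellinConvergent (fun x : ℝ => ((Real.exp (-x) : ℝ) : ℂ)) c := by
    intro c hc
    have := GammaIntegral_convergent (s := (c:ℂ)) (by simpa using hc)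
    unfold MellinConvergent
    refine this.congr_fun (fun x _ => ?_) measurableSet_Ioi
    simp [mul_comm]
  obtain ⟨C, hC⟩ := mellin_bdd (hc a ha) (hc b hb)
  refine ⟨C, fun s h1 h2 => ?_⟩
  have := hC s h1 h2
  rw [Gamma_eq_integral (by linarith), GammaIntegral_eq_mellin]
  simpa using this

lemma gamma_half (t : ℝ) :
    ‖Gamma (1/2 + t * I)‖ * Real.exp (Real.pi * |t| / 2) ≤ 3 := by
  have h := Gamma_mul_Gamma_one_sub (1/2 + t * I)
  have h1 : (1 : ℂ) - (1/2 + t * I) = (starRingEnd ℂ) (1/2 + t * I) := by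
    apply Complex.ext <;> simp; norm_num
  rw [h1, Gamma_conj, Complex.mul_conj] at h
  have h2 : sin (Real.pi * (1/2 + t * I)) = ((Real.cosh (Real.pi * t) : ℝ) : ℂ) := by
    rw [show (Real.pi : ℂ) * (1/2 + t * I) = (Real.pi * t : ℂ) * I + Real.pi / 2 by ring,
      Complex.sin_add_pi_div_two, Complex.cos_mul_I]
    push_cast; rfl
  rw [h2, Complex.normSq_eq_norm_sq] at h
  have h3 : ‖Gamma (1/2 + t * I)‖ ^ 2 = Real.pi / Real.cosh (Real.pi * t) := by exact_mod_cast h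
  have h4 : Real.exp (Real.pi * |t|) ≤ 2 * Real.cosh (Real.pi * t) := by
    rw [← Real.cosh_abs, abs_mul, abs_of_pos Real.pi_pos, Real.cosh_eq]
    have := Real.exp_pos (-(Real.pi * |t|))
    linarith
  have h5 : (‖Gamma (1/2 + t * I)‖ * Real.exp (Real.pi * |t| / 2)) ^ 2 ≤ 3 ^ 2 := by
    rw [mul_pow, h3, ← Real.exp_nat_mul]
    push_cast
    rw [show 2 * (Real.pi * |t| / 2) = Real.pi * |t| by ring, div_mul_eq_mul_div,
      div_le_iff₀ (Real.cosh_pos _)]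
    have := Real.pi_lt_four
    have hc := Real.cosh_pos (Real.pi * t)
    have := Real.pi_pos
    nlinarith
  exact le_of_sq_le_sq h5 (by norm_num) |> fun h => h

lemma gamma_strip : ∃ C : ℝ, 0 < C ∧ ∀ x t : ℝ, 1/2 ≤ x → x ≤ 3/2 →
    ‖Gamma (x + t * I)‖ * Real.exp (Real.pi * |t| / 2) ≤ C * (1 + |t|) ^ (x - 1/2) := by
  obtain ⟨C1, hC1⟩ := gamma_bdd (a := 1/2) (b := 3/2) (by norm_num) (by norm_num)
  have key : ∀ x t : ℝ, 1/2 ≤ x → x ≤ 3/2 → 0 ≤ t →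
    ‖Gamma (x + t * I)‖ * Real.exp (Real.pi * |t| / 2) ≤
      (Real.exp (4+1^2) * 3) * (1 + |t|) ^ (x - 1/2) := by
    intro x t hx1 hx2 ht
    have hn : ∀ z : ℂ, ‖Gamma z * cexp (-(I * Real.pi * z / 2))‖ =
        ‖Gamma z‖ * Real.exp (Real.pi * z.im / 2) := by
      intro z
      rw [norm_mul, Complex.norm_exp]
      congr 2
      simp
      ring
    have hd : ∀ z : ℂ, 0 < z.re → DifferentiableAt ℂ
        (fun z => Gamma z * cexp (-(I * Real.pi * z / 2))) z := by
      intro z hz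
      refine (Complex.differentiableAt_Gamma z ?_).mul (by fun_prop)
      intro m hm
      rw [hm] at hz
      simp at hz
      have : (0:ℝ) ≤ m := by positivity
      linarith
    have hle : ∀ u : ℝ, u ≤ |u| := le_abs_self
    have := gauss3 (f := fun z => Gamma z * cexp (-(I * Real.pi * z / 2))) (a := 1/2) (b := 3/2)
      (Q := 1 + |t|) (A := 3) (B := Real.pi/2) (C0 := C1) (K := 1) (T := t)
      (by norm_num) (by rw [abs_of_pos] <;> norm_num) (by rw [abs_of_pos] <;> norm_num)
      (by positivity) (by norm_num) (by positivity) ?_ ?_ ?_ ?_ x hx1 hx2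
    · rw [hn] at this
      simp only [add_im, ofReal_im, mul_im, ofReal_re, I_im, mul_one, I_re, mul_zero, add_zero, zero_add] at this
      rw [abs_of_nonneg ht] at *
      exact this
    · refine DifferentiableOn.diffContOnCl fun z hz => (hd z ?_).differentiableWithinAt
      have : z ∈ re ⁻¹' (Set.Icc (1/2) (3/2)) := by
        refine closure_minimal ?_ (isClosed_Icc.preimage continuous_re) hz
        exact Set.preimage_mono Set.Ioo_subset_Icc_self
      have := this.1
      linarith
    · intro z h1 h2
      rw [hn]
      refine mul_le_mul (hC1 z h1.le h2.le) (Real.exp_le_exp.mpr ?_) (Real.exp_pos _).le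
        ((norm_nonneg _).trans (hC1 z h1.le h2.le))
      have := hle z.im
      have := Real.pi_pos
      nlinarith
    · intro u
      rw [hn]
      have := gamma_half u
      have h2 : Real.exp (Real.pi * ((((1/2 : ℝ) : ℂ) + u * I).im) / 2) ≤ Real.exp (Real.pi * |u| / 2) := by
        refine Real.exp_le_exp.mpr ?_
        have := hle u
        have := Real.pi_pos
        simp
        nlinarith
      have h3 : (1:ℝ) ≤ Real.exp (1 * |u - t|) := Real.one_le_exp (by positivity)
      push_cast at *
      calc _ ≤ ‖Gamma (1/2 + u * I)‖ * Real.exp (Real.pi * |u| / 2) :=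
            mul_le_mul_of_nonneg_left h2 (norm_nonneg _)
        _ ≤ 3 * 1 := by linarith
        _ ≤ _ := by gcongr
    · intro u
      rw [hn]
      have := gamma_half u
      have h2 : Real.exp (Real.pi * ((((3/2 : ℝ) : ℂ) + u * I).im) / 2) ≤ Real.exp (Real.pi * |u| / 2) := by
        refine Real.exp_le_exp.mpr ?_
        have := hle u
        have := Real.pi_pos
        simp
        nlinarith
      have h3 : 1 + |u - t| ≤ Real.exp (1 * |u - t|) := by
        have := Real.add_one_le_exp (1 * |u-t|); linarith
      have h4 : Gamma (((3/2 : ℝ) : ℂ) + u * I) = (1/2 + u * I) * Gamma (1/2 + u * I) := by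
        rw [← Gamma_add_one]
        · congr 1; push_cast; ring
        · intro h
          have := congrArg Complex.re h
          simp at this
      have h5 : ‖(1/2 + u * I : ℂ)‖ ≤ 1 + |u| := by
        refine (norm_add_le _ _).trans ?_
        simp
        norm_num
      have h6 : 1 + |u| ≤ (1 + |t|) * (1 + |u - t|) := by
        have := abs_sub_abs_le_abs_sub u t
        nlinarith [abs_nonneg t, abs_nonneg (u-t)]
      rw [h4, norm_mul]
      calc _ ≤ ((1 + |u|) * ‖Gamma (1/2 + u * I)‖) * Real.exp (Real.pi * |u| / 2) :=
            mul_le_mul (mul_le_mul_of_nonneg_right h5 (norm_nonneg _)) h2 (Real.exp_pos _).le (by positivity)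
        _ = (1 + |u|) * (‖Gamma (1/2 + u * I)‖ * Real.exp (Real.pi * |u| / 2)) := by ring
        _ ≤ ((1 + |t|) * (1 + |u - t|)) * 3 := by gcongr
        _ ≤ ((1 + |t|) * Real.exp (1 * |u - t|)) * 3 := by gcongr
        _ = _ := by
          rw [show (3/2 - 1/2 : ℝ) = 1 by norm_num, Real.rpow_one]; ring
  refine ⟨Real.exp (4+1^2) * 3, by positivity, fun x t h1 h2 => ?_⟩
  rcases le_total 0 t with h | h
  · exact key x t h1 h2 h
  · have := key x (-t) h1 h2 (by linarith)
    rw [abs_neg, show ((x:ℂ) + ((-t : ℝ):ℂ) * I) = (starRingEnd ℂ) (x + t * I) by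
      apply Complex.ext <;> simp, Gamma_conj, Complex.norm_conj] at this
    exact this

lemma gamma_bound : ∃ C : ℝ, 0 < C ∧ ∀ x t : ℝ, 1/2 ≤ x →
    ‖Gamma (x + t * I)‖ * Real.exp (Real.pi * |t| / 2) ≤ C * (1 + |t| + x) ^ (x - 1/2) := by
  obtain ⟨C, hC, h⟩ := gamma_strip
  refine ⟨C, hC, ?_⟩
  have key : ∀ n : ℕ, ∀ x t : ℝ, 1/2 ≤ x → x ≤ 3/2 + n →
    ‖Gamma (x + t * I)‖ * Real.exp (Real.pi * |t| / 2) ≤ C * (1 + |t| + x) ^ (x - 1/2) := by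
    intro n
    induction n with
    | zero =>
      intro x t h1 h2
      refine (h x t h1 (by simpa using h2)).trans ?_
      refine mul_le_mul_of_nonneg_left (Real.rpow_le_rpow (by positivity) (by linarith) (by linarith)) hC.le
    | succ n ih =>
      intro x t h1 h2
      rcases le_total x (3/2 + n) with h3 | h3
      · exact ih x t h1 h3
      have hn : (0:ℝ) ≤ n := by positivity
      have h4 := ih (x - 1) t (by linarith) (by push_cast at h2; linarith)
      have h5 : Gamma (x + t * I) = (((x - 1 : ℝ) : ℂ) + t * I) * Gamma (((x - 1 : ℝ) : ℂ) + t * I) := by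
        rw [← Gamma_add_one]
        · congr 1; push_cast; ring
        · intro h
          have := congrArg Complex.re h
          simp at this
          linarith
      have h6 : ‖(((x - 1 : ℝ) : ℂ) + t * I : ℂ)‖ ≤ 1 + |t| + x := by
        refine (norm_add_le _ _).trans ?_
        simp only [norm_mul, norm_real, norm_I, mul_one, Real.norm_eq_abs]
        rw [abs_of_pos (by linarith)]
        linarith
      rw [h5, norm_mul, mul_assoc]
      have hp : 0 < 1 + |t| + x := by have := abs_nonneg t; linarith
      calc _ ≤ (1 + |t| + x) * (C * (1 + |t| + (x-1)) ^ ((x - 1) - 1/2)) := by gcongr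
        _ ≤ (1 + |t| + x) * (C * (1 + |t| + x) ^ ((x - 1) - 1/2)) := by
          refine mul_le_mul_of_nonneg_left (mul_le_mul_of_nonneg_left ?_ hC.le) hp.le
          exact Real.rpow_le_rpow (by have := abs_nonneg t; linarith) (by linarith) (by linarith)
        _ = _ := by
          rw [show x - 1/2 = (x - 1 - 1/2) + 1 by ring, Real.rpow_add hp, Real.rpow_one]; ring
  intro x t hx
  obtain ⟨n, hn⟩ := exists_nat_ge x
  exact key n x t hx (by linarith)

end KKY

namespace KKY

lemma norm_cos_le (z : ℂ) : ‖cos z‖ ≤ Real.exp |z.im| := by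
  rw [Complex.cos, norm_div, Complex.norm_ofNat, div_le_iff₀ (by norm_num)]
  refine (norm_add_le _ _).trans ?_
  rw [Complex.norm_exp, Complex.norm_exp]
  have h1 : Real.exp (z * I).re ≤ Real.exp |z.im| :=
    Real.exp_le_exp.mpr (by simpa using neg_le_abs z.im)
  have h2 : Real.exp (-z * I).re ≤ Real.exp |z.im| :=
    Real.exp_le_exp.mpr (by simpa using le_abs_self z.im)
  linarith

lemma norm_sin_le (z : ℂ) : ‖sin z‖ ≤ Real.exp |z.im| := by
  have := norm_cos_le (z - Real.pi / 2)
  rw [Complex.cos_sub_pi_div_two] at this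
  simpa using this

lemma completed_bdd (a b : ℝ) : ∃ C : ℝ, ∀ s : ℂ, a ≤ s.re → s.re ≤ b →
    ‖completedRiemannZeta₀ s‖ ≤ C := by
  set P := HurwitzZeta.hurwitzEvenFEPair 0
  have hP := P.isStrongFEPair_toStrongFEPair
  obtain ⟨C, hC⟩ := mellin_bdd (hP.hasMellin ((a/2 : ℝ) : ℂ)).1 (hP.hasMellin ((b/2 : ℝ) : ℂ)).1
  refine ⟨C / 2, fun s h1 h2 => ?_⟩
  have := hC (s/2) (by simp; linarith) (by simp; linarith)
  change ‖(P.Λ₀ (s / 2)) / 2‖ ≤ _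
  rw [norm_div, Complex.norm_ofNat]
  gcongr
  exact this

lemma zeta1_apriori : ∃ C B : ℝ, 0 ≤ B ∧ ∀ s : ℂ, -(1/2) ≤ s.re → s.re ≤ 3/2 →
    ‖riemannZeta₁ s / (s + 3)‖ ≤ C * Real.exp (B * |s.im|) := by
  obtain ⟨C1, hC1⟩ := completed_bdd (-(1/2)) (3/2)
  obtain ⟨C2, hC2⟩ := gamma_bdd (a := 1/4) (b := 5/4) (by norm_num) (by norm_num)
  have hK : IsCompact (rect (-(1/2)) (3/2) (-1) 1) := by
    have : rect (-(1/2)) (3/2) (-1) 1 = Set.Icc (-(1/2) : ℝ) (3/2) ×ℂ Set.Icc (-1:ℝ) 1 := by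
      ext z; simp [rect, mem_reProdIm, and_assoc]
    rw [this]
    exact isCompact_Icc.reProdIm isCompact_Icc
  have hne : ∀ s : ℂ, -(1/2) ≤ s.re → s + 3 ≠ 0 := by
    intro s hs h
    have := congrArg Complex.re h
    simp at this
    linarith
  have hcont : ContinuousOn (fun s => riemannZeta₁ s / (s + 3)) (rect (-(1/2)) (3/2) (-1) 1) := by
    refine differentiable_riemannZeta₁.continuous.continuousOn.div (by fun_prop) ?_
    intro s hs
    exact hne s hs.1
  obtain ⟨C3, hC3⟩ := hK.exists_bound_of_continuousOn hcont
  have hC1' : 0 ≤ C1 := (norm_nonneg _).trans (hC1 0 (by simp) (by simp; norm_num))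
  have hC2' : 0 ≤ C2 := (norm_nonneg _).trans (hC2 1 (by simp; norm_num) (by simp; norm_num))
  have hC3' : 0 ≤ C3 := (norm_nonneg _).trans (hC3 0 (by simp [rect]; norm_num))
  refine ⟨C3 + (C1 + 2) * (Real.pi * C2), Real.pi/2, by positivity, fun s h1 h2 => ?_⟩
  have hexp : 1 ≤ Real.exp (Real.pi/2 * |s.im|) := Real.one_le_exp (by positivity)
  rcases le_total |s.im| 1 with h | h
  · have := hC3 s ⟨h1, h2, (abs_le.mp h).1, (abs_le.mp h).2⟩
    refine this.trans ?_
    have : 0 ≤ (C1 + 2) * (Real.pi * C2) := by positivity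
    nlinarith
  have him : s.im ≠ 0 := by intro h0; rw [h0] at h; simp at h; linarith
  have hs0 : s ≠ 0 := by rintro rfl; simp at him
  have hs1 : s ≠ 1 := by rintro rfl; simp at him
  have e1 : riemannZeta₁ s = (s - 1) * riemannZeta s := by
    rw [riemannZeta_eq_inv_sub_mul hs1]
    field_simp [sub_ne_zero.mpr hs1]
  have e2 := riemannZeta_eq_completedRiemannZeta₀ hs0
  have e3 := Gamma_mul_Gamma_one_sub (s/2)
  have hG : Gamma (s/2) ≠ 0 := Gamma_ne_zero (by
    intro m hm
    have := congrArg Complex.im hm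
    simp at this
    exact him this)
  have hsin : sin (Real.pi * (s/2)) ≠ 0 := by
    intro h0
    rw [Complex.sin_eq_zero_iff] at h0
    obtain ⟨k, hk⟩ := h0
    have := congrArg Complex.im hk
    simp at this
    exact him this
  have e4 : (Gamma (s/2))⁻¹ = Gamma (1 - s/2) * sin (Real.pi * (s/2)) / Real.pi := by
    rw [eq_div_iff hsin] at e3
    refine inv_eq_of_mul_eq_one_right ?_
    rw [mul_div_assoc', ← mul_assoc, e3, div_self]
    exact_mod_cast Real.pi_ne_zero
  have n1 : ‖(s - 1) / (s + 3)‖ ≤ 1 := by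
    rw [norm_div, div_le_one (norm_pos_iff.mpr (hne s h1))]
    rw [← sq_le_sq₀ (norm_nonneg _) (norm_nonneg _), Complex.sq_norm, Complex.sq_norm,
      normSq_apply, normSq_apply]
    simp
    nlinarith
  have n2 : ‖completedRiemannZeta₀ s - 1 / s - 1 / (1 - s)‖ ≤ C1 + 2 := by
    have a1 : ‖1 / s‖ ≤ 1 := by
      rw [norm_div, norm_one, div_le_one (norm_pos_iff.mpr hs0)]
      exact h.trans (abs_im_le_norm s)
    have a2 : ‖1 / (1 - s)‖ ≤ 1 := by
      rw [norm_div, norm_one, div_le_one (norm_pos_iff.mpr (sub_ne_zero.mpr hs1.symm))]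
      refine h.trans ?_
      have := abs_im_le_norm (1 - s)
      simpa using this
    calc _ ≤ ‖completedRiemannZeta₀ s - 1 / s‖ + ‖1 / (1 - s)‖ := norm_sub_le _ _
      _ ≤ ‖completedRiemannZeta₀ s‖ + ‖1 / s‖ + ‖1 / (1 - s)‖ := by gcongr; exact norm_sub_le _ _
      _ ≤ _ := by linarith [hC1 s h1 h2]
  have n3 : ‖((Real.pi : ℂ) ^ (-s / 2))⁻¹‖ ≤ Real.pi := by
    rw [norm_inv, norm_cpow_eq_rpow_re_of_pos Real.pi_pos, ← Real.rpow_neg Real.pi_pos.le]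
    conv_rhs => rw [← Real.rpow_one Real.pi]
    refine Real.rpow_le_rpow_of_exponent_le (by linarith [Real.pi_gt_three]) ?_
    simp
    linarith
  have n4 : ‖(Gamma (s/2))⁻¹‖ ≤ C2 * Real.exp (Real.pi/2 * |s.im|) := by
    rw [e4, norm_div, norm_mul]
    have b1 := hC2 (1 - s/2) (by simp; linarith) (by simp; linarith)
    have b2 := norm_sin_le (Real.pi * (s/2))
    have b3 : |((Real.pi : ℂ) * (s/2)).im| = Real.pi/2 * |s.im| := by
      simp [abs_mul, abs_div, abs_of_pos Real.pi_pos]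
      ring
    rw [b3] at b2
    have b4 : 1 ≤ ‖(Real.pi : ℂ)‖ := by
      simp [abs_of_pos Real.pi_pos]; linarith [Real.pi_gt_three]
    refine (div_le_self (by positivity) b4).trans ?_
    gcongr
  have e5 : riemannZeta₁ s / (s + 3) = ((s - 1) / (s + 3)) * ((completedRiemannZeta₀ s - 1 / s - 1 / (1 - s)) *
      (((Real.pi : ℂ) ^ (-s / 2))⁻¹ * (Gamma (s/2))⁻¹)) := by
    rw [e1, e2, div_eq_mul_inv _ ((Real.pi : ℂ) ^ (-s / 2) * Gamma (s/2)), mul_inv]; ring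
  rw [e5, norm_mul, norm_mul, norm_mul]
  calc _ ≤ 1 * ((C1 + 2) * (Real.pi * (C2 * Real.exp (Real.pi/2 * |s.im|)))) := by gcongr
    _ ≤ _ := by
      have : 0 ≤ C3 * Real.exp (Real.pi/2 * |s.im|) := by positivity
      nlinarith
end KKY

namespace KKY

lemma logMul_iter (j k : ℕ) : (LSeries.logMul^[j] 1) k = ((Real.log k : ℝ) : ℂ) ^ j := by
  induction j with
  | zero => simp
  | succ j ih =>
    rw [Function.iterate_succ_apply', LSeries.logMul, ih, pow_succ, natCast_log]
    ring

lemma zeta_deriv_hasSum (j : ℕ) {s : ℂ} (hs : 1 < s.re) :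
    HasSum (fun k : ℕ => (-((Real.log k : ℝ) : ℂ)) ^ j * (k : ℂ) ^ (-s))
      (iteratedDeriv j riemannZeta s) := by
  have habs : LSeries.abscissaOfAbsConv 1 < s.re := by
    rw [LSeries.abscissaOfAbsConv_one]; exact_mod_cast hs
  have e1 : riemannZeta =ᶠ[nhds s] LSeries 1 := by
    have : {z : ℂ | 1 < z.re} ∈ nhds s := (isOpen_lt continuous_const continuous_re).mem_nhds hs
    filter_upwards [this] with z hz
    exact (LSeries_one_eq_riemannZeta hz).symm
  rw [e1.iteratedDeriv_eq, LSeries_iteratedDeriv j habs]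
  have hsum : LSeriesSummable (LSeries.logMul^[j] 1) s := by
    refine LSeriesSummable_of_abscissaOfAbsConv_lt_re ?_
    rw [LSeries.absicssaOfAbsConv_logPowMul]
    exact habs
  have h := hsum.LSeriesHasSum.mul_left ((-1) ^ j)
  have e : (fun k : ℕ => (-((Real.log k : ℝ) : ℂ)) ^ j * (k : ℂ) ^ (-s)) =
      fun k => (-1) ^ j * LSeries.term (LSeries.logMul^[j] 1) s k := by
    funext k
    rw [LSeries.term_def]
    split_ifs with h0
    · have : s ≠ 0 := by rintro rfl; simp at hs; linarith
      simp [h0, this]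
    · rw [logMul_iter, cpow_neg, neg_pow, div_eq_mul_inv]; ring
  rw [e]
  exact h

lemma vm_hasSum {s : ℂ} (hs : 1 < s.re) :
    HasSum (fun k : ℕ => ((ArithmeticFunction.vonMangoldt k : ℝ) : ℂ) * (k : ℂ) ^ (-s))
      (-(deriv riemannZeta s / riemannZeta s)) := by
  have h := (ArithmeticFunction.LSeriesSummable_vonMangoldt hs).LSeriesHasSum
  rw [ArithmeticFunction.LSeries_vonMangoldt_eq_deriv_riemannZeta_div hs, neg_div] at h
  have e : (fun k : ℕ => ((ArithmeticFunction.vonMangoldt k : ℝ) : ℂ) * (k : ℂ) ^ (-s)) =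
      LSeries.term (fun k => ((ArithmeticFunction.vonMangoldt k : ℝ) : ℂ)) s := by
    funext k
    rw [LSeries.term_def₀ (by simp)]
  rw [e]
  exact h

lemma hasSum_bound {c : ℕ → ℂ} {s a : ℂ} {B : ℝ} {g : ℕ → ℝ}
    (h : HasSum (fun k : ℕ => c k * (k : ℂ) ^ (-s)) a) (hs : 0 < s.re)
    (hc : ∀ k : ℕ, 1 ≤ k → ‖c k‖ * (k : ℝ) ^ (-s.re) ≤ g k)
    (hg : ∀ N : ℕ, ∑ k ∈ Ioc 0 N, g k ≤ B) : ‖a‖ ≤ B := by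
  have h1 := ((tendsto_add_atTop_iff_nat 1).mpr h.tendsto_sum_nat).norm
  refine le_of_tendsto h1 (Eventually.of_forall fun N => ?_)
  refine (norm_sum_le _ _).trans (le_trans ?_ (hg N))
  have hs0 : s ≠ 0 := by rintro rfl; simp at hs
  have e : range (N + 1) = insert 0 (Ioc 0 N) := by
    ext k; simp
  rw [e, Finset.sum_insert (by simp)]
  simp only [Nat.cast_zero, ne_eq, neg_eq_zero, hs0, not_false_eq_true, zero_cpow, mul_zero, norm_zero, zero_add]
  refine Finset.sum_le_sum fun k hk => ?_
  have hk1 : 1 ≤ k := (Finset.mem_Ioc.mp hk).1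
  rw [norm_mul, norm_natCast_cpow_of_pos hk1]
  simpa using hc k hk1

lemma zeta_right {s : ℂ} (hs : 1 < s.re) : ‖riemannZeta s‖ ≤ 1 + 1 / (s.re - 1) := by
  have h := zeta_deriv_hasSum 0 hs
  simp only [iteratedDeriv_zero] at h
  refine hasSum_bound h (by linarith) (g := fun k => (k:ℝ) ^ (-(1 + (s.re - 1)))) ?_
    (fun N => zsum (s.re - 1) (by linarith) N)
  intro k hk
  simp

lemma log_le_aux (k : ℕ) (q : ℕ) {s ε : ℝ} (hk : 1 ≤ k) (hs : 1 + ε ≤ s) {c : ℂ}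
    (hc : ‖c‖ ≤ (1 + Real.log k) ^ q) :
    ‖c‖ * (k:ℝ) ^ (-s) ≤ (1 + Real.log k) ^ q * (k:ℝ) ^ (-(1+ε)) := by
  have hk' : (1:ℝ) ≤ k := by exact_mod_cast hk
  refine mul_le_mul hc (Real.rpow_le_rpow_of_exponent_le hk' (by linarith)) (by positivity) ?_
  exact (norm_nonneg _).trans hc

lemma zeta_deriv_right (j : ℕ) : ∃ C > (0:ℝ), ∀ ε : ℝ, 0 < ε → ε ≤ 1 → ∀ s : ℂ, 1 + ε ≤ s.re →
    ‖iteratedDeriv j riemannZeta s‖ ≤ C / ε ^ (j + 1) := by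
  obtain ⟨C, hC, h⟩ := zlogsum j
  refine ⟨C, hC, fun ε h1 h2 s hs => ?_⟩
  refine hasSum_bound (zeta_deriv_hasSum j (s := s) (by linarith)) (by linarith) ?_ (h ε h1 h2)
  intro k hk
  refine log_le_aux k j hk hs ?_
  have := Real.log_natCast_nonneg k
  rw [norm_pow, norm_neg, norm_real, Real.norm_of_nonneg this]
  gcongr
  linarith

lemma vm_right : ∃ C > (0:ℝ), ∀ ε : ℝ, 0 < ε → ε ≤ 1 → ∀ s : ℂ, 1 + ε ≤ s.re →
    ‖deriv riemannZeta s / riemannZeta s‖ ≤ C / ε ^ 2 := by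
  obtain ⟨C, hC, h⟩ := zlogsum 1
  refine ⟨C, hC, fun ε h1 h2 s hs => ?_⟩
  rw [← norm_neg]
  refine hasSum_bound (vm_hasSum (s := s) (by linarith)) (by linarith) ?_ (h ε h1 h2)
  intro k hk
  refine log_le_aux k 1 hk hs ?_
  rw [norm_real, Real.norm_of_nonneg ArithmeticFunction.vonMangoldt_nonneg]
  have := ArithmeticFunction.vonMangoldt_le_log (n := k)
  simp
  linarith

/-- The factor in the functional equation `ζ(1-s) = chi s * ζ s`. -/
noncomputable def chi (s : ℂ) : ℂ := 2 * (2 * Real.pi) ^ (-s) * Gamma s * cos (Real.pi * s / 2)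

lemma chi_bound : ∃ C : ℝ, 0 < C ∧ ∀ x t : ℝ, 1/2 ≤ x →
    ‖chi (x + t * I)‖ ≤ C * (2 * Real.pi) ^ (-x) * (1 + |t| + x) ^ (x - 1/2) := by
  obtain ⟨C, hC, h⟩ := gamma_bound
  refine ⟨2 * C, by positivity, fun x t hx => ?_⟩
  have h1 := h x t hx
  have h2 := norm_cos_le (Real.pi * (x + t * I) / 2)
  have h3 : |((Real.pi : ℂ) * (x + t * I) / 2).im| = Real.pi * |t| / 2 := by
    simp [abs_mul, abs_div, abs_of_pos Real.pi_pos]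
  rw [h3] at h2
  have h4 : ‖((2 * Real.pi : ℂ)) ^ (-((x:ℂ) + t * I))‖ = (2 * Real.pi) ^ (-x) := by
    have := norm_cpow_eq_rpow_re_of_pos (x := 2 * Real.pi) (by positivity) (-((x:ℂ) + t * I))
    push_cast at this
    rw [this]
    simp
  unfold chi
  rw [norm_mul, norm_mul, norm_mul, h4, Complex.norm_ofNat]
  calc _ ≤ 2 * (2 * Real.pi) ^ (-x) * ‖Gamma (x + t * I)‖ * Real.exp (Real.pi * |t| / 2) := by gcongr
    _ = 2 * (2 * Real.pi) ^ (-x) * (‖Gamma (x + t * I)‖ * Real.exp (Real.pi * |t| / 2)) := by ring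
    _ ≤ 2 * (2 * Real.pi) ^ (-x) * (C * (1 + |t| + x) ^ (x - 1/2)) := by gcongr
    _ = _ := by ring

lemma zeta_left : ∃ C : ℝ, 1 ≤ C ∧ ∀ x t : ℝ, 0 < x →
    ‖riemannZeta (-x + t * I)‖ ≤
      C * (2 * Real.pi) ^ (-x) * (2 + |t| + x) ^ (x + 1/2) * (1 + 1 / x) := by
  obtain ⟨C, hC, h⟩ := chi_bound
  refine ⟨C + 1, by linarith, fun x t hx => ?_⟩
  set s : ℂ := ((1 + x : ℝ) : ℂ) + ((-t : ℝ) : ℂ) * I with hs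
  have hre : s.re = 1 + x := by simp [hs]
  have e1 : (-x + t * I : ℂ) = 1 - s := by rw [hs]; push_cast; ring
  have e2 := riemannZeta_one_sub (s := s) (by
      intro n hn
      have := congrArg Complex.re hn
      rw [hre] at this
      simp at this
      have : (0:ℝ) ≤ n := by positivity
      linarith) (by
      intro hn
      have := congrArg Complex.re hn
      rw [hre] at this
      simp at this
      linarith)
  have h1 := h (1 + x) (-t) (by linarith)
  have h2 := zeta_right (s := s) (by rw [hre]; linarith)
  rw [hre] at h2
  rw [e1, e2]
  change ‖chi s * _‖ ≤ _
  rw [norm_mul, abs_neg] at *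
  have hp : (2 * Real.pi) ^ (-(1+x)) ≤ (2 * Real.pi) ^ (-x) := by
    refine Real.rpow_le_rpow_of_exponent_le ?_ (by linarith)
    linarith [Real.pi_gt_three]
  have ht := abs_nonneg t
  calc _ ≤ (C * (2 * Real.pi) ^ (-(1+x)) * (1 + |t| + (1 + x)) ^ (1 + x - 1/2)) * (1 + 1 / (1 + x - 1)) := by
        gcongr
    _ ≤ ((C + 1) * (2 * Real.pi) ^ (-x) * (1 + |t| + (1 + x)) ^ (1 + x - 1/2)) * (1 + 1 / (1 + x - 1)) := by
        have : 0 ≤ 1 + 1 / (1 + x - 1) := by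
          have : 0 < 1 + x - 1 := by linarith
          positivity
        refine mul_le_mul_of_nonneg_right ?_ this
        gcongr
        linarith
    _ = _ := by
        rw [show 1 + x - 1 = x by ring, show 1 + x - 1/2 = x + 1/2 by ring,
          show 1 + |t| + (1 + x) = 2 + |t| + x by ring]

end KKY

namespace KKY

lemma zeta1_eq {s : ℂ} (hs : s ≠ 1) : riemannZeta₁ s = (s - 1) * riemannZeta s := by
  rw [riemannZeta_eq_inv_sub_mul hs]
  field_simp [sub_ne_zero.mpr hs]

lemma ratio_le {s : ℂ} (hs : -1 ≤ s.re) : ‖(s - 1) / (s + 3)‖ ≤ 1 := by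
  have hne : s + 3 ≠ 0 := by
    intro h
    have := congrArg Complex.re h
    simp at this
    linarith
  rw [norm_div, div_le_one (norm_pos_iff.mpr hne)]
  rw [← sq_le_sq₀ (norm_nonneg _) (norm_nonneg _), Complex.sq_norm, Complex.sq_norm,
      normSq_apply, normSq_apply]
  simp
  nlinarith

lemma shift_le (c t T : ℝ) (hc : 1 ≤ c) : c + |t| ≤ (c + |T|) * Real.exp |t - T| := by
  have h3 : 1 + |t - T| ≤ Real.exp |t - T| := by
    have := Real.add_one_le_exp |t-T|; linarith
  have := abs_sub_abs_le_abs_sub t T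
  have := abs_nonneg T
  have := abs_nonneg (t - T)
  calc c + |t| ≤ (c + |T|) * (1 + |t - T|) := by nlinarith
    _ ≤ _ := by gcongr

lemma zeta_strip : ∃ C : ℝ, 0 < C ∧ ∀ η : ℝ, 0 < η → η ≤ 1/2 → ∀ σ t : ℝ, -η ≤ σ → σ ≤ 1 + η →
    1/2 ≤ |t| → ‖riemannZeta (σ + t * I)‖ ≤ C / η * (4 + |t|) ^ ((1 - σ + η) / 2) := by
  obtain ⟨C0, B, hB, hgrow⟩ := zeta1_apriori
  obtain ⟨C1, hC1, hleft⟩ := zeta_left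
  refine ⟨9 * (Real.exp (4 + 2 ^ 2) * (C1 * 2)), by positivity, fun η h1 h2 σ T hσ1 hσ2 hT => ?_⟩
  set f : ℂ → ℂ := fun s => riemannZeta₁ s / (s + 3) with hf
  have hne : ∀ s : ℂ, -1 ≤ s.re → s + 3 ≠ 0 := by
    intro s hs h
    have := congrArg Complex.re h
    simp at this
    linarith
  have hQ : 0 < 4 + |T| := by positivity
  have hfz : ∀ s : ℂ, s ≠ 1 → -1 ≤ s.re → ‖f s‖ ≤ ‖riemannZeta s‖ := by
    intro s hs hs'
    rw [hf]
    simp only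
    rw [zeta1_eq hs, mul_div_right_comm, norm_mul]
    exact mul_le_of_le_one_left (norm_nonneg _) (ratio_le hs')
  have hη2 : 1 + 1 / η ≤ 2 / η := by
    rw [← sub_nonneg]
    have : 2 / η - (1 + 1/η) = (1 - η) / η := by field_simp; ring
    rw [this]
    apply div_nonneg <;> linarith
  have key := gauss3 (f := f) (a := -η) (b := 1 + η) (T := T) (A := C1 * (4 + |T|) ^ (η + 1/2) * (2 / η))
    (Q := (4 + |T|) ^ (-(1/2) : ℝ)) (C0 := C0) (B := B) (K := 2) (by linarith)
    (abs_le.mpr ⟨by linarith, by linarith⟩) (abs_le.mpr ⟨by linarith, by linarith⟩)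
    (by positivity) (by positivity) hB ?_ ?_ ?_ ?_ σ hσ1 hσ2
  · set s : ℂ := σ + T * I with hs
    have him : s.im = T := by simp [hs]
    have hs1 : s ≠ 1 := by
      intro h
      have := congrArg Complex.im h
      rw [him] at this
      simp at this
      rw [this] at hT
      norm_num at hT
    have hsre : s.re = σ := by simp [hs]
    have e : riemannZeta s = f s * ((s + 3) / (s - 1)) := by
      rw [hf]
      simp only
      rw [zeta1_eq hs1]
      have := hne s (by linarith)
      have := sub_ne_zero.mpr hs1
      field_simp
    have hr : ‖(s + 3) / (s - 1)‖ ≤ 9 := by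
      have : (s + 3) / (s - 1) = 1 + 4 / (s - 1) := by
        have := sub_ne_zero.mpr hs1
        field_simp
        ring
      rw [this]
      refine (norm_add_le _ _).trans ?_
      have h3 : 1/2 ≤ ‖s - 1‖ := by
        have := abs_im_le_norm (s - 1)
        simp only [sub_im, one_im, sub_zero, him] at this
        linarith
      have : ‖4 / (s - 1)‖ ≤ 8 := by
        rw [norm_div, Complex.norm_ofNat, div_le_iff₀ (by linarith)]
        linarith
      rw [norm_one]
      linarith
    rw [e, norm_mul]
    calc _ ≤ _ * 9 := mul_le_mul key hr (norm_nonneg _) (by positivity)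
      _ = 9 * (Real.exp (4 + 2 ^ 2) * (C1 * 2)) / η *
          ((4 + |T|) ^ (η + 1/2) * ((4 + |T|) ^ (-(1/2) : ℝ)) ^ (σ - -η)) := by ring
      _ = _ := by
        rw [← Real.rpow_mul hQ.le, ← Real.rpow_add hQ]
        congr 2
        ring
  · refine DifferentiableOn.diffContOnCl fun z hz => ?_
    have : z ∈ re ⁻¹' (Set.Icc (-η) (1+η)) := by
      refine closure_minimal ?_ (isClosed_Icc.preimage continuous_re) hz
      exact Set.preimage_mono Set.Ioo_subset_Icc_self
    have := this.1
    exact ((differentiable_riemannZeta₁ z).div (by fun_prop) (hne z (by linarith))).differentiableWithinAt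
  · intro z h3 h4
    exact hgrow z (by linarith) (by linarith)
  · intro t
    refine (hfz _ ?_ ?_).trans ?_
    · intro h
      have := congrArg Complex.re h
      simp at this
      linarith
    · simp; linarith
    have h3 := hleft η t h1
    have h4 : (2 * Real.pi) ^ (-η) ≤ 1 :=
      Real.rpow_le_one_of_one_le_of_nonpos (by linarith [Real.pi_gt_three]) (by linarith)
    have h5 : (2 + |t| + η) ^ (η + 1/2) ≤ (4 + |T|) ^ (η + 1/2) * Real.exp (2 * |t - T|) := by
      calc _ ≤ ((4 + |T|) * Real.exp |t - T|) ^ (η + 1/2) := by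
            refine Real.rpow_le_rpow (by positivity) ?_ (by positivity)
            refine le_trans ?_ (shift_le 4 t T (by norm_num))
            linarith
        _ = (4 + |T|) ^ (η + 1/2) * Real.exp (|t - T| * (η + 1/2)) := by
            rw [Real.mul_rpow hQ.le (Real.exp_pos _).le, ← Real.exp_mul]
        _ ≤ _ := by
            refine mul_le_mul_of_nonneg_left (Real.exp_le_exp.mpr ?_) (by positivity)
            nlinarith [abs_nonneg (t - T)]
    push_cast
    calc _ ≤ _ := h3
      _ ≤ C1 * 1 * ((4 + |T|) ^ (η + 1/2) * Real.exp (2 * |t - T|)) * (2 / η) := by gcongr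
      _ = _ := by ring
  · intro t
    refine (hfz _ ?_ ?_).trans ?_
    · intro h
      have := congrArg Complex.re h
      simp at this
      linarith
    · simp; linarith
    have h3 := zeta_right (s := ((1 + η : ℝ) : ℂ) + t * I) (by simp; linarith)
    refine h3.trans ?_
    rw [← Real.rpow_mul hQ.le]
    have e : C1 * (4 + |T|) ^ (η + 1/2) * (2 / η) * (4 + |T|) ^ (-(1/2) * (1 + η - -η)) = C1 * (2 / η) := by
      rw [mul_right_comm C1, mul_assoc, ← Real.rpow_add hQ,
        show η + 1/2 + -(1/2) * (1 + η - -η) = 0 by ring, Real.rpow_zero, mul_one]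
    rw [e]
    have h6 : (1:ℝ) ≤ Real.exp (2 * |t - T|) := Real.one_le_exp (by positivity)
    calc _ ≤ 1 * (2 / η) * 1 := by
          simp
          have := hη2
          simp at this
          linarith
      _ ≤ _ := by gcongr

end KKY

namespace KKY

lemma zeta_diff_of_im {s : ℂ} (h : s.im ≠ 0) : DifferentiableAt ℂ riemannZeta s := by
  apply differentiableAt_riemannZeta
  rintro rfl
  simp at h

/-- Cauchy estimate on a closed ball. -/
lemma cauchy_ball {f : ℂ → ℂ} {c : ℂ} {R C : ℝ} (n : ℕ) (hR : 0 < R)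
    (hf : ∀ z ∈ Metric.closedBall c R, DifferentiableAt ℂ f z)
    (hC : ∀ z ∈ Metric.closedBall c R, ‖f z‖ ≤ C) :
    ‖iteratedDeriv n f c‖ ≤ n.factorial * C / R ^ n := by
  refine Complex.norm_iteratedDeriv_le_of_forall_mem_sphere_norm_le n hR ?_
    (fun z hz => hC z (Metric.sphere_subset_closedBall hz))
  refine DifferentiableOn.diffContOnCl fun z hz => (hf z ?_).differentiableWithinAt
  exact Metric.closure_ball_subset_closedBall hz

lemma mem_cb {c z : ℂ} {R : ℝ} (hz : z ∈ Metric.closedBall c R) :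
    |z.re - c.re| ≤ R ∧ |z.im - c.im| ≤ R := by
  rw [mem_closedBall_iff_norm] at hz
  constructor
  · have := abs_re_le_norm (z - c)
    rw [sub_re] at this
    linarith
  · have := abs_im_le_norm (z - c)
    rw [sub_im] at this
    linarith

lemma rpow_small {y L c : ℝ} (hy : 1 ≤ y) (hL : 0 < L) (hc : 0 ≤ c) (h : y ≤ Real.exp (2 * L)) :
    y ^ (c / L) ≤ Real.exp (2 * c) := by
  calc y ^ (c / L) ≤ (Real.exp (2 * L)) ^ (c / L) := Real.rpow_le_rpow (by linarith) h (by positivity)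
    _ = _ := by
      rw [← Real.exp_mul]; congr 1; field_simp

lemma zeta_deriv_strip (j : ℕ) : ∃ C : ℝ, 0 < C ∧ ∀ L : ℝ, 4 ≤ L → ∀ σ t : ℝ, -(1/L) ≤ σ →
    σ ≤ 1 + 1/L → 1 ≤ |t| → 5 + |t| ≤ Real.exp (2 * L) →
    ‖iteratedDeriv j riemannZeta (σ + t * I)‖ ≤ C * L ^ (j+1) * (5 + |t|) ^ ((1 - σ) / 2) := by
  obtain ⟨C, hC, h⟩ := zeta_strip
  refine ⟨j.factorial * C * Real.exp 3, by positivity, fun L hL σ t h1 h2 ht hT => ?_⟩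
  have hL0 : 0 < L := by linarith
  have hL1 : 1 / L ≤ 1/4 := by
    rw [div_le_div_iff₀ hL0 (by norm_num)]; linarith
  have hL2 : 0 < 1 / L := by positivity
  have key : ∀ z ∈ Metric.closedBall ((σ:ℂ) + t * I) (1/L), 3/4 ≤ |z.im| ∧
      ‖riemannZeta z‖ ≤ C * L * ((5 + |t|) ^ ((1 - σ) / 2) * Real.exp 3) := by
    intro z hz
    obtain ⟨hz1, hz2⟩ := mem_cb hz
    simp only [add_re, ofReal_re, mul_re, I_re, mul_zero, ofReal_im, I_im, mul_one, sub_self, add_zero, add_im, mul_im, zero_add] at hz1 hz2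
    have hz3 : |t| - |z.im| ≤ 1/L := by
      have := abs_sub_abs_le_abs_sub t z.im
      rw [abs_sub_comm] at this
      linarith
    have hz4 : |z.im| - |t| ≤ 1/L := by
      have := abs_sub_abs_le_abs_sub z.im t
      linarith
    refine ⟨by linarith, ?_⟩
    have hz5 := abs_le.mp hz1
    have e2 : 2 / L = 2 * (1/L) := by ring
    have := h (2/L) (by positivity) (by linarith) z.re z.im (by linarith [hz5.1]) (by linarith [hz5.2]) (by linarith)
    rw [re_add_im] at this
    refine this.trans ?_
    have hb : (1:ℝ) ≤ 5 + |t| := by linarith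
    have b1 : (4 + |z.im|) ^ ((1 - z.re + 2/L)/2) ≤ (5 + |t|) ^ ((1 - z.re + 2/L)/2) :=
      Real.rpow_le_rpow (by positivity) (by linarith) (by linarith [hz5.2])
    have b2 : (5 + |t|) ^ ((1 - z.re + 2/L)/2) ≤ (5 + |t|) ^ ((1 - σ)/2 + (3/2)/L) := by
      refine Real.rpow_le_rpow_of_exponent_le hb ?_
      have : 3/2/L = 3/2 * (1/L) := by ring
      rw [this, e2]
      linarith [hz5.1]
    have b3 : (5 + |t|) ^ ((3/2)/L) ≤ Real.exp 3 := by
      have := rpow_small hb hL0 (c := 3/2) (by norm_num) hT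
      norm_num at this ⊢
      exact this
    rw [Real.rpow_add (by linarith)] at b2
    calc _ ≤ C * L * (4 + |z.im|) ^ ((1 - z.re + 2/L)/2) := by
          refine mul_le_mul_of_nonneg_right ?_ (by positivity)
          rw [div_div_eq_mul_div]
          have : 0 < C * L := by positivity
          linarith
      _ ≤ _ := by
          refine mul_le_mul_of_nonneg_left ?_ (by positivity)
          refine (b1.trans b2).trans ?_
          gcongr
  have := cauchy_ball j hL2 (f := riemannZeta) (fun z hz => zeta_diff_of_im (by
    have := (key z hz).1
    intro h0
    rw [h0] at this
    norm_num at this)) (fun z hz => (key z hz).2)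
  refine this.trans (le_of_eq ?_)
  rw [one_div, inv_pow, div_inv_eq_mul]
  ring

lemma zeta_deriv_left (j : ℕ) : ∃ C : ℝ, 0 < C ∧ ∀ L : ℝ, 4 ≤ L → ∀ x t : ℝ, 1/L ≤ x →
    1 ≤ |t| → 4 + |t| + x ≤ Real.exp (2 * L) →
    ‖iteratedDeriv j riemannZeta (-x + t * I)‖ ≤
      C * L ^ (j+1) * (2 * Real.pi) ^ (-x) * (4 + |t| + x) ^ (x + 1 / 2) := by
  obtain ⟨C, hC, h⟩ := zeta_left
  refine ⟨j.factorial * 2 ^ j * (C * (7 * Real.exp 1 * 3)), by positivity, fun L hL x t h1 ht hT => ?_⟩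
  have hL0 : 0 < L := by linarith
  have hL1 : 1 / L ≤ 1/4 := by
    rw [div_le_div_iff₀ hL0 (by norm_num)]; linarith
  have hL2 : 0 < 1 / L := by positivity
  have e2 : 1/(2*L) = (1/L)/2 := by ring
  have key : ∀ z ∈ Metric.closedBall (-(x:ℂ) + t * I) (1/(2*L)), 3/4 ≤ |z.im| ∧
      ‖riemannZeta z‖ ≤ C * ((2 * Real.pi) ^ (-x) * 7) * ((4 + |t| + x) ^ (x + 1/2) * Real.exp 1) * (3 * L) := by
    intro z hz
    obtain ⟨hz1, hz2⟩ := mem_cb hz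
    simp only [add_re, neg_re, neg_im, ofReal_re, mul_re, I_re, mul_zero, ofReal_im, I_im, mul_one, sub_self, add_zero, add_im, mul_im, zero_add, neg_zero] at hz1 hz2
    have hz3 : |t| - |z.im| ≤ 1/(2*L) := by
      have := abs_sub_abs_le_abs_sub t z.im
      rw [abs_sub_comm] at this
      linarith
    have hz4 : |z.im| - |t| ≤ 1/(2*L) := by
      have := abs_sub_abs_le_abs_sub z.im t
      linarith
    refine ⟨by linarith, ?_⟩
    have hz5 := abs_le.mp hz1
    have := h (-z.re) z.im (by linarith [hz5.2])
    rw [show (-((-z.re : ℝ) : ℂ) + z.im * I) = z by push_cast; rw [neg_neg, re_add_im]] at this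
    refine this.trans ?_
    have b0 : (2 * Real.pi) ^ (-(-z.re)) ≤ (2 * Real.pi) ^ (-x) * 7 := by
      have hp : 1 ≤ 2 * Real.pi := by linarith [Real.pi_gt_three]
      calc (2 * Real.pi) ^ (-(-z.re)) ≤ (2 * Real.pi) ^ (-x + 1) :=
            Real.rpow_le_rpow_of_exponent_le hp (by linarith [hz5.2])
        _ = (2 * Real.pi) ^ (-x) * (2 * Real.pi) := by
            rw [Real.rpow_add (by positivity), Real.rpow_one]
        _ ≤ _ := by gcongr; linarith [Real.pi_lt_d2]
    have b1 : (2 + |z.im| + -z.re) ^ (-z.re + 1/2) ≤ (4 + |t| + x) ^ (-z.re + 1/2) :=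
      Real.rpow_le_rpow (by linarith [hz5.2, abs_nonneg z.im]) (by linarith [hz5.1]) (by linarith [hz5.2])
    have hb : 1 ≤ 4 + |t| + x := by linarith
    have b2 : (4 + |t| + x) ^ (-z.re + 1/2) ≤ (4 + |t| + x) ^ ((x + 1/2) + (1/2)/L) := by
      refine Real.rpow_le_rpow_of_exponent_le hb ?_
      have : 1/2/L = 1/(2*L) := by rw [div_div]
      rw [this]
      linarith [hz5.1]
    have b3 : (4 + |t| + x) ^ ((1/2)/L) ≤ Real.exp 1 := by
      have := rpow_small hb hL0 (c := 1/2) (by norm_num) hT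
      norm_num at this ⊢
      exact this
    rw [Real.rpow_add (by linarith) (x+1/2)] at b2
    have b4 : (4 + |t| + x) ^ (x + 1/2) * (4 + |t| + x) ^ ((1/2)/L) ≤ (4 + |t| + x) ^ (x + 1/2) * Real.exp 1 := by
      gcongr
    have b5 : 1 + 1 / (-z.re) ≤ 3 * L := by
      have h3 : 1/(2*L) ≤ -z.re := by linarith [hz5.2]
      have : 1 / (-z.re) ≤ 1/(1/(2*L)) := one_div_le_one_div_of_le (by positivity) h3
      rw [one_div_one_div] at this
      linarith
    have : 0 ≤ 1 + 1 / (-z.re) := by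
      have : 0 < -z.re := by linarith [hz5.2]
      positivity
    have hb6 := (b1.trans b2).trans b4
    gcongr
    exact Real.rpow_nonneg (by linarith [hz5.2, abs_nonneg z.im]) _
  have := cauchy_ball j (by positivity) (f := riemannZeta) (fun z hz => zeta_diff_of_im (by
    have := (key z hz).1
    intro h0
    rw [h0] at this
    norm_num at this)) (fun z hz => (key z hz).2)
  refine this.trans (le_of_eq ?_)
  rw [one_div (2 * L), inv_pow, div_inv_eq_mul, mul_pow]
  ring

lemma chi_diff {s : ℂ} (hs : s.im ≠ 0) : DifferentiableAt ℂ chi s := by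
  unfold chi
  have h1 : DifferentiableAt ℂ (fun s : ℂ => (2 * (Real.pi:ℂ)) ^ (-s)) s := by
    refine DifferentiableAt.const_cpow (by fun_prop) (Or.inl ?_)
    have := Real.pi_ne_zero
    exact_mod_cast (mul_ne_zero two_ne_zero this)
  have h2 : DifferentiableAt ℂ Gamma s := by
    refine Complex.differentiableAt_Gamma s ?_
    intro m hm
    rw [hm] at hs
    simp at hs
  fun_prop

lemma chi_mul_chi {s : ℂ} (hs : s.im ≠ 0) : chi s * chi (1 - s) = 1 := by
  unfold chi
  have h1 := Gamma_mul_Gamma_one_sub s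
  have hpi : (2 * (Real.pi:ℂ)) ≠ 0 := by
    exact_mod_cast (mul_ne_zero two_ne_zero Real.pi_ne_zero)
  have hpi' : (Real.pi:ℂ) ≠ 0 := by exact_mod_cast Real.pi_ne_zero
  have h2 : (2 * (Real.pi:ℂ)) ^ (-s) * (2 * (Real.pi:ℂ)) ^ (-(1-s)) = (2 * (Real.pi:ℂ))⁻¹ := by
    rw [← cpow_add _ _ hpi, show -s + -(1-s) = -1 by ring, cpow_neg_one]
  have h3 : cos (Real.pi * (1 - s) / 2) = sin (Real.pi * s / 2) := by
    rw [← Complex.cos_pi_div_two_sub]; congr 1; ring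
  have h4 : sin (Real.pi * s) = 2 * sin (Real.pi * s / 2) * cos (Real.pi * s / 2) := by
    rw [← Complex.sin_two_mul]; congr 1; ring
  have hsin : sin (Real.pi * s) ≠ 0 := by
    intro h0
    rw [Complex.sin_eq_zero_iff] at h0
    obtain ⟨k, hk⟩ := h0
    have := congrArg Complex.im hk
    simp at this
    exact hs this
  have h5 : sin (Real.pi * s / 2) * cos (Real.pi * s / 2) = sin (Real.pi * s) / 2 := by
    rw [h4]; ring
  calc _ = 4 * ((2 * (Real.pi:ℂ)) ^ (-s) * (2 * (Real.pi:ℂ)) ^ (-(1-s))) * (Gamma s * Gamma (1-s)) *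
        (sin (Real.pi * s / 2) * cos (Real.pi * s / 2)) := by rw [h3]; ring
    _ = 1 := by
      rw [h2, h1, h5]
      generalize sin (Real.pi * s) = w at *
      field_simp
      norm_num

lemma chi_ne_zero {s : ℂ} (hs : s.im ≠ 0) : chi s ≠ 0 := by
  intro h
  have := chi_mul_chi hs
  rw [h, zero_mul] at this
  exact zero_ne_one this

lemma zeta_fe {s : ℂ} (hs : s.im ≠ 0) : riemannZeta s = chi (1 - s) * riemannZeta (1 - s) := by
  have := riemannZeta_one_sub (s := 1 - s) (by
    intro n hn
    have := congrArg Complex.im hn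
    simp at this
    exact hs this) (by
    intro hn
    have := congrArg Complex.im hn
    simp at this
    exact hs this)
  rw [sub_sub_cancel] at this
  exact this

lemma chi_shift {s : ℂ} (hs : s.im ≠ 0) :
    chi (s + 4) = chi s * ((2 * (Real.pi:ℂ)) ^ 4)⁻¹ * (s * (s + 1) * (s + 2) * (s + 3)) := by
  unfold chi
  have hpi : (2 * (Real.pi:ℂ)) ≠ 0 := by
    exact_mod_cast (mul_ne_zero two_ne_zero Real.pi_ne_zero)
  have hne : ∀ x : ℝ, s + x ≠ 0 := by
    intro x h
    have := congrArg Complex.im h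
    simp at this
    exact hs this
  have g0 := Gamma_add_one s (by simpa using hne 0)
  have g1 := Gamma_add_one (s+1) (by simpa using hne 1)
  have g2 := Gamma_add_one (s+2) (by simpa using hne 2)
  have g3 := Gamma_add_one (s+3) (by simpa using hne 3)
  have c1 : cos (Real.pi * (s + 4) / 2) = cos (Real.pi * s / 2) := by
    rw [← Complex.cos_add_two_pi (Real.pi * s / 2)]; congr 1; ring
  have c2 : (2 * (Real.pi:ℂ)) ^ (-(s + 4)) = (2 * (Real.pi:ℂ)) ^ (-s) * ((2 * (Real.pi:ℂ)) ^ 4)⁻¹ := by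
    rw [neg_add, cpow_add _ _ hpi, cpow_neg _ 4]
    congr 2
    exact_mod_cast cpow_natCast (2 * (Real.pi:ℂ)) 4
  rw [c1, c2, show s + 4 = s + 3 + 1 by ring, g3, show s + 3 = s + 2 + 1 by ring, g2,
    show s + 2 = s + 1 + 1 by ring, g1, g0]
  ring

lemma chi_poly : ∃ C : ℝ, 1 ≤ C ∧ ∀ s : ℂ, -2 ≤ s.re → s.re ≤ 3 → 1/2 ≤ |s.im| →
    ‖chi s‖ ≤ C * (8 + |s.im|) ^ 8 := by
  obtain ⟨C, hC, h⟩ := chi_bound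
  have hR : ∀ s : ℂ, 1/2 ≤ s.re → s.re ≤ 7 → ‖chi s‖ ≤ C * (8 + |s.im|) ^ 8 := by
    intro s h1 h2
    have := h s.re s.im h1
    rw [re_add_im] at this
    refine this.trans ?_
    have b1 : (2 * Real.pi) ^ (-s.re) ≤ 1 :=
      Real.rpow_le_one_of_one_le_of_nonpos (by linarith [Real.pi_gt_three]) (by linarith)
    have b2 : (1 + |s.im| + s.re) ^ (s.re - 1/2) ≤ (8 + |s.im|) ^ 8 := by
      calc _ ≤ (8 + |s.im|) ^ (s.re - 1/2) :=
            Real.rpow_le_rpow (by positivity) (by linarith) (by linarith)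
        _ ≤ (8 + |s.im|) ^ ((8:ℕ):ℝ) :=
            Real.rpow_le_rpow_of_exponent_le (by linarith [abs_nonneg s.im]) (by norm_num; linarith)
        _ = _ := Real.rpow_natCast _ _
    calc _ ≤ C * 1 * (8 + |s.im|) ^ 8 := by gcongr
      _ = _ := by ring
  refine ⟨1 + C * ((2 * Real.pi) ^ 4 * 16), by
    have : 0 ≤ C * ((2 * Real.pi) ^ 4 * 16) := by positivity
    linarith, fun s h1 h2 h3 => ?_⟩
  have him : s.im ≠ 0 := by intro h0; rw [h0] at h3; norm_num at h3
  have e := chi_shift him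
  have hn : ∀ x : ℝ, 1/2 ≤ ‖s + x‖ := by
    intro x
    have := abs_im_le_norm (s + x)
    simp at this
    linarith
  have hP : 1/16 ≤ ‖s * (s + 1) * (s + 2) * (s + 3)‖ := by
    rw [norm_mul, norm_mul, norm_mul]
    have a0 := hn 0
    have a1 := hn 1
    have a2 := hn 2
    have a3 := hn 3
    push_cast at a0 a1 a2 a3
    rw [add_zero] at a0
    calc (1/16:ℝ) = 1/2 * (1/2) * (1/2) * (1/2) := by norm_num
      _ ≤ _ := by gcongr
  have hpi : 0 < (2 * Real.pi) ^ 4 := by positivity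
  have h4 := hR (s + 4) (by simp; linarith) (by simp; linarith)
  rw [e, norm_mul, norm_mul, norm_inv, norm_pow, norm_mul, Complex.norm_ofNat, norm_real,
    Real.norm_of_nonneg Real.pi_pos.le] at h4
  have h5 : (s + 4).im = s.im := by simp
  rw [h5] at h4
  have hB : 0 ≤ (8 + |s.im|) ^ 8 := by positivity
  have h6 : ‖chi s‖ * ((2 * Real.pi) ^ 4)⁻¹ * (1/16) ≤ C * (8 + |s.im|) ^ 8 := by
    refine le_trans ?_ h4
    gcongr
  have h7 : ‖chi s‖ = (‖chi s‖ * ((2 * Real.pi) ^ 4)⁻¹ * (1/16)) * ((2 * Real.pi) ^ 4 * 16) := by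
    field_simp
  rw [h7]
  calc _ ≤ (C * (8 + |s.im|) ^ 8) * ((2 * Real.pi) ^ 4 * 16) := by gcongr
    _ ≤ _ := by nlinarith

lemma chi_logderiv : ∃ C : ℝ, 0 < C ∧ ∀ s : ℂ, -1 ≤ s.re → s.re ≤ 2 → 1 ≤ |s.im| →
    ‖deriv chi s / chi s‖ ≤ C * Real.log (9 + |s.im|) := by
  obtain ⟨C, hC, h⟩ := chi_poly
  set D := 2 * Real.log C + 16 with hD
  have hlC : 0 ≤ Real.log C := Real.log_nonneg hC
  refine ⟨64 * D, by positivity, fun s h1 h2 h3 => ?_⟩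
  set y := 9 + |s.im| with hy
  have hy1 : 10 ≤ y := by rw [hy]; linarith
  have hly : 1 ≤ Real.log y := by
    rw [Real.le_log_iff_exp_le (by linarith)]
    linarith [Real.exp_one_lt_d9]
  have hM : 0 < D * Real.log y := by positivity
  have hz : ∀ z ∈ Metric.ball s (1/2), -2 ≤ z.re ∧ z.re ≤ 3 ∧ 1/2 ≤ |z.im| ∧ 8 + |z.im| ≤ y := by
    intro z hz
    obtain ⟨a1, a2⟩ := mem_cb (Metric.ball_subset_closedBall hz)
    have := abs_le.mp a1
    have := abs_sub_abs_le_abs_sub z.im s.im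
    have := abs_sub_abs_le_abs_sub s.im z.im
    rw [abs_sub_comm] at this
    refine ⟨by linarith, by linarith, by linarith, by linarith⟩
  have him : ∀ z ∈ Metric.ball s (1/2), z.im ≠ 0 := by
    intro z hz' h0
    have := (hz z hz').2.2.1
    rw [h0] at this
    norm_num at this
  have hup : ∀ z ∈ Metric.ball s (1/2), ‖chi z‖ ≤ C * y ^ 8 := by
    intro z hz'
    obtain ⟨a1, a2, a3, a4⟩ := hz z hz'
    refine (h z a1 a2 a3).trans ?_
    gcongr
  have hs : s ∈ Metric.ball s (1/2) := Metric.mem_ball_self (by norm_num)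
  have hlow : 1 ≤ ‖chi s‖ * (C * y ^ 8) := by
    have e := congrArg norm (chi_mul_chi (him s hs))
    rw [norm_mul, norm_one] at e
    rw [← e]
    refine mul_le_mul_of_nonneg_left ?_ (norm_nonneg _)
    have := h (1 - s) (by simp; linarith) (by simp; linarith) (by simp; linarith)
    refine this.trans ?_
    simp only [sub_im, one_im, zero_sub, abs_neg]
    gcongr
    rw [hy]; linarith
  have hexp : Real.exp (D * Real.log y) ≥ (C * y ^ 8) * (C * y ^ 8) := by
    have e1 : (C * y ^ 8) * (C * y ^ 8) = Real.exp (2 * Real.log C + 16 * Real.log y) := by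
      rw [Real.exp_add, mul_comm 2, mul_comm 16, Real.exp_mul, Real.exp_mul, Real.exp_log (by linarith),
        Real.exp_log (by linarith)]
      norm_cast
      ring
    rw [e1]
    refine Real.exp_le_exp.mpr ?_
    rw [hD]
    nlinarith
  have := bc_logderiv (f := chi) (c := s) (R := 1/2) (r := 1/4) (M := D * Real.log y) (by norm_num) (by norm_num) hM
    (fun z hz' => (chi_diff (him z hz')).differentiableWithinAt) (fun z hz' => chi_ne_zero (him z hz')) ?_
    s (Metric.mem_closedBall_self (by norm_num))
  · refine this.trans (le_of_eq ?_)
    norm_num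
    ring
  · intro z hz'
    refine (hup z hz').trans ?_
    have hp : 0 < C * y ^ 8 := by positivity
    calc C * y ^ 8 ≤ (C * y ^ 8) * (‖chi s‖ * (C * y ^ 8)) := by
          exact le_mul_of_one_le_right hp.le hlow
      _ = (C * y ^ 8) * (C * y ^ 8) * ‖chi s‖ := by ring
      _ ≤ _ := by gcongr

lemma chi_deriv_bound (j : ℕ) : ∃ C : ℝ, 0 < C ∧ ∀ L : ℝ, 4 ≤ L → ∀ t : ℝ,
    1 ≤ |t| → 5 + |t| ≤ Real.exp (2 * L) →
    ‖iteratedDeriv j chi (((1 + 1/L : ℝ) : ℂ) + t * I)‖ ≤ C * L ^ j * (5 + |t|) ^ (1/2 : ℝ) := by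
  obtain ⟨C, hC, h⟩ := chi_bound
  refine ⟨j.factorial * C * Real.exp 4, by positivity, fun L hL t ht hT => ?_⟩
  have hL0 : 0 < L := by linarith
  have hL1 : 1 / L ≤ 1/4 := by
    rw [div_le_div_iff₀ hL0 (by norm_num)]; linarith
  have hL2 : 0 < 1 / L := by positivity
  have key : ∀ z ∈ Metric.closedBall (((1 + 1/L : ℝ) : ℂ) + t * I) (1/L), 3/4 ≤ |z.im| ∧
      ‖chi z‖ ≤ C * ((5 + |t|) ^ (1/2 : ℝ) * Real.exp 4) := by
    intro z hz
    obtain ⟨hz1, hz2⟩ := mem_cb hz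
    simp only [add_re, ofReal_re, mul_re, I_re, mul_zero, ofReal_im, I_im, mul_one, sub_self, add_zero, add_im, mul_im, zero_add] at hz1 hz2
    have hz3 : |t| - |z.im| ≤ 1/L := by
      have := abs_sub_abs_le_abs_sub t z.im
      rw [abs_sub_comm] at this
      linarith
    have hz4 : |z.im| - |t| ≤ 1/L := by
      have := abs_sub_abs_le_abs_sub z.im t
      linarith
    refine ⟨by linarith, ?_⟩
    have hz5 := abs_le.mp hz1
    have := h z.re z.im (by linarith [hz5.1])
    rw [re_add_im] at this
    refine this.trans ?_
    have b1 : (2 * Real.pi) ^ (-z.re) ≤ 1 :=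
      Real.rpow_le_one_of_one_le_of_nonpos (by linarith [Real.pi_gt_three]) (by linarith [hz5.1])
    have hb : 1 ≤ 5 + |t| := by linarith
    have b2 : (1 + |z.im| + z.re) ^ (z.re - 1/2) ≤ (5 + |t|) ^ (1/2 + 2 / L) := by
      calc _ ≤ (5 + |t|) ^ (z.re - 1/2) :=
            Real.rpow_le_rpow (by linarith [hz5.1, abs_nonneg z.im]) (by linarith [hz5.2]) (by linarith [hz5.1])
        _ ≤ _ := by
            refine Real.rpow_le_rpow_of_exponent_le hb ?_
            have : 2 / L = 2 * (1/L) := by ring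
            rw [this]
            linarith [hz5.2]
    have b3 := rpow_small hb hL0 (c := 2) (by norm_num) hT
    rw [Real.rpow_add (by linarith)] at b2
    norm_num at b3
    calc _ ≤ C * 1 * ((5 + |t|) ^ (1/2 : ℝ) * (5 + |t|) ^ (2 / L)) := by
          gcongr
          exact Real.rpow_nonneg (by linarith [hz5.1, abs_nonneg z.im]) _
      _ ≤ C * 1 * ((5 + |t|) ^ (1/2 : ℝ) * Real.exp 4) := by gcongr
      _ = _ := by ring
  have := cauchy_ball j hL2 (f := chi) (fun z hz => chi_diff (by
    have := (key z hz).1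
    intro h0
    rw [h0] at this
    norm_num at this)) (fun z hz => (key z hz).2)
  refine this.trans (le_of_eq ?_)
  rw [one_div L, inv_pow, div_inv_eq_mul]
  ring

end KKY

namespace KKY

lemma shift_sum_gt (h : ℕ → ℝ) (hh : ∀ d, 0 ≤ h d) (k N : ℕ) :
    ∑ l ∈ Ioc 0 N, (if k < l then h (l - k) else 0) ≤ ∑ d ∈ Ioc 0 N, h d := by
  rw [← Finset.sum_filter]
  rw [← Finset.sum_image (g := fun l => l - k) (f := h)]
  · apply Finset.sum_le_sum_of_subset_of_nonneg
    · intro d hd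
      simp only [Finset.mem_image, Finset.mem_filter, Finset.mem_Ioc] at hd ⊢
      omega
    · intros; exact hh _
  · intro x hx y hy hxy
    simp only [Finset.coe_filter, Set.mem_ofPred_eq, Finset.mem_Ioc] at hx hy hxy
    omega

lemma shift_sum_lt (h : ℕ → ℝ) (hh : ∀ d, 0 ≤ h d) (k N : ℕ) :
    ∑ l ∈ Ioc 0 N, (if l < k then h (k - l) else 0) ≤ ∑ d ∈ Ioc 0 k, h d := by
  rw [← Finset.sum_filter]
  rw [← Finset.sum_image (g := fun l => k - l) (f := h)]
  · apply Finset.sum_le_sum_of_subset_of_nonneg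
    · intro d hd
      simp only [Finset.mem_image, Finset.mem_filter, Finset.mem_Ioc] at hd ⊢
      omega
    · intros; exact hh _
  · intro x hx y hy hxy
    simp only [Finset.coe_filter, Set.mem_ofPred_eq, Finset.mem_Ioc] at hx hy hxy
    omega

lemma exp_int_bound (u a b : ℝ) (hu : u ≠ 0) :
    ‖∫ t in a..b, Complex.exp (u * t * I)‖ ≤ 2 / |u| := by
  have h1 : ∀ t : ℝ, Complex.exp (u * t * I) = Complex.exp ((u * I) * t) := by
    intro t; congr 1; ring
  simp_rw [h1]
  have hc : (u * I : ℂ) ≠ 0 := by simp [hu]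
  rw [integral_exp_mul_complex hc, norm_div]
  have e : ∀ t : ℝ, ‖Complex.exp ((u * I) * t)‖ = 1 := by
    intro t
    rw [show (u * I : ℂ) * t = ((u * t : ℝ) : ℂ) * I by push_cast; ring]
    exact Complex.norm_exp_ofReal_mul_I _
  have : ‖(u * I : ℂ)‖ = |u| := by simp
  rw [this]
  have h2 := norm_sub_le (Complex.exp ((u * I) * b)) (Complex.exp ((u * I) * a))
  rw [e, e] at h2
  gcongr
  linarith

lemma exp_int_bound' (u a b : ℝ) (hab : a ≤ b) :
    ‖∫ t in a..b, Complex.exp (u * t * I)‖ ≤ b - a := by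
  have := intervalIntegral.norm_integral_le_of_norm_le_const (a := a) (b := b) (C := 1)
    (f := fun t : ℝ => Complex.exp (u * t * I)) (fun t _ => by
      rw [show (u * t * I : ℂ) = ((u * t : ℝ) : ℂ) * I by push_cast; ring]
      exact (Complex.norm_exp_ofReal_mul_I _).le)
  rwa [one_mul, abs_of_nonneg (by linarith)] at this

lemma log_sub_lower {k l : ℕ} (hk : 0 < k) (hkl : k < l) :
    ((l - k : ℕ) : ℝ) / l ≤ Real.log l - Real.log k := by
  have hk' : (0:ℝ) < k := by exact_mod_cast hk
  have hl' : (0:ℝ) < l := by exact_mod_cast hk.trans hkl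
  rw [← Real.log_div hl'.ne' hk'.ne']
  have := Real.one_sub_inv_le_log_of_pos (x := (l:ℝ)/k) (by positivity)
  refine le_trans (le_of_eq ?_) this
  rw [Nat.cast_sub hkl.le]
  field_simp

/-- pairwise bound -/
lemma pair_bound (q : ℕ) {ε : ℝ} (hε : 0 < ε) {k l : ℕ} (hk : 0 < k) (hkl : k < l) :
    ((1 + Real.log k) ^ q * (k:ℝ) ^ (-(1 + ε))) * ((1 + Real.log l) ^ q * (l:ℝ) ^ (-(1 + ε)))
      * (l / ((l - k : ℕ) : ℝ)) ≤
    2 ^ q * ((1 + Real.log k) ^ (2 * q) * (k:ℝ) ^ (-(1 + ε))) *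
      ((1 + Real.log ((l - k : ℕ) : ℝ)) ^ q * (((l - k : ℕ) : ℝ)) ^ (-(1 + ε))) := by
  obtain ⟨d, rfl⟩ := Nat.exists_eq_add_of_lt hkl
  have : k + d + 1 - k = d + 1 := by omega
  rw [this]
  set e : ℝ := ((d + 1 : ℕ) : ℝ) with he
  have he1 : 1 ≤ e := by rw [he]; push_cast; linarith [Nat.cast_nonneg (α := ℝ) d]
  have hk1 : (1:ℝ) ≤ k := by exact_mod_cast hk
  have hl : ((k + d + 1 : ℕ) : ℝ) = k + e := by rw [he]; push_cast; ring
  rw [hl]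
  have lk := Real.log_nonneg hk1
  have le := Real.log_nonneg he1
  have h1 : Real.log (k + e) ≤ Real.log 2 + Real.log k + Real.log e := by
    rw [← Real.log_mul (by norm_num) (by positivity), ← Real.log_mul (by positivity) (by positivity)]
    apply Real.log_le_log (by positivity)
    nlinarith
  have h2 : 1 + Real.log (k + e) ≤ 2 * (1 + Real.log k) * (1 + Real.log e) := by
    have := Real.log_two_lt_d9
    nlinarith [mul_nonneg lk le]
  have h3 : (1 + Real.log (k + e)) ^ q ≤ 2 ^ q * (1 + Real.log k) ^ q * (1 + Real.log e) ^ q := by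
    rw [← mul_pow, ← mul_pow]
    apply pow_le_pow_left₀ _ h2
    linarith [Real.log_nonneg (show (1:ℝ) ≤ k + e by linarith)]
  have h4 : ((k:ℝ) + e) ^ (-(1 + ε)) * ((k + e) / e) ≤ e ^ (-(1 + ε)) := by
    have a1 : ((k:ℝ) + e) ^ (-(1 + ε)) = (k + e) ^ (-ε) * (k + e)⁻¹ := by
      rw [← Real.rpow_neg_one, ← Real.rpow_add (by positivity)]; congr 1; ring
    have a2 : e ^ (-(1 + ε)) = e ^ (-ε) * e⁻¹ := by
      rw [← Real.rpow_neg_one, ← Real.rpow_add (by positivity)]; congr 1; ring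
    rw [a1, a2]
    have : ((k:ℝ) + e) ^ (-ε) * (k + e)⁻¹ * ((k + e) / e) = (k + e) ^ (-ε) * e⁻¹ := by
      field_simp
    rw [this]
    gcongr ?_ * _
    exact Real.rpow_le_rpow_of_nonpos (by positivity) (by linarith) (by linarith)
  calc _ = ((1 + Real.log k) ^ q * (k:ℝ) ^ (-(1 + ε))) * (1 + Real.log (k + e)) ^ q * ((k + e) ^ (-(1 + ε)) * ((k + e) / e)) := by ring
    _ ≤ ((1 + Real.log k) ^ q * (k:ℝ) ^ (-(1 + ε))) * (2 ^ q * (1 + Real.log k) ^ q * (1 + Real.log e) ^ q) * (e ^ (-(1 + ε))) := by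
        gcongr
    _ = _ := by rw [two_mul q, pow_add]; ring

lemma diag_sum (q : ℕ) : ∃ C : ℝ, 0 < C ∧ ∀ ε : ℝ, 0 < ε → ∀ N : ℕ,
    ∑ k ∈ Ioc 0 N, ((1 + Real.log k) ^ q * (k:ℝ) ^ (-(1 + ε))) ^ 2 ≤ C := by
  obtain ⟨C, hC, h⟩ := zlogsum (2 * q)
  refine ⟨C, hC, fun ε hε N => ?_⟩
  have := h 1 one_pos le_rfl N
  simp only [one_pow, div_one] at this
  refine le_trans (Finset.sum_le_sum fun k hk => ?_) this
  have hk1 : (1:ℝ) ≤ k := by exact_mod_cast (Finset.mem_Ioc.mp hk).1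
  have lk := Real.log_nonneg hk1
  rw [mul_pow, ← pow_mul, mul_comm q 2]
  gcongr
  rw [← Real.rpow_natCast, ← Real.rpow_mul (by positivity)]
  apply Real.rpow_le_rpow_of_exponent_le hk1
  push_cast
  linarith

lemma meansq_fin (q : ℕ) : ∃ C : ℝ, 0 < C ∧ ∀ ε : ℝ, 0 < ε → ε ≤ 1 → ∀ c : ℕ → ℂ,
    (∀ k, 1 ≤ k → ‖c k‖ ≤ (1 + Real.log k) ^ q) → ∀ a b : ℝ, a ≤ b → ∀ N : ℕ,
    ∫ t in a..b, ‖∑ k ∈ Ioc 0 N, c k * (k:ℂ) ^ (-(((1 + ε : ℝ) : ℂ) + t * I))‖ ^ 2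
      ≤ C * ((b - a) + 1 / ε ^ (3 * q + 2)) := by
  obtain ⟨C1, hC1, h1⟩ := diag_sum q
  obtain ⟨C2, hC2, h2⟩ := zlogsum (2 * q)
  obtain ⟨C3, hC3, h3⟩ := zlogsum q
  refine ⟨C1 + 2 * (2 * 2 ^ q * C2 * C3), by positivity, fun ε hε hε1 c hc a b hab N => ?_⟩
  set A : ℕ → ℂ := fun k => c k * (k:ℂ) ^ (-((1 + ε : ℝ) : ℂ)) with hA
  set B : ℕ → ℝ := fun k => (1 + Real.log k) ^ q * (k:ℝ) ^ (-(1 + ε)) with hB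
  have hAB : ∀ k ∈ Ioc 0 N, ‖A k‖ ≤ B k := by
    intro k hk
    have hk1 := (Finset.mem_Ioc.mp hk).1
    simp only [hA, hB, norm_mul]
    rw [Complex.norm_natCast_cpow_of_pos hk1]
    simp only [neg_re, ofReal_re]
    gcongr
    exact hc k hk1
  have hB0 : ∀ k ∈ Ioc 0 N, 0 ≤ B k := fun k hk => (norm_nonneg _).trans (hAB k hk)
  have hterm : ∀ t : ℝ, ∀ k ∈ Ioc 0 N, c k * (k:ℂ) ^ (-(((1 + ε : ℝ) : ℂ) + t * I)) =
      A k * Complex.exp (-(Real.log k * t * I)) := by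
    intro t k hk
    have hk1 := (Finset.mem_Ioc.mp hk).1
    have hk0 : (k:ℂ) ≠ 0 := by exact_mod_cast hk1.ne'
    simp only [hA]
    rw [neg_add, Complex.cpow_add _ _ hk0, mul_assoc]
    congr 2
    rw [Complex.cpow_def_of_ne_zero hk0, ← Complex.natCast_log]
    congr 1; push_cast; ring
  have hsq : ∀ t : ℝ, ((‖∑ k ∈ Ioc 0 N, c k * (k:ℂ) ^ (-(((1 + ε : ℝ) : ℂ) + t * I))‖ ^ 2 : ℝ) : ℂ)
      = ∑ k ∈ Ioc 0 N, ∑ l ∈ Ioc 0 N, A k * (starRingEnd ℂ) (A l) *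
        Complex.exp ((Real.log l - Real.log k : ℝ) * t * I) := by
    intro t
    rw [Finset.sum_congr rfl (hterm t)]
    rw [Complex.ofReal_pow, ← Complex.mul_conj', map_sum, Finset.sum_mul_sum]
    refine Finset.sum_congr rfl fun k _ => Finset.sum_congr rfl fun l _ => ?_
    rw [map_mul, ← Complex.exp_conj]
    have : (starRingEnd ℂ) (-(↑(Real.log l) * ↑t * I)) = Real.log l * t * I := by
      rw [map_neg, map_mul, map_mul, Complex.conj_ofReal, Complex.conj_ofReal, Complex.conj_I]
      ring
    rw [this]
    have : Complex.exp (((Real.log l - Real.log k : ℝ) : ℂ) * ↑t * I) =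
      Complex.exp (-(Real.log k * t * I)) * Complex.exp (Real.log l * t * I) := by
        rw [← Complex.exp_add, Complex.ofReal_sub]; congr 1; ring
    rw [this]; ring
  have hIntg : ((∫ t in a..b, ‖∑ k ∈ Ioc 0 N, c k * (k:ℂ) ^ (-(((1 + ε : ℝ) : ℂ) + t * I))‖ ^ 2 : ℝ) : ℂ)
      = ∑ k ∈ Ioc 0 N, ∑ l ∈ Ioc 0 N, A k * (starRingEnd ℂ) (A l) *
        ∫ t in a..b, Complex.exp ((Real.log l - Real.log k : ℝ) * t * I) := by
    rw [← intervalIntegral.integral_ofReal]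
    simp_rw [hsq]
    rw [intervalIntegral.integral_finsetSum]
    · refine Finset.sum_congr rfl fun k _ => ?_
      rw [intervalIntegral.integral_finsetSum]
      · refine Finset.sum_congr rfl fun l _ => ?_
        rw [intervalIntegral.integral_const_mul]
      · intro l _
        apply Continuous.intervalIntegrable
        fun_prop
    · intro l _
      apply Continuous.intervalIntegrable
      fun_prop
  set G : ℕ → ℕ → ℝ := fun k l => if k < l then 2 * (2 ^ q * ((1 + Real.log k) ^ (2 * q) * (k:ℝ) ^ (-(1 + ε))) *
      ((1 + Real.log ((l - k : ℕ) : ℝ)) ^ q * (((l - k : ℕ) : ℝ)) ^ (-(1 + ε)))) else 0 with hG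
  have hpair : ∀ k ∈ Ioc 0 N, ∀ l ∈ Ioc 0 N, k < l → B k * B l * (2 / |Real.log l - Real.log k|) ≤ G k l := by
    intro k hk l hl hkl
    have hk1 := (Finset.mem_Ioc.mp hk).1
    simp only [hG, if_pos hkl]
    have hp := pair_bound q hε hk1 hkl
    have hlow := log_sub_lower hk1 hkl
    have hl0 : (0:ℝ) < l := by exact_mod_cast hk1.trans hkl
    have hd0 : (0:ℝ) < ((l - k : ℕ) : ℝ) := by exact_mod_cast Nat.sub_pos_of_lt hkl
    have hpos : 0 < Real.log l - Real.log k := lt_of_lt_of_le (by positivity) hlow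
    rw [abs_of_pos hpos]
    have : 2 / (Real.log l - Real.log k) ≤ 2 * (l / ((l - k : ℕ) : ℝ)) := by
      rw [div_le_iff₀ hpos]
      calc (2:ℝ) = 2 * (l / ((l - k : ℕ) : ℝ)) * (((l - k : ℕ) : ℝ) / l) := by field_simp
        _ ≤ _ := by gcongr
    have h0 := mul_nonneg (hB0 k hk) (hB0 l hl)
    calc _ ≤ B k * B l * (2 * (l / ((l - k : ℕ) : ℝ))) := by gcongr
      _ = 2 * (B k * B l * (l / ((l - k : ℕ) : ℝ))) := by ring
      _ ≤ _ := by gcongr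
  have hG0 : ∀ k ∈ Ioc 0 N, ∀ l ∈ Ioc 0 N, 0 ≤ G k l := by
    intro k hk l hl
    by_cases hkl : k < l
    · refine le_trans ?_ (hpair k hk l hl hkl)
      have h0 := mul_nonneg (hB0 k hk) (hB0 l hl)
      positivity
    · simp [hG, hkl]
  have hall : ∀ k ∈ Ioc 0 N, ∀ l ∈ Ioc 0 N, ‖A k * (starRingEnd ℂ) (A l) *
        ∫ t in a..b, Complex.exp ((Real.log l - Real.log k : ℝ) * t * I)‖ ≤
        (if k = l then (b - a) * B k ^ 2 else 0) + G k l + G l k := by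
    intro k hk l hl
    rw [norm_mul, norm_mul, RCLike.norm_conj]
    have hAA : ‖A k‖ * ‖A l‖ ≤ B k * B l := mul_le_mul (hAB k hk) (hAB l hl) (norm_nonneg _) (hB0 k hk)
    rcases lt_trichotomy k l with hkl | hkl | hkl
    · have hpos : 0 < Real.log l - Real.log k := by
        have := log_sub_lower (Finset.mem_Ioc.mp hk).1 hkl
        have hl0 : (0:ℝ) < l := by exact_mod_cast (Finset.mem_Ioc.mp hl).1
        have hd0 : (0:ℝ) < ((l - k : ℕ) : ℝ) := by exact_mod_cast Nat.sub_pos_of_lt hkl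
        exact lt_of_lt_of_le (by positivity) this
      have := exp_int_bound (Real.log l - Real.log k) a b hpos.ne'
      calc _ ≤ B k * B l * (2 / |Real.log l - Real.log k|) := mul_le_mul hAA this (norm_nonneg _) (mul_nonneg (hB0 k hk) (hB0 l hl))
        _ ≤ G k l := hpair k hk l hl hkl
        _ ≤ _ := by simp only [if_neg hkl.ne, zero_add]; linarith [hG0 l hl k hk]
    · subst hkl
      have := exp_int_bound' (Real.log k - Real.log k) a b hab
      have hGk : G k k = 0 := by simp [hG]
      rw [if_pos rfl, hGk]
      calc _ ≤ B k * B k * (b - a) := mul_le_mul hAA this (norm_nonneg _) (mul_nonneg (hB0 k hk) (hB0 k hl))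
        _ = _ := by ring
    · have hpos : 0 < Real.log k - Real.log l := by
        have := log_sub_lower (Finset.mem_Ioc.mp hl).1 hkl
        have hl0 : (0:ℝ) < k := by exact_mod_cast (Finset.mem_Ioc.mp hk).1
        have hd0 : (0:ℝ) < ((k - l : ℕ) : ℝ) := by exact_mod_cast Nat.sub_pos_of_lt hkl
        exact lt_of_lt_of_le (by positivity) this
      have := exp_int_bound (Real.log l - Real.log k) a b (by linarith)
      rw [abs_sub_comm] at this
      calc _ ≤ B k * B l * (2 / |Real.log k - Real.log l|) := mul_le_mul hAA this (norm_nonneg _) (mul_nonneg (hB0 k hk) (hB0 l hl))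
        _ = B l * B k * (2 / |Real.log k - Real.log l|) := by ring
        _ ≤ G l k := hpair l hl k hk hkl
        _ ≤ _ := by simp only [if_neg hkl.ne', zero_add]; linarith [hG0 k hk l hl]
  have hGsum : ∑ k ∈ Ioc 0 N, ∑ l ∈ Ioc 0 N, G k l ≤ 2 * 2 ^ q * C2 * C3 / ε ^ (3 * q + 2) := by
    have e1 : ∀ k ∈ Ioc 0 N, ∑ l ∈ Ioc 0 N, G k l ≤ (2 * 2 ^ q * (C3 / ε ^ (q + 1))) * ((1 + Real.log k) ^ (2 * q) * (k:ℝ) ^ (-(1 + ε))) := by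
      intro k hk
      have hk1 : (1:ℝ) ≤ k := by exact_mod_cast (Finset.mem_Ioc.mp hk).1
      have lk := Real.log_nonneg hk1
      have := shift_sum_gt (fun d => (1 + Real.log (d:ℝ)) ^ q * (d:ℝ) ^ (-(1 + ε))) (fun d => by
        have : 0 ≤ Real.log (d:ℝ) := Real.log_natCast_nonneg d
        positivity) k N
      have h3' := this.trans (h3 ε hε hε1 N)
      calc _ = (2 * 2 ^ q * ((1 + Real.log k) ^ (2 * q) * (k:ℝ) ^ (-(1 + ε)))) * ∑ l ∈ Ioc 0 N, (if k < l then (1 + Real.log ((l - k : ℕ):ℝ)) ^ q * ((l - k : ℕ):ℝ) ^ (-(1 + ε)) else 0) := by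
            rw [Finset.mul_sum]
            refine Finset.sum_congr rfl fun l _ => ?_
            simp only [hG]
            split_ifs
            · ring
            · ring
        _ ≤ (2 * 2 ^ q * ((1 + Real.log k) ^ (2 * q) * (k:ℝ) ^ (-(1 + ε)))) * (C3 / ε ^ (q + 1)) := by
            gcongr
        _ = _ := by ring
    refine (Finset.sum_le_sum e1).trans ?_
    rw [← Finset.mul_sum]
    calc _ ≤ (2 * 2 ^ q * (C3 / ε ^ (q + 1))) * (C2 / ε ^ (2 * q + 1)) := by
          gcongr; exact h2 ε hε hε1 N
      _ = _ := by
          rw [show 3 * q + 2 = (q + 1) + (2 * q + 1) by ring, pow_add _ (q + 1)]; field_simp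
  have hfin : ‖((∫ t in a..b, ‖∑ k ∈ Ioc 0 N, c k * (k:ℂ) ^ (-(((1 + ε : ℝ) : ℂ) + t * I))‖ ^ 2 : ℝ) : ℂ)‖ ≤
      (b - a) * C1 + 2 * (2 * 2 ^ q * C2 * C3 / ε ^ (3 * q + 2)) := by
    rw [hIntg]
    calc _ ≤ ∑ k ∈ Ioc 0 N, ∑ l ∈ Ioc 0 N, ((if k = l then (b - a) * B k ^ 2 else 0) + G k l + G l k) :=
          (norm_sum_le _ _).trans (Finset.sum_le_sum fun k hk => (norm_sum_le _ _).trans (Finset.sum_le_sum fun l hl => hall k hk l hl))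
      _ = (b - a) * ∑ k ∈ Ioc 0 N, B k ^ 2 + ∑ k ∈ Ioc 0 N, ∑ l ∈ Ioc 0 N, G k l + ∑ k ∈ Ioc 0 N, ∑ l ∈ Ioc 0 N, G k l := by
          simp_rw [Finset.sum_add_distrib]
          congr 1
          · congr 1
            rw [Finset.mul_sum]
            refine Finset.sum_congr rfl fun k hk => ?_
            rw [Finset.sum_ite_eq, if_pos hk]
          · rw [Finset.sum_comm]
      _ ≤ _ := by
          have := mul_le_mul_of_nonneg_left (h1 ε hε N) (sub_nonneg.mpr hab)
          linarith
  rw [Complex.norm_real] at hfin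
  refine (Real.le_norm_self _).trans (hfin.trans ?_)
  have : 0 ≤ 1 / ε ^ (3 * q + 2) := by positivity
  have hba := sub_nonneg.mpr hab
  have e : 2 * 2 ^ q * C2 * C3 / ε ^ (3 * q + 2) = (2 * 2 ^ q * C2 * C3) * (1 / ε ^ (3 * q + 2)) := by ring
  rw [e]
  have p1 : 0 ≤ C1 * (1 / ε ^ (3 * q + 2)) := by positivity
  have p2 : 0 ≤ (2 * 2 ^ q * C2 * C3) * (b - a) := by positivity
  nlinarith

end KKY

namespace KKY

lemma meansq (q : ℕ) : ∃ C : ℝ, 0 < C ∧ ∀ ε : ℝ, 0 < ε → ε ≤ 1 → ∀ c : ℕ → ℂ,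
    (∀ k, 1 ≤ k → ‖c k‖ ≤ (1 + Real.log k) ^ q) → ∀ F : ℝ → ℂ,
    (∀ t : ℝ, HasSum (fun k : ℕ => c k * (k:ℂ) ^ (-(((1 + ε : ℝ) : ℂ) + t * I))) (F t)) →
    ∀ a b : ℝ, a ≤ b →
    ∫ t in a..b, ‖F t‖ ^ 2 ≤ C * ((b - a) + 1 / ε ^ (3 * q + 2)) := by
  obtain ⟨C, hC, h⟩ := meansq_fin q
  obtain ⟨D, hD, hD'⟩ := zlogsum q
  refine ⟨C, hC, fun ε hε hε1 c hc F hF a b hab => ?_⟩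
  have hcont : ∀ N : ℕ, Continuous fun t : ℝ => ∑ k ∈ Ioc 0 N, c k * (k:ℂ) ^ (-(((1 + ε : ℝ) : ℂ) + t * I)) := by
    intro N
    refine continuous_finsetSum _ fun k hk => continuous_const.mul ?_
    have hk0 : (k:ℂ) ≠ 0 := by exact_mod_cast (Finset.mem_Ioc.mp hk).1.ne'
    exact Continuous.const_cpow (by fun_prop) (Or.inl hk0)
  have hlim : Tendsto (fun N : ℕ => ∫ t in a..b, ‖∑ k ∈ Ioc 0 N, c k * (k:ℂ) ^ (-(((1 + ε : ℝ) : ℂ) + t * I))‖ ^ 2)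
      atTop (nhds (∫ t in a..b, ‖F t‖ ^ 2)) := by
    refine intervalIntegral.tendsto_integral_filter_of_dominated_convergence (fun _ => (D / ε ^ (q + 1)) ^ 2) ?_ ?_ ?_ ?_
    · refine Eventually.of_forall fun N => ?_
      exact ((hcont N).norm.pow 2).aestronglyMeasurable
    · refine Eventually.of_forall fun N => Eventually.of_forall fun t _ => ?_
      rw [Real.norm_of_nonneg (by positivity)]
      refine pow_le_pow_left₀ (norm_nonneg _) ?_ 2
      refine (norm_sum_le _ _).trans (le_trans (Finset.sum_le_sum fun k hk => ?_) (hD' ε hε hε1 N))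
      have hk1 := (Finset.mem_Ioc.mp hk).1
      rw [norm_mul, Complex.norm_natCast_cpow_of_pos hk1]
      simp only [neg_re, add_re, ofReal_re, mul_re, I_re, mul_zero, ofReal_im, I_im, mul_one, sub_self, add_zero]
      gcongr
      exact hc k hk1
    · exact intervalIntegrable_const
    · refine Eventually.of_forall fun t _ => ?_
      refine Tendsto.pow (Tendsto.norm ?_) 2
      have h1 := ((tendsto_add_atTop_iff_nat 1).mpr (hF t).tendsto_sum_nat)
      refine h1.congr fun N => ?_
      have hs0 : (((1 + ε : ℝ) : ℂ) + t * I) ≠ 0 := by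
        intro h0
        have := congrArg Complex.re h0
        simp at this
        linarith
      have e : range (N + 1) = insert 0 (Ioc 0 N) := by
        ext k; simp
      rw [e, Finset.sum_insert (by simp)]
      have : ((0:ℕ):ℂ) ^ (-(((1 + ε : ℝ) : ℂ) + t * I)) = 0 := by
        rw [Nat.cast_zero, Complex.zero_cpow (neg_ne_zero.mpr hs0)]
      rw [this, mul_zero, zero_add]
  exact le_of_tendsto hlim (Eventually.of_forall fun N => h ε hε hε1 c hc a b hab N)

lemma chi_contDiffAt {s : ℂ} (hs : s.im ≠ 0) (n : ℕ) : ContDiffAt ℂ n chi s := by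
  have hU : IsOpen {z : ℂ | z.im ≠ 0} := isOpen_ne_fun Complex.continuous_im continuous_const
  have : DifferentiableOn ℂ chi {z : ℂ | z.im ≠ 0} := fun z hz => (chi_diff hz).differentiableWithinAt
  exact (this.analyticAt (hU.mem_nhds hs)).contDiffAt

lemma zeta_analyticAt {s : ℂ} (hs : s.im ≠ 0) : AnalyticAt ℂ riemannZeta s := by
  have hU : IsOpen {z : ℂ | z.im ≠ 0} := isOpen_ne_fun Complex.continuous_im continuous_const
  have : DifferentiableOn ℂ riemannZeta {z : ℂ | z.im ≠ 0} := fun z hz => (zeta_diff_of_im hz).differentiableWithinAt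
  exact this.analyticAt (hU.mem_nhds hs)

lemma zeta_deriv_fe (n : ℕ) {s : ℂ} (hs : s.im ≠ 0) :
    ‖iteratedDeriv n riemannZeta s‖ ≤ ∑ i ∈ range (n + 1),
      (n.choose i : ℝ) * ‖iteratedDeriv i chi (1 - s)‖ * ‖iteratedDeriv (n - i) riemannZeta (1 - s)‖ := by
  have hU : IsOpen {z : ℂ | z.im ≠ 0} := isOpen_ne_fun Complex.continuous_im continuous_const
  have h1 : riemannZeta =ᶠ[nhds s] fun s => chi (1 - s) * riemannZeta (1 - s) := by
    filter_upwards [hU.mem_nhds hs] with z hz using zeta_fe hz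
  have hs' : (1 - s).im ≠ 0 := by simpa using hs
  have c1 : ContDiffAt ℂ n (fun z => chi (1 - z)) s :=
    ContDiffAt.comp s (chi_contDiffAt hs' n) (by fun_prop)
  have c2 : ContDiffAt ℂ n (fun z => riemannZeta (1 - z)) s :=
    ContDiffAt.comp s (zeta_analyticAt hs').contDiffAt (by fun_prop)
  rw [h1.iteratedDeriv_eq n, iteratedDeriv_fun_mul c1 c2]
  refine (norm_sum_le _ _).trans (Finset.sum_le_sum fun i _ => ?_)
  rw [iteratedDeriv_comp_const_sub, iteratedDeriv_comp_const_sub]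
  simp

lemma deriv_meansq (j : ℕ) : ∃ C : ℝ, 0 < C ∧ ∀ ε : ℝ, 0 < ε → ε ≤ 1 → ∀ a b : ℝ, a ≤ b →
    ∫ t in a..b, ‖iteratedDeriv j riemannZeta (((1 + ε : ℝ) : ℂ) - t * I)‖ ^ 2 ≤ C * ((b - a) + 1 / ε ^ (3 * j + 2)) := by
  obtain ⟨C, hC, h⟩ := meansq j
  refine ⟨C, hC, fun ε hε hε1 a b hab => ?_⟩
  have := h ε hε hε1 (fun k => (-((Real.log k:ℝ):ℂ))^j) (fun k hk => by
    have hk1 : (1:ℝ) ≤ k := by exact_mod_cast hk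
    have lk := Real.log_nonneg hk1
    rw [norm_pow, norm_neg, Complex.norm_real, Real.norm_of_nonneg lk]
    gcongr
    linarith) (fun t => iteratedDeriv j riemannZeta (((1 + ε : ℝ) : ℂ) + t * I))
    (fun t => zeta_deriv_hasSum j (by simp; linarith)) (-b) (-a) (by linarith)
  rw [← intervalIntegral.integral_comp_neg] at this
  have e : -a - -b = b - a := by ring
  rw [e] at this
  convert this using 8
  push_cast; ring

lemma vm_meansq : ∃ C : ℝ, 0 < C ∧ ∀ ε : ℝ, 0 < ε → ε ≤ 1 → ∀ a b : ℝ, a ≤ b →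
    ∫ t in a..b, ‖deriv riemannZeta (((1 + ε : ℝ) : ℂ) - t * I) / riemannZeta (((1 + ε : ℝ) : ℂ) - t * I)‖ ^ 2 ≤ C * ((b - a) + 1 / ε ^ 5) := by
  obtain ⟨C, hC, h⟩ := meansq 1
  refine ⟨C, hC, fun ε hε hε1 a b hab => ?_⟩
  have := h ε hε hε1 (fun k => ((ArithmeticFunction.vonMangoldt k:ℝ):ℂ)) (fun k hk => by
    have hk1 : (1:ℝ) ≤ k := by exact_mod_cast hk
    have lk := Real.log_nonneg hk1
    rw [Complex.norm_real, Real.norm_of_nonneg ArithmeticFunction.vonMangoldt_nonneg, pow_one]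
    have := ArithmeticFunction.vonMangoldt_le_log (n := k)
    linarith) (fun t => -(deriv riemannZeta (((1 + ε : ℝ) : ℂ) + t * I) / riemannZeta (((1 + ε : ℝ) : ℂ) + t * I)))
    (fun t => vm_hasSum (by simp; linarith)) (-b) (-a) (by linarith)
  rw [← intervalIntegral.integral_comp_neg] at this
  have e : -a - -b = b - a := by ring
  rw [e] at this
  simp only [norm_neg] at this
  have e2 : ∀ x : ℝ, (((1 + ε : ℝ) : ℂ) + ((-x : ℝ) : ℂ) * I) = ((1 + ε : ℝ) : ℂ) - x * I := by
    intro x; push_cast; ring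
  simp_rw [e2] at this
  exact this

lemma zd_cont (j : ℕ) {γ : ℝ → ℂ} {S : Set ℝ} (hγ : ContinuousOn γ S) (h : ∀ t ∈ S, γ t ≠ 1) :
    ContinuousOn (fun t => iteratedDeriv j riemannZeta (γ t)) S := by
  have hU : IsOpen {z : ℂ | z ≠ 1} := isOpen_ne
  have hd : DifferentiableOn ℂ riemannZeta {z : ℂ | z ≠ 1} := fun z hz => (differentiableAt_riemannZeta hz).differentiableWithinAt
  have : ContinuousOn (iteratedDeriv j riemannZeta) {z : ℂ | z ≠ 1} := by
    intro z hz
    have ha := hd.analyticAt (hU.mem_nhds hz)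
    rw [iteratedDeriv_eq_iterate]
    exact (ha.iterated_deriv j).continuousAt.continuousWithinAt
  exact this.comp hγ h

/-- mean value of the left-edge integrand -/
lemma g_mean (n : ℕ) : ∃ C : ℝ, 0 < C ∧ ∀ L : ℝ, 4 ≤ L → ∀ a b : ℝ, 1 ≤ a → a ≤ b → 5 + b ≤ Real.exp (2 * L) →
    ∫ t in a..b, ‖deriv riemannZeta (((1 + 1/L : ℝ) : ℂ) - t * I) / riemannZeta (((1 + 1/L : ℝ) : ℂ) - t * I)‖ *
      ‖iteratedDeriv n riemannZeta (1 - (((1 + 1/L : ℝ) : ℂ) - t * I))‖ ≤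
      C * L ^ n * (5 + b) ^ (1/2 : ℝ) * ((b - a) + L ^ (3 * n + 5)) := by
  choose C1 hC1 h1 using chi_deriv_bound
  choose C2 hC2 h2 using deriv_meansq
  obtain ⟨C3, hC3, h3⟩ := vm_meansq
  refine ⟨∑ i ∈ range (n + 1), (n.choose i : ℝ) * C1 i * (C3 + C2 (n - i)), ?_, fun L hL a b ha hab hb => ?_⟩
  · refine Finset.sum_pos (fun i hi => ?_) ⟨0, by simp⟩
    have : 0 < n.choose i := Nat.choose_pos (by simpa [Nat.lt_succ_iff] using hi)
    have := hC1 i; have := hC2 (n - i)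
    positivity
  have hL0 : 0 < L := by linarith
  have hε : 0 < 1 / L := by positivity
  have hε1 : 1 / L ≤ 1 := by rw [div_le_one hL0]; linarith
  set A : ℝ → ℝ := fun t => ‖deriv riemannZeta (((1 + 1/L : ℝ) : ℂ) - t * I) / riemannZeta (((1 + 1/L : ℝ) : ℂ) - t * I)‖ with hA
  set B : ℕ → ℝ → ℝ := fun j t => ‖iteratedDeriv j riemannZeta (((1 + 1/L : ℝ) : ℂ) - t * I)‖ with hB
  have hne1 : ∀ t : ℝ, (((1 + 1/L : ℝ) : ℂ) - t * I) ≠ 1 := by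
    intro t h0
    have := congrArg Complex.re h0
    simp at this
    linarith
  have hBc : ∀ j, Continuous (B j) := by
    intro j
    rw [← continuousOn_univ]
    exact (zd_cont j (by fun_prop) (fun t _ => hne1 t)).norm
  have hAc : Continuous A := by
    rw [← continuousOn_univ]
    refine ContinuousOn.norm (ContinuousOn.div ?_ ?_ ?_)
    · have := zd_cont 1 (γ := fun t : ℝ => (((1 + 1/L : ℝ) : ℂ) - t * I)) (S := Set.univ) (by fun_prop) (fun t _ => hne1 t)
      simpa only [iteratedDeriv_one] using this
    · have := zd_cont 0 (γ := fun t : ℝ => (((1 + 1/L : ℝ) : ℂ) - t * I)) (S := Set.univ) (by fun_prop) (fun t _ => hne1 t)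
      simpa only [iteratedDeriv_zero] using this
    · intro t _
      exact riemannZeta_ne_zero_of_one_lt_re (by simp; linarith)
  have hpt : ∀ t ∈ Set.Icc a b, A t * ‖iteratedDeriv n riemannZeta (1 - (((1 + 1/L : ℝ) : ℂ) - t * I))‖ ≤
      L ^ n * (5 + b) ^ (1/2 : ℝ) * ∑ i ∈ range (n + 1), (n.choose i : ℝ) * C1 i * (A t ^ 2 + B (n - i) t ^ 2) := by
    intro t ht
    have ht0 : 0 < t := by linarith [ht.1]
    have hf := zeta_deriv_fe n (s := (1 - (((1 + 1/L : ℝ) : ℂ) - t * I))) (by simp; exact ht0.ne')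
    rw [sub_sub_cancel] at hf
    have hA0 : 0 ≤ A t := norm_nonneg _
    refine (mul_le_mul_of_nonneg_left hf hA0).trans ?_
    rw [Finset.mul_sum, Finset.mul_sum]
    refine Finset.sum_le_sum fun i hi => ?_
    have hi' : i ≤ n := by simpa [Nat.lt_succ_iff] using hi
    have hc := h1 i L hL (-t) (by rw [abs_neg, abs_of_pos ht0]; linarith [ht.1]) (by rw [abs_neg, abs_of_pos ht0]; linarith [ht.2])
    rw [abs_neg, abs_of_pos ht0] at hc
    have e : (((1 + 1/L : ℝ) : ℂ) + (-t : ℝ) * I) = (((1 + 1/L : ℝ) : ℂ) - t * I) := by push_cast; ring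
    rw [e] at hc
    have hc' : ‖iteratedDeriv i chi (((1 + 1/L : ℝ) : ℂ) - t * I)‖ ≤ C1 i * L ^ n * (5 + b) ^ (1/2 : ℝ) := by
      refine hc.trans ?_
      have := hC1 i
      gcongr
      · linarith
      · exact ht.2
    have hB0 : 0 ≤ B (n - i) t := norm_nonneg _
    have hAB : A t * B (n - i) t ≤ A t ^ 2 + B (n - i) t ^ 2 := by nlinarith [sq_nonneg (A t - B (n-i) t)]
    have h50 : 0 ≤ (5 + b) ^ (1/2 : ℝ) := Real.rpow_nonneg (by linarith) _
    have := hC1 i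
    calc _ = (n.choose i : ℝ) * ‖iteratedDeriv i chi (((1 + 1/L : ℝ) : ℂ) - t * I)‖ * (A t * B (n - i) t) := by
          simp only [hB]; ring
      _ ≤ (n.choose i : ℝ) * (C1 i * L ^ n * (5 + b) ^ (1/2 : ℝ)) * (A t ^ 2 + B (n - i) t ^ 2) := by gcongr
      _ = _ := by ring
  have hLc : ContinuousOn (fun t : ℝ => A t * ‖iteratedDeriv n riemannZeta (1 - (((1 + 1/L : ℝ) : ℂ) - t * I))‖) (Set.uIcc a b) := by
    refine hAc.continuousOn.mul (zd_cont n (by fun_prop) ?_).norm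
    intro t _ h0
    have := congrArg Complex.re h0
    simp at this
    have hi : 0 < L⁻¹ := by positivity
    linarith
  have hpow : ∀ m, m ≤ 3 * n + 5 → 1 / (1 / L) ^ m ≤ L ^ (3 * n + 5) := by
    intro m hm
    rw [one_div_pow, one_div_one_div]
    exact pow_le_pow_right₀ (by linarith) hm
  calc _ ≤ ∫ t in a..b, L ^ n * (5 + b) ^ (1/2 : ℝ) * ∑ i ∈ range (n + 1), (n.choose i : ℝ) * C1 i * (A t ^ 2 + B (n - i) t ^ 2) := by
        apply intervalIntegral.integral_mono_on hab hLc.intervalIntegrable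
        · apply Continuous.intervalIntegrable
          fun_prop
        · exact hpt
    _ = L ^ n * (5 + b) ^ (1/2 : ℝ) * ∑ i ∈ range (n + 1), (n.choose i : ℝ) * C1 i * ((∫ t in a..b, A t ^ 2) + ∫ t in a..b, B (n - i) t ^ 2) := by
        rw [intervalIntegral.integral_const_mul, intervalIntegral.integral_finsetSum]
        · congr 1
          refine Finset.sum_congr rfl fun i _ => ?_
          rw [intervalIntegral.integral_const_mul, intervalIntegral.integral_add]
          · exact (hAc.pow 2).intervalIntegrable _ _
          · exact ((hBc _).pow 2).intervalIntegrable _ _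
        · intro i _
          apply Continuous.intervalIntegrable
          fun_prop
    _ ≤ L ^ n * (5 + b) ^ (1/2 : ℝ) * ∑ i ∈ range (n + 1), (n.choose i : ℝ) * C1 i * ((C3 + C2 (n - i)) * ((b - a) + L ^ (3 * n + 5))) := by
        have h50 : 0 ≤ (5 + b) ^ (1/2 : ℝ) := Real.rpow_nonneg (by linarith) _
        gcongr with i hi
        · have := hC1 i; positivity
        have i1 := h3 (1/L) hε hε1 a b hab
        have i2 := h2 (n - i) (1/L) hε hε1 a b hab
        have j1 := hpow 5 (by omega)
        have j2 := hpow (3 * (n - i) + 2) (by omega)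
        have := hC2 (n - i)
        have k1 := mul_le_mul_of_nonneg_left j1 hC3.le
        have k2 := mul_le_mul_of_nonneg_left j2 this.le
        simp only [hA, hB]
        linarith
    _ = _ := by
        simp_rw [Finset.mul_sum, Finset.sum_mul]
        refine Finset.sum_congr rfl fun i _ => by ring

end KKY

namespace KKY

lemma near_cmp (n : ℕ) : ∃ C : ℝ, 0 < C ∧ ∀ L lk ε u y Y : ℝ, 1 ≤ L → 0 ≤ lk → lk ≤ 2 * L → 0 < ε → ε ≤ 1 →
    y ≠ 0 → |y| ≤ 1/4 → |u - y| ≤ 2 * y ^ 2 → 0 ≤ Y →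
    ‖(((lk - u) ^ n * Real.exp ((1 + ε) * u) / u : ℝ) : ℂ) * Complex.exp (u * Y * I) -
      ((lk ^ n / y : ℝ) : ℂ) * Complex.exp (y * Y * I)‖ ≤ C * L ^ n * (1 + Y * |y|) := by
  refine ⟨(n * 3 ^ n * 5 + 2 ^ n * 4 + 2 ^ n * 4) + 2 ^ n * 2, by positivity, fun L lk ε u y Y hL hlk hlk2 hε hε1 hy0 hy hu hY => ?_⟩
  have hy1 : 0 < |y| := abs_pos.mpr hy0
  have hysq : y ^ 2 = |y| * |y| := by rw [← sq, sq_abs]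
  have hu1 : |u - y| ≤ |y| / 2 := by nlinarith
  have hul : |y| / 2 ≤ |u| := by
    have := abs_sub_abs_le_abs_sub y u
    rw [abs_sub_comm y u] at this
    linarith
  have huu : |u| ≤ 3/2 * |y| := by
    have := abs_sub_abs_le_abs_sub u y
    linarith
  have hu0 : 0 < |u| := by linarith
  have hu0' : u ≠ 0 := abs_pos.mp hu0
  have hr : |Real.exp ((1 + ε) * u) - 1| ≤ 4 * |u| := by
    have h1 : |(1 + ε) * u| ≤ 2 * |u| := by
      rw [abs_mul, abs_of_pos (by linarith : 0 < 1 + ε)]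
      gcongr; linarith
    have := Real.abs_exp_sub_one_le (x := (1 + ε) * u) (by linarith)
    linarith
  have hp : |(lk - u) ^ n - lk ^ n| ≤ n * 3 ^ n * L ^ n * |u| := by
    have h1 := abs_pow_sub_pow_le (lk - u) lk n
    have h2 : max |lk - u| |lk| ≤ 3 * L := by
      apply max_le
      · have := abs_sub lk u
        rw [abs_of_nonneg hlk] at this
        linarith
      · rw [abs_of_nonneg hlk]; linarith
    refine h1.trans ?_
    have e : |lk - u - lk| = |u| := by rw [show lk - u - lk = -u by ring, abs_neg]
    rw [e]
    have h3 : max |lk - u| |lk| ^ (n - 1) ≤ 3 ^ n * L ^ n := by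
      rw [← mul_pow]
      calc _ ≤ (3 * L) ^ (n - 1) := by gcongr
        _ ≤ _ := pow_le_pow_right₀ (by linarith) (by omega)
    calc _ ≤ |u| * n * (3 ^ n * L ^ n) := by gcongr
      _ = _ := by ring
  have hlkn : lk ^ n ≤ 2 ^ n * L ^ n := by rw [← mul_pow]; gcongr
  have hlkn0 : 0 ≤ lk ^ n := by positivity
  have hexp : Real.exp ((1 + ε) * u) ≤ 5 := by
    have := (abs_le.mp hr).2
    linarith
  -- first difference
  have hd1 : |(lk - u) ^ n * Real.exp ((1 + ε) * u) / u - lk ^ n / y| ≤ (n * 3 ^ n * 5 + 2 ^ n * 4 + 2 ^ n * 4) * L ^ n := by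
    have e : (lk - u) ^ n * Real.exp ((1 + ε) * u) / u - lk ^ n / y =
      ((lk - u) ^ n - lk ^ n) * Real.exp ((1 + ε) * u) / u + lk ^ n * (Real.exp ((1 + ε) * u) - 1) / u
        - lk ^ n * (u - y) / (u * y) := by
      field_simp; ring
    rw [e]
    have t1 : |((lk - u) ^ n - lk ^ n) * Real.exp ((1 + ε) * u) / u| ≤ n * 3 ^ n * 5 * L ^ n := by
      rw [abs_div, abs_mul, abs_of_pos (Real.exp_pos _), div_le_iff₀ hu0]
      calc _ ≤ (n * 3 ^ n * L ^ n * |u|) * 5 := by gcongr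
        _ = _ := by ring
    have t2 : |lk ^ n * (Real.exp ((1 + ε) * u) - 1) / u| ≤ 2 ^ n * 4 * L ^ n := by
      rw [abs_div, abs_mul, abs_of_nonneg hlkn0, div_le_iff₀ hu0]
      calc _ ≤ (2 ^ n * L ^ n) * (4 * |u|) := by gcongr
        _ = _ := by ring
    have t3 : |lk ^ n * (u - y) / (u * y)| ≤ 2 ^ n * 4 * L ^ n := by
      rw [abs_div, abs_mul, abs_mul, abs_of_nonneg hlkn0, div_le_iff₀ (by positivity)]
      calc _ ≤ (2 ^ n * L ^ n) * (2 * y ^ 2) := by gcongr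
        _ = (2 ^ n * 4 * L ^ n) * (|y| / 2 * |y|) := by rw [hysq]; ring
        _ ≤ _ := by gcongr
    have := abs_sub (((lk - u) ^ n - lk ^ n) * Real.exp ((1 + ε) * u) / u + lk ^ n * (Real.exp ((1 + ε) * u) - 1) / u) (lk ^ n * (u - y) / (u * y))
    have h2 := abs_add_le (((lk - u) ^ n - lk ^ n) * Real.exp ((1 + ε) * u) / u) (lk ^ n * (Real.exp ((1 + ε) * u) - 1) / u)
    linarith
  have hd2 : ‖Complex.exp (u * Y * I) - Complex.exp (y * Y * I)‖ ≤ Y * (2 * y ^ 2) := by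
    have e : Complex.exp (u * Y * I) - Complex.exp (y * Y * I) =
        Complex.exp (((y * Y : ℝ) : ℂ) * I) * (Complex.exp (I * (((u - y) * Y : ℝ) : ℂ)) - 1) := by
      rw [mul_sub, ← Complex.exp_add]; push_cast; congr 2 <;> ring_nf
    rw [e, norm_mul, Complex.norm_exp_ofReal_mul_I, one_mul]
    refine (Real.norm_exp_I_mul_ofReal_sub_one_le).trans ?_
    rw [Real.norm_eq_abs, abs_mul, abs_of_nonneg hY, mul_comm]
    gcongr
  have e : (((lk - u) ^ n * Real.exp ((1 + ε) * u) / u : ℝ) : ℂ) * Complex.exp (u * Y * I) -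
      ((lk ^ n / y : ℝ) : ℂ) * Complex.exp (y * Y * I) =
      (((lk - u) ^ n * Real.exp ((1 + ε) * u) / u - lk ^ n / y : ℝ) : ℂ) * Complex.exp (((u * Y : ℝ) : ℂ) * I)
      + ((lk ^ n / y : ℝ) : ℂ) * (Complex.exp (u * Y * I) - Complex.exp (y * Y * I)) := by
    push_cast; ring
  rw [e]
  refine (norm_add_le _ _).trans ?_
  rw [norm_mul, norm_mul, Complex.norm_exp_ofReal_mul_I, mul_one, Complex.norm_real, Complex.norm_real, Real.norm_eq_abs, Real.norm_eq_abs]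
  have hs : |lk ^ n / y| * ‖Complex.exp (u * Y * I) - Complex.exp (y * Y * I)‖ ≤ 2 ^ n * 2 * L ^ n * (Y * |y|) := by
    calc _ ≤ |lk ^ n / y| * (Y * (2 * y ^ 2)) := by gcongr
      _ = lk ^ n * (2 * Y * |y|) := by
          rw [abs_div, abs_of_nonneg hlkn0, hysq]; field_simp
      _ ≤ (2 ^ n * L ^ n) * (2 * Y * |y|) := by gcongr
      _ = _ := by ring
  have q1 : 0 ≤ (n * 3 ^ n * 5 + 2 ^ n * 4 + 2 ^ n * 4) * L ^ n * (Y * |y|) := by positivity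
  have q2 : 0 ≤ 2 ^ n * 2 * L ^ n := by positivity
  linarith

/-- real log comparison -/
lemma log_cmp {y : ℝ} (hy : |y| ≤ 1/4) : |(-Real.log (1 - y)) - y| ≤ 2 * y ^ 2 := by
  have h := Real.abs_log_sub_add_sum_range_le (x := y) (by linarith) 1
  simp at h
  rw [show -Real.log (1 - y) - y = -(y + Real.log (1 - y)) by ring, abs_neg]
  refine h.trans ?_
  rw [div_le_iff₀ (by linarith)]
  nlinarith [sq_nonneg y]

lemma near_sum (n : ℕ) : ∃ C : ℝ, 0 < C ∧ ∀ (L H Y ε : ℝ) (k D : ℕ), 1 ≤ L → 4 ≤ H → 1 ≤ k → Real.log k ≤ 2 * L →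
    0 < ε → ε ≤ 1 → 0 ≤ Y → Y ≤ 2 * H ^ 2 → (D : ℝ) * H ≤ k →
    ‖∑ d ∈ Ioc 0 D, (
      (((Real.log ((k + d : ℕ) : ℝ)) ^ n * Real.exp ((1 + ε) * (Real.log k - Real.log ((k + d : ℕ) : ℝ))) / (Real.log k - Real.log ((k + d : ℕ) : ℝ)) : ℝ) : ℂ)
        * Complex.exp (((Real.log k - Real.log ((k + d : ℕ) : ℝ) : ℝ) : ℂ) * Y * I) +
      (((Real.log ((k - d : ℕ) : ℝ)) ^ n * Real.exp ((1 + ε) * (Real.log k - Real.log ((k - d : ℕ) : ℝ))) / (Real.log k - Real.log ((k - d : ℕ) : ℝ)) : ℝ) : ℂ)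
        * Complex.exp (((Real.log k - Real.log ((k - d : ℕ) : ℝ) : ℝ) : ℂ) * Y * I))‖ ≤ C * L ^ n * k := by
  obtain ⟨C, hC, h⟩ := near_cmp n
  refine ⟨2 * C * 3 + 2 ^ n * 10, by positivity, fun L H Y ε k D hL hH hk hlk hε hε1 hY hY2 hD => ?_⟩
  have hk1 : (1:ℝ) ≤ k := by exact_mod_cast hk
  have hk0 : (0:ℝ) < k := by linarith
  have hlk0 := Real.log_nonneg hk1
  set lk := Real.log (k:ℝ) with hlkdef
  have hD' : (D:ℝ) ≤ k / H := by rw [le_div_iff₀ (by linarith)]; exact hD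
  have hd : ∀ d ∈ Ioc 0 D, (1:ℝ) ≤ d ∧ (d:ℝ) ≤ k / H ∧ d < k := by
    intro d hd
    have h1 := Finset.mem_Ioc.mp hd
    have h2 : (d:ℝ) ≤ D := by exact_mod_cast h1.2
    refine ⟨by exact_mod_cast h1.1, h2.trans hD', ?_⟩
    have : (d:ℝ) < k := by
      calc (d:ℝ) ≤ k / H := h2.trans hD'
        _ < k := by rw [div_lt_iff₀ (by linarith)]; nlinarith
    exact_mod_cast this
  have cmp : ∀ m : ℕ, ∀ x : ℝ, (m:ℝ) = k * (1 - x) → x ≠ 0 → |x| ≤ 1 / H →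
      ‖(((Real.log (m : ℝ)) ^ n * Real.exp ((1 + ε) * (lk - Real.log (m : ℝ))) / (lk - Real.log (m : ℝ)) : ℝ) : ℂ)
        * Complex.exp (((lk - Real.log (m : ℝ) : ℝ) : ℂ) * Y * I) -
        ((lk ^ n / x : ℝ) : ℂ) * Complex.exp (x * Y * I)‖ ≤ C * L ^ n * 3 * 1 + C * L ^ n * 2 * (H - 1) := by
    intro m x hm hx0 hx
    have hH4 : 1 / H ≤ 1 / 4 := by gcongr
    have hx4 : |x| ≤ 1/4 := hx.trans hH4
    have hx1 := abs_le.mp hx4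
    have hlog : lk - Real.log m = -Real.log (1 - x) := by
      rw [hm, Real.log_mul hk0.ne' (by linarith)]; ring
    have := h L lk ε (lk - Real.log m) x Y hL hlk0 hlk hε hε1 hx0 hx4 (by rw [hlog]; exact log_cmp hx4) hY
    rw [sub_sub_cancel] at this
    refine this.trans ?_
    have : Y * |x| ≤ 2 * H := by
      calc Y * |x| ≤ (2 * H ^ 2) * (1 / H) := by gcongr
        _ = 2 * H := by field_simp
    have h0 : 0 ≤ C * L ^ n := by positivity
    nlinarith
  have hcmp : ∀ d ∈ Ioc 0 D, ‖((((Real.log ((k + d : ℕ) : ℝ)) ^ n * Real.exp ((1 + ε) * (lk - Real.log ((k + d : ℕ) : ℝ))) / (lk - Real.log ((k + d : ℕ) : ℝ)) : ℝ) : ℂ)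
        * Complex.exp (((lk - Real.log ((k + d : ℕ) : ℝ) : ℝ) : ℂ) * Y * I) +
      (((Real.log ((k - d : ℕ) : ℝ)) ^ n * Real.exp ((1 + ε) * (lk - Real.log ((k - d : ℕ) : ℝ))) / (lk - Real.log ((k - d : ℕ) : ℝ)) : ℝ) : ℂ)
        * Complex.exp (((lk - Real.log ((k - d : ℕ) : ℝ) : ℝ) : ℂ) * Y * I)) -
        ((2 * lk ^ n * k : ℝ) : ℂ) * I * ((Real.sin (d * (Y / k)) / d : ℝ) : ℂ)‖ ≤ 2 * (C * L ^ n * 3 * H) := by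
    intro d hdD
    obtain ⟨hd1, hd2, hd3⟩ := hd d hdD
    have hdk : (d:ℝ) / k ≤ 1 / H := by
      rw [div_le_div_iff₀ hk0 (by linarith)]
      rw [le_div_iff₀ (by linarith)] at hd2
      linarith
    have hdk0 : 0 < (d:ℝ) / k := by positivity
    have c1 := cmp (k + d) (-(d / k)) (by push_cast; field_simp; ring) (by linarith) (by rw [abs_neg, abs_of_pos hdk0]; exact hdk)
    have c2 := cmp (k - d) (d / k) (by rw [Nat.cast_sub hd3.le]; field_simp) hdk0.ne' (by rw [abs_of_pos hdk0]; exact hdk)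
    have e : ((lk ^ n / (-(d / k)) : ℝ) : ℂ) * Complex.exp ((-(d / k) : ℝ) * Y * I) + ((lk ^ n / (d / k) : ℝ) : ℂ) * Complex.exp ((d / k : ℝ) * Y * I)
        = ((2 * lk ^ n * k : ℝ) : ℂ) * I * ((Real.sin (d * (Y / k)) / d : ℝ) : ℂ) := by
      have hs : ((Real.sin (d * (Y / k)) : ℝ) : ℂ) = (Complex.exp (-((d / k : ℝ) * Y) * I) - Complex.exp ((d / k : ℝ) * Y * I)) * I / 2 := by
        rw [Complex.ofReal_sin, Complex.sin]
        push_cast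
        have : (d:ℂ) * (Y / k) = d / k * Y := by ring
        rw [this]
      have e1 : Complex.exp ((-(d / k) : ℝ) * Y * I) = Complex.exp (-((d / k : ℝ) * Y) * I) := by
        congr 1; push_cast; ring
      rw [Complex.ofReal_div (Real.sin _), hs, e1]
      have hdc : (d:ℂ) ≠ 0 := by
        have : (d:ℝ) ≠ 0 := by linarith
        exact_mod_cast this
      have hkc : (k:ℂ) ≠ 0 := by exact_mod_cast hk0.ne'
      have e2 : ((lk ^ n / (-(d / k)) : ℝ) : ℂ) = -(lk ^ n * k / d) := by push_cast; field_simp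
      have e3 : ((lk ^ n / ((d / k)) : ℝ) : ℂ) = (lk ^ n * k / d) := by push_cast; field_simp
      rw [e2, e3]
      generalize Complex.exp (-((d / k : ℝ) * Y) * I) = E1
      generalize Complex.exp ((d / k : ℝ) * Y * I) = E2
      push_cast
      field_simp
      linear_combination (lk:ℂ) ^ n * (E2 - E1) * I_sq
    have h0 : 0 ≤ C * L ^ n := by positivity
    have hle : C * L ^ n * 3 * 1 + C * L ^ n * 2 * (H - 1) ≤ C * L ^ n * 3 * H := by nlinarith
    rw [← e, add_sub_add_comm]
    refine (norm_add_le _ _).trans ?_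
    linarith
  have hsum : ‖∑ d ∈ Ioc 0 D, (((2 * lk ^ n * k : ℝ) : ℂ) * I * ((Real.sin (d * (Y / k)) / d : ℝ) : ℂ))‖ ≤ 2 ^ n * 10 * L ^ n * k := by
    rw [← Finset.mul_sum, ← Complex.ofReal_sum, norm_mul, norm_mul, Complex.norm_I, mul_one, Complex.norm_real, Complex.norm_real,
      Real.norm_eq_abs, Real.norm_eq_abs, abs_of_nonneg (by positivity : 0 ≤ 2 * lk ^ n * k)]
    have hlkn : lk ^ n ≤ 2 ^ n * L ^ n := by rw [← mul_pow]; gcongr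
    calc _ ≤ 2 * (2 ^ n * L ^ n) * k * 5 := by
          gcongr
          exact sine_sum (Y / k) D
      _ = _ := by ring
  have key := Finset.sum_le_sum hcmp
  have key2 := (norm_sum_le _ _).trans key
  rw [Finset.sum_sub_distrib, Finset.sum_const, Nat.card_Ioc, nsmul_eq_mul, Nat.sub_zero] at key2
  have tri := norm_add_le (∑ d ∈ Ioc 0 D, (
      (((Real.log ((k + d : ℕ) : ℝ)) ^ n * Real.exp ((1 + ε) * (lk - Real.log ((k + d : ℕ) : ℝ))) / (lk - Real.log ((k + d : ℕ) : ℝ)) : ℝ) : ℂ)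
        * Complex.exp (((lk - Real.log ((k + d : ℕ) : ℝ) : ℝ) : ℂ) * Y * I) +
      (((Real.log ((k - d : ℕ) : ℝ)) ^ n * Real.exp ((1 + ε) * (lk - Real.log ((k - d : ℕ) : ℝ))) / (lk - Real.log ((k - d : ℕ) : ℝ)) : ℝ) : ℂ)
        * Complex.exp (((lk - Real.log ((k - d : ℕ) : ℝ) : ℝ) : ℂ) * Y * I)) - ∑ d ∈ Ioc 0 D, (((2 * lk ^ n * k : ℝ) : ℂ) * I * ((Real.sin (d * (Y / k)) / d : ℝ) : ℂ)))
      (∑ d ∈ Ioc 0 D, (((2 * lk ^ n * k : ℝ) : ℂ) * I * ((Real.sin (d * (Y / k)) / d : ℝ) : ℂ)))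
  rw [sub_add_cancel] at tri
  refine tri.trans ?_
  have h0 : 0 ≤ C * L ^ n := by positivity
  have : (D:ℝ) * (2 * (C * L ^ n * 3 * H)) ≤ 2 * C * 3 * L ^ n * k := by
    calc _ = (2 * C * 3 * L ^ n) * (D * H) := by ring
      _ ≤ _ := by gcongr
  linarith

end KKY

namespace KKY

lemma hasSum_int {f : ℕ → ℝ → ℂ} {F : ℝ → ℂ} {b : ℕ → ℝ} (hc : ∀ m, Continuous (f m))
    (hb : ∀ m t, ‖f m t‖ ≤ b m) (hs : Summable b) (h : ∀ t, HasSum (fun m => f m t) (F t)) (a c : ℝ) :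
    HasSum (fun m => ∫ t in a..c, f m t) (∫ t in a..c, F t) := by
  refine intervalIntegral.hasSum_integral_of_dominated_convergence (fun m _ => b m) (fun m => (hc m).aestronglyMeasurable)
    (fun m => Eventually.of_forall fun t _ => hb m t) (Eventually.of_forall fun t _ => hs) intervalIntegrable_const
    (Eventually.of_forall fun t _ => h t)

lemma hasSum_fin {f : ℕ → ℂ} {a : ℂ} (h : HasSum f a) (S : Finset ℕ) {g : ℕ → ℝ} {B : ℝ}
    (hf : ∀ m, m ∉ S → ‖f m‖ ≤ g m) (hg0 : ∀ m, 0 ≤ g m) (hg : ∀ N, ∑ m ∈ range N, g m ≤ B) :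
    ‖a - ∑ m ∈ S, f m‖ ≤ B := by
  have h1 : HasSum (fun m => f m - if m ∈ S then f m else 0) (a - ∑ m ∈ S, f m) := by
    refine h.sub ?_
    have : HasSum (fun m => if m ∈ S then f m else 0) (∑ m ∈ S, if m ∈ S then f m else 0) := hasSum_sum_of_ne_finset_zero (fun m hm => if_neg hm)
    rwa [Finset.sum_congr rfl (fun m hm => if_pos hm)] at this
  have h2 := h1.tendsto_sum_nat.norm
  refine le_of_tendsto h2 (Eventually.of_forall fun N => ?_)
  refine (norm_sum_le _ _).trans (le_trans (Finset.sum_le_sum fun m _ => ?_) (hg N))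
  by_cases hm : m ∈ S
  · simp [hm, hg0]
  · simp [hm, hf]

lemma inv_sq_sum (D N : ℕ) : ∑ d ∈ Ioc 0 N, (if D < d then 1 / (d:ℝ) ^ 2 else (0:ℝ)) ≤ 2 / ((D:ℝ) + 1) := by
  have key : ∀ N : ℕ, ∑ d ∈ Ioc 0 N, (if D < d then 1 / (d:ℝ) ^ 2 else (0:ℝ)) ≤ if D < N then 2 / ((D:ℝ) + 1) - 2 / ((N:ℝ) + 1) else (0:ℝ) := by
    intro N
    induction N with
    | zero => simp
    | succ N ih =>
      rw [Finset.sum_Ioc_succ_top (Nat.zero_le N)]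
      have hN : (0:ℝ) ≤ N := Nat.cast_nonneg N
      have st : 1 / (((N + 1 : ℕ) : ℝ)) ^ 2 ≤ 2 / ((N:ℝ) + 1) - 2 / ((N + 1 : ℕ) + 1) := by
        push_cast
        rw [div_sub_div _ _ (by positivity) (by positivity), div_le_div_iff₀ (by positivity) (by positivity)]
        nlinarith
      rcases lt_trichotomy D N with hD | hD | hD
      · rw [if_pos hD] at ih
        rw [if_pos (by omega), if_pos (by omega)]
        linarith
      · rw [if_neg (by omega)] at ih
        rw [if_pos (by omega), if_pos (by omega)]
        subst hD
        linarith
      · rw [if_neg (by omega)] at ih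
        rw [if_neg (by omega), if_neg (by omega)]
        linarith
  refine (key N).trans ?_
  split_ifs
  · have : 0 ≤ 2 / ((N:ℝ) + 1) := by positivity
    linarith
  · positivity

/-- coefficient -/
noncomputable def cf (n : ℕ) (ε : ℝ) (k m : ℕ) : ℝ := (-Real.log m) ^ n * (m:ℝ) ^ (-(1 + ε)) * (k:ℝ) ^ (1 + ε)

lemma cf_eq (n : ℕ) (ε : ℝ) {k m : ℕ} (hk : 1 ≤ k) (hm : 1 ≤ m) :
    cf n ε k m = (-1) ^ n * (Real.log m ^ n * Real.exp ((1 + ε) * (Real.log k - Real.log m))) := by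
  have hk0 : (0:ℝ) < k := by exact_mod_cast hk
  have hm0 : (0:ℝ) < m := by exact_mod_cast hm
  unfold cf
  rw [Real.rpow_def_of_pos hk0, Real.rpow_def_of_pos hm0, neg_pow, mul_assoc, mul_assoc, ← Real.exp_add]
  congr 3; ring

lemma cf_abs (n : ℕ) (ε : ℝ) {k m : ℕ} (hk : 1 ≤ k) (hm : 1 ≤ m) :
    |cf n ε k m| = Real.log m ^ n * Real.exp ((1 + ε) * (Real.log k - Real.log m)) := by
  have hm1 : (1:ℝ) ≤ m := by exact_mod_cast hm
  have := Real.log_nonneg hm1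
  rw [cf_eq n ε hk hm, abs_mul, abs_pow, abs_neg, abs_one, one_pow, one_mul, abs_of_nonneg (by positivity)]

/-- far term bound -/
lemma far_term (n : ℕ) {L : ℝ} (hL : 4 ≤ L) {k m : ℕ} (hk : 1 ≤ k) (hlk : 1 + Real.log k ≤ 2 * L) (hm : 1 ≤ m) (hmk : m ≠ k) :
    |cf n (1/L) k m| * (4 / (Real.log k - Real.log m) ^ 2) ≤
      64 * (2 * L) ^ n * k ^ 2 * (1 / ((m:ℝ) - k) ^ 2) + 36 * Real.exp 2 * k * ((1 + Real.log m) ^ n * (m:ℝ) ^ (-(1 + 1/L))) := by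
  have hk1 : (1:ℝ) ≤ k := by exact_mod_cast hk
  have hm1 : (1:ℝ) ≤ m := by exact_mod_cast hm
  have hL0 : 0 < L := by linarith
  have hlm := Real.log_nonneg hm1
  have hlk0 := Real.log_nonneg hk1
  have hmk' : (m:ℝ) - k ≠ 0 := by
    rw [sub_ne_zero]; exact_mod_cast hmk
  set j := |(m:ℝ) - k| with hj
  have hj0 : 0 < j := abs_pos.mpr hmk'
  have hjsq : ((m:ℝ) - k) ^ 2 = j ^ 2 := (sq_abs _).symm
  -- lower bound of |u|
  have hu : j / max (k:ℝ) m ≤ |Real.log k - Real.log m| := by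
    rcases lt_or_gt_of_ne hmk with h | h
    · have := log_sub_lower hm h
      have h' : (m:ℝ) ≤ k := by exact_mod_cast h.le
      rw [Nat.cast_sub h.le] at this
      rw [max_eq_left h', hj, abs_sub_comm, abs_of_nonneg (by linarith)]
      exact this.trans (le_abs_self _)
    · have := log_sub_lower hk h
      have h' : (k:ℝ) ≤ m := by exact_mod_cast h.le
      rw [Nat.cast_sub h.le] at this
      rw [max_eq_right h', hj, abs_of_nonneg (by linarith), abs_sub_comm]
      exact this.trans (le_abs_self _)
  have hmax : 0 < max (k:ℝ) m := lt_of_lt_of_le (by linarith) (le_max_left _ _)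
  have husq : 4 / (Real.log k - Real.log m) ^ 2 ≤ 4 * (max (k:ℝ) m / j) ^ 2 := by
    rw [← sq_abs (Real.log k - Real.log m)]
    have h0 : 0 < j / max (k:ℝ) m := by positivity
    calc _ ≤ 4 / (j / max (k:ℝ) m) ^ 2 := by gcongr
      _ = _ := by field_simp
  have t1 : 0 ≤ 64 * (2 * L) ^ n * k ^ 2 * (1 / ((m:ℝ) - k) ^ 2) := by positivity
  have t2 : 0 ≤ 36 * Real.exp 2 * k * ((1 + Real.log m) ^ n * (m:ℝ) ^ (-(1 + 1/L))) := by positivity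
  by_cases hc : 2 * j ≤ k
  · have hb := abs_le.mp (show |(m:ℝ) - k| ≤ k / 2 by rw [← hj]; linarith)
    have hmax2 : max (k:ℝ) m ≤ 2 * k := max_le (by linarith) (by linarith [hb.2])
    have hlm2 : Real.log m ≤ 2 * L := by
      have : Real.log m ≤ Real.log (2 * k) := Real.log_le_log (by linarith) (by linarith [hb.2])
      rw [Real.log_mul (by norm_num) (by linarith)] at this
      linarith [Real.log_two_lt_d9]
    have hcf : |cf n (1/L) k m| ≤ (2 * L) ^ n * 4 := by
      rw [cf_abs n _ hk hm]
      have hd : Real.log k - Real.log m ≤ Real.log 2 := by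
        rw [← Real.log_div (by linarith) (by linarith)]
        apply Real.log_le_log (by positivity)
        rw [div_le_iff₀ (by linarith)]
        linarith [hb.1]
      have hε : 1 / L ≤ 1 := by rw [div_le_one hL0]; linarith
      have hε0 : 0 < 1 / L := by positivity
      have : Real.exp ((1 + 1/L) * (Real.log k - Real.log m)) ≤ 4 := by
        calc _ ≤ Real.exp (2 * Real.log 2) := by
              apply Real.exp_le_exp.mpr
              have := Real.log_pos (show (1:ℝ) < 2 by norm_num)
              calc _ ≤ (1 + 1/L) * Real.log 2 := by gcongr
                _ ≤ _ := by gcongr; linarith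
          _ = 4 := by
              rw [two_mul, Real.exp_add, Real.exp_log (by norm_num)]; norm_num
      gcongr
    calc _ ≤ (2 * L) ^ n * 4 * (4 * ((2 * k) / j) ^ 2) := by
          refine mul_le_mul hcf (husq.trans ?_) (by positivity) (by positivity)
          gcongr
      _ = 64 * (2 * L) ^ n * k ^ 2 * (1 / ((m:ℝ) - k) ^ 2) := by
          rw [hjsq]; field_simp; ring
      _ ≤ _ := by linarith
  · push Not at hc
    have hmax3 : max (k:ℝ) m / j ≤ 3 := by
      rw [div_le_iff₀ hj0]
      refine max_le (by linarith) ?_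
      have := le_abs_self ((m:ℝ) - k)
      rw [← hj] at this
      linarith
    have hk2 : (k:ℝ) ^ (1 + 1/L) ≤ k * Real.exp 2 := by
      rw [Real.rpow_add (by linarith), Real.rpow_one]
      gcongr
      rw [Real.rpow_def_of_pos (by linarith)]
      apply Real.exp_le_exp.mpr
      rw [mul_one_div, div_le_iff₀ hL0]; linarith
    have hcf : |cf n (1/L) k m| ≤ (1 + Real.log m) ^ n * (m:ℝ) ^ (-(1 + 1/L)) * (k * Real.exp 2) := by
      unfold cf
      rw [abs_mul, abs_mul, abs_pow, abs_neg, abs_of_nonneg hlm, abs_of_nonneg (by positivity), abs_of_nonneg (by positivity)]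
      gcongr
      linarith
    calc _ ≤ (1 + Real.log m) ^ n * (m:ℝ) ^ (-(1 + 1/L)) * (k * Real.exp 2) * (4 * 3 ^ 2) := by
          refine mul_le_mul hcf (husq.trans ?_) (by positivity) (by positivity)
          gcongr
      _ = 36 * Real.exp 2 * k * ((1 + Real.log m) ^ n * (m:ℝ) ^ (-(1 + 1/L))) := by ring
      _ ≤ _ := by linarith

/-- averaged kernel -/
noncomputable def WW (T H u : ℝ) : ℂ := (∫ h in (0:ℝ)..H, Complex.exp (u * h * I)) * ∫ t in H..T, Complex.exp (u * t * I)

lemma WW_bound (T H : ℝ) {u : ℝ} (hu : u ≠ 0) : ‖WW T H u‖ ≤ 4 / u ^ 2 := by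
  unfold WW
  rw [norm_mul]
  have hu' := abs_pos.mpr hu
  calc _ ≤ (2 / |u|) * (2 / |u|) := mul_le_mul (exp_int_bound u _ _ hu) (exp_int_bound u _ _ hu) (norm_nonneg _) (by positivity)
    _ = _ := by rw [← sq_abs u]; field_simp; norm_num

/-- far sum -/
lemma far_bound (n : ℕ) : ∃ C : ℝ, 0 < C ∧ ∀ (T H L : ℝ) (k D : ℕ), 4 ≤ L → L ≤ H → 1 ≤ k → 1 + Real.log k ≤ 2 * L →
    (k:ℝ) ≤ (D + 1) * H → D < k → ∀ a : ℂ, HasSum (fun m : ℕ => (cf n (1/L) k m : ℂ) * WW T H (Real.log k - Real.log m)) a →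
    ‖a - ∑ m ∈ Icc (k - D) (k + D), (cf n (1/L) k m : ℂ) * WW T H (Real.log k - Real.log m)‖ ≤ C * L ^ n * k * H := by
  obtain ⟨C, hC, hz⟩ := zlogsum n
  refine ⟨64 * 2 ^ n * 6 + 36 * Real.exp 2 * C, by positivity, fun T H L k D hL hLH hk hlk hD hDk a ha => ?_⟩
  have hL0 : 0 < L := by linarith
  have hε : 0 < 1 / L := by positivity
  have hε1 : 1 / L ≤ 1 := by rw [div_le_one hL0]; linarith
  have hk1 : (1:ℝ) ≤ k := by exact_mod_cast hk
  set q : ℕ → ℝ := fun d => if D < d then 1 / (d:ℝ) ^ 2 else 0 with hq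
  have hq0 : ∀ d, 0 ≤ q d := by intro d; simp only [hq]; split_ifs <;> positivity
  set g : ℕ → ℝ := fun m => 64 * (2 * L) ^ n * k ^ 2 * ((if k < m then q (m - k) else 0) + (if m < k then q (k - m) else 0)) +
    36 * Real.exp 2 * k * ((1 + Real.log m) ^ n * (m:ℝ) ^ (-(1 + 1/L))) with hg
  have hlog : ∀ m : ℕ, 0 ≤ Real.log (m:ℝ) := fun m => Real.log_natCast_nonneg m
  have hg0 : ∀ m, 0 ≤ g m := by
    intro m
    have := hlog m
    have h1 : 0 ≤ (if k < m then q (m - k) else 0) := by split_ifs; exacts [hq0 _, le_rfl]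
    have h2 : 0 ≤ (if m < k then q (k - m) else 0) := by split_ifs; exacts [hq0 _, le_rfl]
    simp only [hg]; positivity
  refine hasSum_fin ha _ (g := g) ?_ hg0 ?_
  · intro m hm
    rcases Nat.eq_zero_or_pos m with rfl | hm1
    · have : cf n (1/L) k 0 = 0 := by
        unfold cf
        rw [Nat.cast_zero, Real.zero_rpow (by linarith), mul_zero, zero_mul]
      rw [this]; simpa using hg0 0
    · have hmk : m ≠ k := by rintro rfl; simp at hm
      have hm' : m < k - D ∨ k + D < m := by
        rw [Finset.mem_Icc] at hm; omega
      have hu : Real.log k - Real.log m ≠ 0 := by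
        rw [sub_ne_zero]
        intro h
        have := Real.log_injOn_pos (Set.mem_Ioi.mpr (by linarith : (0:ℝ) < k)) (Set.mem_Ioi.mpr (by exact_mod_cast hm1 : (0:ℝ) < m)) h
        exact hmk (by exact_mod_cast this.symm)
      rw [norm_mul, Complex.norm_real, Real.norm_eq_abs]
      refine (mul_le_mul_of_nonneg_left (WW_bound T H hu) (abs_nonneg _)).trans ((far_term n hL hk hlk hm1 hmk).trans ?_)
      simp only [hg]
      gcongr
      rcases hm' with h | h
      · rw [if_neg (by omega), if_pos (by omega), zero_add]
        simp only [hq]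
        rw [if_pos (by omega), Nat.cast_sub (by omega)]
        rw [show ((m:ℝ) - k) ^ 2 = ((k:ℝ) - m) ^ 2 by ring]
      · rw [if_pos (by omega), if_neg (by omega), add_zero]
        simp only [hq]
        rw [if_pos (by omega), Nat.cast_sub (by omega)]
  · intro N
    have h1 : ∑ m ∈ range N, g m ≤ g 0 + ∑ m ∈ Ioc 0 N, g m := by
      have e : range (N + 1) = insert 0 (Ioc 0 N) := by ext k; simp
      calc _ ≤ ∑ m ∈ range (N + 1), g m := by rw [Finset.sum_range_succ]; linarith [hg0 N]
        _ = _ := by rw [e, Finset.sum_insert (by simp)]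
    have s1 := (shift_sum_gt q hq0 k N).trans (inv_sq_sum D N)
    have s2 := (shift_sum_lt q hq0 k N).trans (inv_sq_sum D k)
    have s3 := hz (1/L) hε hε1 N
    have g0 : g 0 = 64 * (2 * L) ^ n * k ^ 2 * q k := by
      simp only [hg]
      rw [if_neg (by omega), if_pos (by omega), Nat.cast_zero, Real.zero_rpow (by linarith)]
      simp
    have s0 : q k ≤ 2 / (D + 1) := by
      refine le_trans ?_ (inv_sq_sum D k)
      exact Finset.single_le_sum (f := q) (fun i _ => hq0 i) (Finset.mem_Ioc.mpr ⟨by omega, le_rfl⟩)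
    have hsum : ∑ m ∈ Ioc 0 N, g m ≤ 64 * (2 * L) ^ n * k ^ 2 * (2 / (D + 1) + 2 / (D + 1)) + 36 * Real.exp 2 * k * (C / (1/L) ^ (n + 1)) := by
      simp only [hg]
      rw [Finset.sum_add_distrib, ← Finset.mul_sum, ← Finset.mul_sum, Finset.sum_add_distrib]
      gcongr
    have hD1 : (0:ℝ) < D + 1 := by positivity
    have hkk : (k:ℝ) ^ 2 * (2 / ((D:ℝ) + 1)) ≤ 2 * k * H := by
      rw [mul_div_assoc', div_le_iff₀ hD1]
      nlinarith
    have e1 : C / (1 / L) ^ (n + 1) = C * (L ^ n * L) := by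
      rw [one_div, inv_pow, div_inv_eq_mul, pow_succ]
    have a1 : 64 * (2 * L) ^ n * (k:ℝ) ^ 2 * (2 / ((D:ℝ) + 1)) ≤ 64 * 2 ^ n * 2 * (L ^ n * k * H) := by
      calc _ = 64 * (2 * L) ^ n * ((k:ℝ) ^ 2 * (2 / ((D:ℝ) + 1))) := by ring
        _ ≤ 64 * (2 * L) ^ n * (2 * k * H) := by gcongr
        _ = _ := by rw [mul_pow]; ring
    have a2 : 36 * Real.exp 2 * k * (C * (L ^ n * L)) ≤ 36 * Real.exp 2 * C * (L ^ n * k * H) := by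
      calc _ = 36 * Real.exp 2 * C * (L ^ n * k * L) := by ring
        _ ≤ _ := by gcongr
    have a0 : g 0 ≤ 64 * (2 * L) ^ n * (k:ℝ) ^ 2 * (2 / ((D:ℝ) + 1)) := by
      rw [g0]; gcongr
    rw [e1] at hsum
    nlinarith [h1, hsum, a1, a2, a0]

end KKY

namespace KKY

lemma cf_zero (n : ℕ) {ε : ℝ} (hε : 0 < ε) (k : ℕ) : cf n ε k 0 = 0 := by
  unfold cf
  rw [Nat.cast_zero, Real.zero_rpow (by linarith), mul_zero, zero_mul]

lemma dk_hasSum (n : ℕ) {ε : ℝ} (hε : 0 < ε) {k : ℕ} (hk : 1 ≤ k) (t : ℝ) :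
    HasSum (fun m : ℕ => (cf n ε k m : ℂ) * Complex.exp (((Real.log k - Real.log m : ℝ) : ℂ) * t * I))
      (iteratedDeriv n riemannZeta (((1 + ε : ℝ) : ℂ) + t * I) * (k:ℂ) ^ (((1 + ε : ℝ) : ℂ) + t * I)) := by
  have hk0 : (0:ℝ) < k := by exact_mod_cast hk
  have h := (zeta_deriv_hasSum n (s := ((1 + ε : ℝ) : ℂ) + t * I) (by simp [hε])).mul_right ((k:ℂ) ^ (((1 + ε : ℝ) : ℂ) + t * I))
  have e : (fun m : ℕ => (cf n ε k m : ℂ) * Complex.exp (((Real.log k - Real.log m : ℝ) : ℂ) * t * I)) =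
      fun m : ℕ => (-((Real.log m:ℝ):ℂ)) ^ n * (m:ℂ) ^ (-(((1 + ε : ℝ) : ℂ) + t * I)) * (k:ℂ) ^ (((1 + ε : ℝ) : ℂ) + t * I) := by
    funext m
    rcases Nat.eq_zero_or_pos m with rfl | hm
    · rw [cf_zero n hε, Nat.cast_zero, Nat.cast_zero, Complex.zero_cpow]
      · simp
      · intro h0
        have := congrArg Complex.re h0
        simp at this
        linarith
    · have hm0 : (0:ℝ) < m := by exact_mod_cast hm
      rw [cf_eq n ε hk hm, Complex.cpow_def_of_ne_zero (by exact_mod_cast hm.ne'), Complex.cpow_def_of_ne_zero (by exact_mod_cast (by omega : k ≠ 0)),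
        ← Complex.natCast_log, ← Complex.natCast_log, mul_assoc _ (Complex.exp _) (Complex.exp _), ← Complex.exp_add, neg_pow ((Real.log m : ℝ) : ℂ),
        Complex.ofReal_mul, Complex.ofReal_mul, mul_assoc, mul_assoc, mul_assoc, Complex.ofReal_exp,
        ← Complex.exp_add, Complex.ofReal_pow, Complex.ofReal_pow, Complex.ofReal_neg, Complex.ofReal_one]
      rw [mul_assoc]
      congr 3
      rw [Complex.ofReal_mul, Complex.ofReal_sub]
      ring
  rw [e]
  exact h

lemma shift_int (u a b h : ℝ) : ∫ t in (a + h)..(b + h), Complex.exp (u * t * I) =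
    Complex.exp (u * h * I) * ∫ t in a..b, Complex.exp (u * t * I) := by
  rw [← intervalIntegral.integral_comp_add_right (fun t : ℝ => Complex.exp (u * t * I)), ← intervalIntegral.integral_const_mul]
  refine intervalIntegral.integral_congr fun t _ => ?_
  rw [← Complex.exp_add]
  congr 1; push_cast; ring

lemma exp_cont (u : ℝ) : Continuous fun t : ℝ => Complex.exp (u * t * I) := by fun_prop

lemma norm_e (u t : ℝ) : ‖Complex.exp (u * t * I)‖ = 1 := by
  rw [show (u * t * I : ℂ) = ((u * t : ℝ) : ℂ) * I by push_cast; ring]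
  exact Complex.norm_exp_ofReal_mul_I _

lemma cf_summable (n : ℕ) {ε : ℝ} (hε : 0 < ε) (hε1 : ε ≤ 1) (k : ℕ) : Summable fun m => |cf n ε k m| := by
  refine Summable.of_nonneg_of_le (fun m => abs_nonneg _) (fun m => ?_) ((zlogsum_summable n ε hε hε1).mul_right ((k:ℝ) ^ (1 + ε)))
  have hl := Real.log_natCast_nonneg m
  unfold cf
  rw [abs_mul, abs_mul, abs_pow, abs_neg, abs_of_nonneg hl, abs_of_nonneg (by positivity), abs_of_nonneg (by positivity)]
  gcongr
  linarith

lemma WW_hasSum (n : ℕ) {ε : ℝ} (hε : 0 < ε) (hε1 : ε ≤ 1) {k : ℕ} (hk : 1 ≤ k) {T H : ℝ} (hHT : H ≤ T) :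
    HasSum (fun m : ℕ => (cf n ε k m : ℂ) * WW T H (Real.log k - Real.log m))
      (∫ h in (0:ℝ)..H, ∫ t in (H + h)..(T + h),
        iteratedDeriv n riemannZeta (((1 + ε : ℝ) : ℂ) + t * I) * (k:ℂ) ^ (((1 + ε : ℝ) : ℂ) + t * I)) := by
  have hs := cf_summable n hε hε1 k
  have h1 : ∀ h : ℝ, HasSum (fun m : ℕ => (cf n ε k m : ℂ) * (Complex.exp (((Real.log k - Real.log m : ℝ) : ℂ) * h * I) *
      ∫ t in H..T, Complex.exp (((Real.log k - Real.log m : ℝ) : ℂ) * t * I)))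
      (∫ t in (H + h)..(T + h), iteratedDeriv n riemannZeta (((1 + ε : ℝ) : ℂ) + t * I) * (k:ℂ) ^ (((1 + ε : ℝ) : ℂ) + t * I)) := by
    intro h
    have := hasSum_int (f := fun (m : ℕ) (t : ℝ) => (cf n ε k m : ℂ) * Complex.exp (((Real.log k - Real.log m : ℝ) : ℂ) * t * I))
      (fun m => continuous_const.mul (exp_cont _)) (fun m t => by
        rw [norm_mul, norm_e, mul_one, Complex.norm_real, Real.norm_eq_abs]) hs (fun t => dk_hasSum n hε hk t) (H + h) (T + h)
    simp_rw [intervalIntegral.integral_const_mul, shift_int] at this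
    exact this
  have := hasSum_int (f := fun (m : ℕ) (h : ℝ) => (cf n ε k m : ℂ) * (Complex.exp (((Real.log k - Real.log m : ℝ) : ℂ) * h * I) *
      ∫ t in H..T, Complex.exp (((Real.log k - Real.log m : ℝ) : ℂ) * t * I))) (fun m => continuous_const.mul ((exp_cont _).mul continuous_const)) (fun m t => by
    rw [norm_mul, norm_mul, norm_e, one_mul, Complex.norm_real, Real.norm_eq_abs]
    exact mul_le_mul_of_nonneg_left (exp_int_bound' _ _ _ hHT) (abs_nonneg _)) (hs.mul_right (T - H)) h1 0 H
  simp_rw [intervalIntegral.integral_const_mul, intervalIntegral.integral_mul_const] at this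
  exact this

lemma exp_int_eval (u a b : ℝ) (hu : u ≠ 0) : ∫ t in a..b, Complex.exp (u * t * I) =
    (1 / (u:ℂ)) * (-I) * (Complex.exp (u * b * I) - Complex.exp (u * a * I)) := by
  have h1 : ∀ t : ℝ, Complex.exp (u * t * I) = Complex.exp ((u * I) * t) := by
    intro t; congr 1; ring
  simp_rw [h1]
  have hc : (u * I : ℂ) ≠ 0 := by simp [hu]
  have hu' : (u:ℂ) ≠ 0 := by exact_mod_cast hu
  rw [integral_exp_mul_complex hc, div_eq_iff hc]
  field_simp
  rw [I_sq]; ring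

lemma sum_sym (f : ℕ → ℂ) {k : ℕ} : ∀ {D : ℕ}, D < k →
    ∑ m ∈ Icc (k - D) (k + D), f m = f k + ∑ d ∈ Ioc 0 D, (f (k + d) + f (k - d)) := by
  intro D
  induction D with
  | zero => simp
  | succ D ih =>
    intro h
    rw [Finset.sum_Ioc_succ_top (Nat.zero_le D), ← add_assoc (f k), ← ih (by omega), ← add_assoc k D 1, Finset.sum_Icc_succ_top (by omega)]
    have : Icc (k - (D+1)) (k + D) = insert (k - (D+1)) (Icc (k - D) (k + D)) := by
      ext x; simp only [Finset.mem_insert, Finset.mem_Icc]; omega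
    rw [this, Finset.sum_insert (by simp; omega)]
    ring

lemma avg_kernel (n : ℕ) : ∃ C : ℝ, 0 < C ∧ ∀ (T H L : ℝ) (k : ℕ), 4 ≤ L → L ≤ H → T ≤ H ^ 2 → H ≤ T → 1 ≤ k →
    1 + Real.log k ≤ 2 * L →
    ‖(∫ h in (0:ℝ)..H, ∫ t in (H + h)..(T + h),
        iteratedDeriv n riemannZeta (((1 + 1/L : ℝ) : ℂ) + t * I) * (k:ℂ) ^ (((1 + 1/L : ℝ) : ℂ) + t * I)) -
      ((H * (T - H) * (-Real.log k) ^ n : ℝ) : ℂ)‖ ≤ C * L ^ n * k * H := by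
  obtain ⟨C1, hC1, hfar⟩ := far_bound n
  obtain ⟨C2, hC2, hnear⟩ := near_sum n
  refine ⟨C1 + 2 * C2, by positivity, fun T H L k hL hLH hTH hHT hk hlk => ?_⟩
  have hL0 : 0 < L := by linarith
  have hε : 0 < 1 / L := by positivity
  have hε1 : 1 / L ≤ 1 := by rw [div_le_one hL0]; linarith
  have hk1 : (1:ℝ) ≤ k := by exact_mod_cast hk
  have hH : 4 ≤ H := by linarith
  set D := ⌊(k:ℝ) / H⌋₊ with hDdef
  have hD1 : (D:ℝ) * H ≤ k := by
    rw [← le_div_iff₀ (by linarith)]; exact Nat.floor_le (by positivity)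
  have hD2 : (k:ℝ) ≤ (D + 1) * H := by
    rw [← div_le_iff₀ (by linarith)]; exact (Nat.lt_floor_add_one _).le
  have hDk : D < k := by
    have : (D:ℝ) < k := by nlinarith
    exact_mod_cast this
  have hfar' := hfar T H L k D hL hLH hk hlk hD2 hDk _ (WW_hasSum n hε hε1 hk hHT)
  rw [sum_sym _ hDk] at hfar'
  have hdiag : (cf n (1/L) k k : ℂ) * WW T H (Real.log k - Real.log k) = ((H * (T - H) * (-Real.log k) ^ n : ℝ) : ℂ) := by
    rw [cf_eq n _ hk hk]
    unfold WW
    simp only [sub_self, Complex.ofReal_zero, zero_mul, Complex.exp_zero, mul_zero, Real.exp_zero, mul_one]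
    rw [intervalIntegral.integral_const, intervalIntegral.integral_const, neg_pow]
    simp only [sub_zero, Complex.real_smul, mul_one]
    push_cast; ring
  rw [hdiag] at hfar'
  -- near
  have hne : ∀ m : ℕ, 1 ≤ m → m ≠ k → Real.log k - Real.log m ≠ 0 := by
    intro m hm hmk
    rw [sub_ne_zero]
    intro h
    have := Real.log_injOn_pos (Set.mem_Ioi.mpr (by linarith : (0:ℝ) < k)) (Set.mem_Ioi.mpr (by exact_mod_cast hm : (0:ℝ) < m)) h
    exact hmk (by exact_mod_cast this.symm)
  set gg : ℕ → ℝ → ℂ := fun m Y => (((Real.log (m : ℝ)) ^ n * Real.exp ((1 + 1/L) * (Real.log k - Real.log (m : ℝ))) / (Real.log k - Real.log (m : ℝ)) : ℝ) : ℂ)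
        * Complex.exp (((Real.log k - Real.log (m : ℝ) : ℝ) : ℂ) * Y * I) with hgg
  have hWW : ∀ m : ℕ, 1 ≤ m → m ≠ k → (cf n (1/L) k m : ℂ) * WW T H (Real.log k - Real.log m) =
      ∫ h in (0:ℝ)..H, (-1) ^ n * (-I) * (gg m (T + h : ℝ) - gg m (H + h : ℝ)) := by
    intro m hm hmk
    have hu := hne m hm hmk
    unfold WW
    rw [← intervalIntegral.integral_mul_const, ← intervalIntegral.integral_const_mul]
    refine intervalIntegral.integral_congr fun h _ => ?_
    rw [← shift_int, exp_int_eval _ _ _ hu, cf_eq n _ hk hm]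
    simp only [hgg]
    rw [Complex.ofReal_div, Complex.ofReal_mul ((-1:ℝ)^n)]
    push_cast
    ring
  have hnear' : ‖∑ d ∈ Ioc 0 D, ((cf n (1/L) k (k + d) : ℂ) * WW T H (Real.log k - Real.log (k + d : ℕ)) +
      (cf n (1/L) k (k - d) : ℂ) * WW T H (Real.log k - Real.log (k - d : ℕ)))‖ ≤ 2 * (C2 * L ^ n * k) * H := by
    have hcont : ∀ m, Continuous fun h : ℝ => (-1) ^ n * (-I) * (gg m (T + h : ℝ) - gg m (H + h : ℝ)) := by
      intro m; simp only [hgg]; fun_prop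
    have e : ∑ d ∈ Ioc 0 D, ((cf n (1/L) k (k + d) : ℂ) * WW T H (Real.log k - Real.log (k + d : ℕ)) +
      (cf n (1/L) k (k - d) : ℂ) * WW T H (Real.log k - Real.log (k - d : ℕ))) =
      ∫ h in (0:ℝ)..H, (-1) ^ n * (-I) * (∑ d ∈ Ioc 0 D, (gg (k + d) (T + h : ℝ) + gg (k - d) (T + h : ℝ)) -
        ∑ d ∈ Ioc 0 D, (gg (k + d) (H + h : ℝ) + gg (k - d) (H + h : ℝ))) := by
      have : ∀ d ∈ Ioc 0 D, ((cf n (1/L) k (k + d) : ℂ) * WW T H (Real.log k - Real.log (k + d : ℕ)) +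
      (cf n (1/L) k (k - d) : ℂ) * WW T H (Real.log k - Real.log (k - d : ℕ))) = ∫ h in (0:ℝ)..H,
        ((-1) ^ n * (-I) * (gg (k + d) (T + h : ℝ) - gg (k + d) (H + h : ℝ)) + (-1) ^ n * (-I) * (gg (k - d) (T + h : ℝ) - gg (k - d) (H + h : ℝ))) := by
        intro d hd
        rw [Finset.mem_Ioc] at hd
        rw [hWW _ (by omega) (by omega), hWW _ (by omega) (by omega), intervalIntegral.integral_add ((hcont _).intervalIntegrable _ _) ((hcont _).intervalIntegrable _ _)]
      rw [Finset.sum_congr rfl this, ← intervalIntegral.integral_finsetSum (f := fun (d : ℕ) (h : ℝ) => (-1) ^ n * (-I) * (gg (k + d) (T + h : ℝ) - gg (k + d) (H + h : ℝ)) + (-1) ^ n * (-I) * (gg (k - d) (T + h : ℝ) - gg (k - d) (H + h : ℝ))) (fun d _ => ((hcont _).add (hcont _)).intervalIntegrable _ _)]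
      refine intervalIntegral.integral_congr fun h _ => ?_
      rw [← Finset.sum_sub_distrib, Finset.mul_sum]
      refine Finset.sum_congr rfl fun d _ => ?_
      ring
    rw [e]
    have := intervalIntegral.norm_integral_le_of_norm_le_const (a := 0) (b := H) (C := 2 * (C2 * L ^ n * k))
      (f := fun h : ℝ => (-1) ^ n * (-I) * (∑ d ∈ Ioc 0 D, (gg (k + d) (T + h : ℝ) + gg (k - d) (T + h : ℝ)) -
        ∑ d ∈ Ioc 0 D, (gg (k + d) (H + h : ℝ) + gg (k - d) (H + h : ℝ)))) (fun h hh => by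
        rw [Set.uIoc_of_le (by linarith)] at hh
        have hHH : H ≤ H ^ 2 := by nlinarith
        have b1 := hnear L H (T + h) (1/L) k D (by linarith) hH hk (by linarith) hε hε1 (by linarith [hh.1]) (by linarith [hh.2]) hD1
        have b2 := hnear L H (H + h) (1/L) k D (by linarith) hH hk (by linarith) hε hε1 (by linarith [hh.1]) (by linarith [hh.2]) hD1
        rw [norm_mul, norm_mul, norm_pow, norm_neg, norm_one, one_pow, norm_neg, Complex.norm_I, one_mul, one_mul]
        refine (norm_sub_le _ _).trans ?_
        rw [two_mul]
        exact add_le_add b1 b2)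
    rwa [sub_zero, abs_of_nonneg (by linarith)] at this
  calc _ = ‖((∫ h in (0:ℝ)..H, ∫ t in (H + h)..(T + h),
        iteratedDeriv n riemannZeta (((1 + 1/L : ℝ) : ℂ) + t * I) * (k:ℂ) ^ (((1 + 1/L : ℝ) : ℂ) + t * I)) -
      (((H * (T - H) * (-Real.log k) ^ n : ℝ) : ℂ) + ∑ d ∈ Ioc 0 D, ((cf n (1/L) k (k + d) : ℂ) * WW T H (Real.log k - Real.log (k + d : ℕ)) +
      (cf n (1/L) k (k - d) : ℂ) * WW T H (Real.log k - Real.log (k - d : ℕ))))) + ∑ d ∈ Ioc 0 D, ((cf n (1/L) k (k + d) : ℂ) * WW T H (Real.log k - Real.log (k + d : ℕ)) +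
      (cf n (1/L) k (k - d) : ℂ) * WW T H (Real.log k - Real.log (k - d : ℕ)))‖ := by congr 1; ring
    _ ≤ C1 * L ^ n * k * H + 2 * (C2 * L ^ n * k) * H := (norm_add_le _ _).trans (add_le_add hfar' hnear')
    _ = _ := by ring

end KKY

namespace KKY

lemma rect_shift {F : ℂ → ℂ} {a c b d : ℝ} (hac : a ≤ c) (hbd : b ≤ d)
    (hF : DifferentiableOn ℂ F (rect a c b d)) :
    ‖(∫ y : ℝ in b..d, F (a + y * I)) - ∫ y : ℝ in b..d, F (c + y * I)‖ ≤
      ‖∫ x : ℝ in a..c, F (x + b * I)‖ + ‖∫ x : ℝ in a..c, F (x + d * I)‖ := by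
  have h := rectInt_eq_zero hac hbd hF
  unfold rectInt at h
  have e : I * ((∫ y : ℝ in b..d, F (a + y * I)) - ∫ y : ℝ in b..d, F (c + y * I)) =
      (∫ x : ℝ in a..c, F (x + b * I)) - ∫ x : ℝ in a..c, F (x + d * I) := by
    linear_combination -h
  have := congrArg norm e
  rw [norm_mul, Complex.norm_I, one_mul] at this
  rw [this]
  exact norm_sub_le _ _

/-- parameters -/
structure Big (n : ℕ) (T L H : ℝ) : Prop where
  L8 : 8 ≤ L
  expL : Real.exp L = T
  H0 : 0 < H
  HH : H ^ 2 = T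
  LH : L ^ (3 * n + 10) ≤ H

lemma Big.Hbig {n : ℕ} {T L H : ℝ} (h : Big n T L H) : 8 ^ 10 ≤ H := by
  refine le_trans ?_ h.LH
  calc (8:ℝ) ^ 10 ≤ L ^ 10 := by gcongr; exact h.L8
    _ ≤ _ := pow_le_pow_right₀ (by linarith [h.L8]) (by omega)

lemma Big.powH {n : ℕ} {T L H : ℝ} (h : Big n T L H) {j : ℕ} (hj : j ≤ 3 * n + 10) : L ^ j ≤ H :=
  (pow_le_pow_right₀ (by linarith [h.L8]) hj).trans h.LH

lemma Big.LleH {n : ℕ} {T L H : ℝ} (h : Big n T L H) : L ≤ H := by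
  simpa using h.powH (j := 1) (by omega)

lemma Big.HT {n : ℕ} {T L H : ℝ} (h : Big n T L H) : 8 ^ 10 * H ≤ T := by
  rw [← h.HH, sq]
  exact mul_le_mul_of_nonneg_right h.Hbig h.H0.le

lemma Big.exp2L {n : ℕ} {T L H : ℝ} (h : Big n T L H) : Real.exp (2 * L) = T * T := by
  rw [two_mul, Real.exp_add, h.expL]

lemma zd_diff (n : ℕ) {s : ℂ} (hs : s.im ≠ 0) : DifferentiableAt ℂ (iteratedDeriv n riemannZeta) s := by
  have := ((zeta_analyticAt hs).iterated_deriv n).differentiableAt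
  rwa [← iteratedDeriv_eq_iterate] at this

lemma exp_line_int {L : ℝ} (hL : 0 < L) :
    ∫ x in (-(1/L))..(1 + 1/L), Real.exp ((x - 1) * L / 4) ≤ 8 / L := by
  have hd : ∀ x : ℝ, HasDerivAt (fun x : ℝ => Real.exp ((x - 1) * L / 4) * (4 / L)) (Real.exp ((x - 1) * L / 4)) x := by
    intro x
    have h1 : HasDerivAt (fun x : ℝ => (x - 1) * L / 4) (1 * L / 4) x := (((hasDerivAt_id x).sub_const 1).mul_const L).div_const 4
    refine (h1.exp.mul_const (4 / L)).congr_deriv ?_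
    field_simp
  rw [intervalIntegral.integral_eq_sub_of_hasDerivAt (fun x _ => hd x) (by apply Continuous.intervalIntegrable; fun_prop)]
  have e1 : Real.exp ((1 + 1/L - 1) * L / 4) ≤ 2 := by
    have : (1 + 1/L - 1) * L / 4 = 1/4 := by field_simp; ring
    rw [this]
    have h2 : Real.exp (1/4) ≤ Real.exp (Real.log 2) := Real.exp_le_exp.mpr (by linarith [Real.log_two_gt_d9])
    rwa [Real.exp_log (by norm_num)] at h2
  have e2 : 0 ≤ Real.exp ((-(1/L) - 1) * L / 4) * (4 / L) := by positivity
  have e3 : Real.exp ((1 + 1/L - 1) * L / 4) * (4 / L) ≤ 2 * (4 / L) := by gcongr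
  have e4 : 2 * (4 / L) = 8 / L := by ring
  linarith

/-- horizontal bound pointwise -/
lemma hor_pt {L lk κ Y σ : ℝ} (hL : 8 ≤ L) (hlk0 : 0 ≤ lk) (hlκ : lk ≤ κ) (hκ1 : 3 / 4 * L ≤ κ) (hκ2 : κ ≤ 2 * L) (hY0 : 1 ≤ Y)
    (hY : Y ≤ 3 * Real.exp L) (h1 : -(1/L) ≤ σ) (h2 : σ ≤ 1 + 1/L) :
    Y ^ ((1 - σ) / 2) * Real.exp (lk * σ) ≤ Real.exp 8 * Real.exp κ * Real.exp ((σ - 1) * L / 4) := by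
  have hL0 : 0 < L := by linarith
  have hlog : Real.log Y ≤ L + 2 := by
    have := Real.log_le_log (by linarith) hY
    rw [Real.log_mul (by norm_num) (Real.exp_pos _).ne', Real.log_exp] at this
    have h3 : Real.log 3 ≤ 2 := by
      have := Real.log_le_sub_one_of_pos (show (0:ℝ) < 3 by norm_num)
      linarith
    linarith
  have hlog0 := Real.log_nonneg hY0
  rw [Real.rpow_def_of_pos (by linarith), ← Real.exp_add, ← Real.exp_add, ← Real.exp_add]
  apply Real.exp_le_exp.mpr
  have hs1 : -1 ≤ σ * L := by
    have := mul_le_mul_of_nonneg_right h1 hL0.le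
    rwa [neg_mul, one_div, inv_mul_cancel₀ hL0.ne'] at this
  have hs2 : (σ - 1) * L ≤ 1 := by
    have := mul_le_mul_of_nonneg_right (show σ - 1 ≤ 1/L by linarith) hL0.le
    rwa [one_div, inv_mul_cancel₀ hL0.ne'] at this
  have hLi : 1 / L ≤ 1/8 := one_div_le_one_div_of_le (by norm_num) hL
  -- log Y part
  have p1 : Real.log Y * ((1 - σ) / 2) ≤ L * (1 - σ) / 2 + 2 := by
    rcases le_total σ 1 with h | h
    · nlinarith
    · nlinarith
  have p2 : lk * σ ≤ κ * σ + 2 := by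
    rcases le_total 0 σ with h | h
    · nlinarith
    · nlinarith
  have p3 : L * (1 - σ) / 2 + κ * σ ≤ κ + (σ - 1) * L / 4 + 2 := by
    rcases le_total σ 1 with h | h
    · nlinarith
    · nlinarith
  linarith

lemma Jk_shift (n : ℕ) : ∃ C : ℝ, 0 < C ∧ ∀ (T L H : ℝ), Big n T L H → ∀ k : ℕ, 1 ≤ k → (k:ℝ) ≤ 2 * T → ∀ B U : ℝ, 1 ≤ B → B ≤ U → U ≤ 2 * T →
    ‖(∫ y : ℝ in B..U, iteratedDeriv n riemannZeta (((-(1/L) : ℝ) : ℂ) + y * I) * (k:ℂ) ^ (((-(1/L) : ℝ) : ℂ) + y * I)) -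
      ∫ y : ℝ in B..U, iteratedDeriv n riemannZeta (((1 + 1/L : ℝ) : ℂ) + y * I) * (k:ℂ) ^ (((1 + 1/L : ℝ) : ℂ) + y * I)‖ ≤
      C * L ^ n * (k + T ^ (3/4 : ℝ)) := by
  obtain ⟨C, hC, hst⟩ := zeta_deriv_strip n
  refine ⟨2 * (C * Real.exp 8 * 8), by positivity, fun T L H hT k hk hk2 B U hB hBU hU => ?_⟩
  have hL := hT.L8
  have hL0 : 0 < L := by linarith
  have hk1 : (1:ℝ) ≤ k := by exact_mod_cast hk
  have hTb : 8 ^ 10 ≤ T := by nlinarith [hT.HT, hT.Hbig]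
  have hT0 : 0 < T := by linarith
  have hac : -(1/L) ≤ 1 + 1/L := by
    have : 0 < 1 / L := by positivity
    linarith
  have hhor : ∀ Y : ℝ, 1 ≤ Y → Y ≤ 2 * T → ‖∫ x : ℝ in (-(1/L))..(1 + 1/L), iteratedDeriv n riemannZeta (x + Y * I) * (k:ℂ) ^ (x + Y * I : ℂ)‖ ≤
      C * Real.exp 8 * 8 * L ^ n * (k + T ^ (3/4 : ℝ)) := by
    intro Y hY1 hY2
    set κ := max (Real.log k) (3/4 * L) with hκ
    have hlk := Real.log_nonneg hk1
    have hκ2 : κ ≤ 2 * L := by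
      refine max_le ?_ (by linarith)
      have := Real.log_le_log (by linarith) hk2
      rw [Real.log_mul (by norm_num) hT0.ne', ← hT.expL, Real.log_exp] at this
      linarith [Real.log_two_lt_d9]
    have hexpκ : Real.exp κ ≤ k + T ^ (3/4 : ℝ) := by
      have t0 : 0 ≤ T ^ (3/4 : ℝ) := by positivity
      rcases max_cases (Real.log k) (3/4 * L) with ⟨h, _⟩ | ⟨h, _⟩
      · rw [hκ, h, Real.exp_log (by linarith)]; linarith
      · rw [hκ, h, ← hT.expL, ← Real.exp_mul, mul_comm]; linarith
    have hpt : ∀ x ∈ Set.Icc (-(1/L)) (1 + 1/L), ‖iteratedDeriv n riemannZeta (x + Y * I) * (k:ℂ) ^ (x + Y * I : ℂ)‖ ≤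
        C * L ^ (n + 1) * (Real.exp 8 * Real.exp κ) * Real.exp ((x - 1) * L / 4) := by
      intro x hx
      have h1 := hst L (by linarith) x Y hx.1 hx.2 (by rw [abs_of_nonneg (by linarith)]; exact hY1)
        (by rw [abs_of_nonneg (by linarith), hT.exp2L]; nlinarith)
      rw [abs_of_nonneg (by linarith)] at h1
      have h2 : ‖(k:ℂ) ^ (x + Y * I : ℂ)‖ = Real.exp (Real.log k * x) := by
        rw [Complex.norm_natCast_cpow_of_pos (by omega), Real.rpow_def_of_pos (by linarith)]
        simp
      rw [norm_mul, h2]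
      have h3 := hor_pt (σ := x) (Y := 5 + Y) hL hlk (le_max_left _ (3/4 * L)) (le_max_right _ _) hκ2 (by linarith) (by rw [hT.expL]; linarith) hx.1 hx.2
      calc _ ≤ C * L ^ (n + 1) * (5 + Y) ^ ((1 - x) / 2) * Real.exp (Real.log k * x) := by gcongr
        _ = C * L ^ (n + 1) * ((5 + Y) ^ ((1 - x) / 2) * Real.exp (Real.log k * x)) := by ring
        _ ≤ C * L ^ (n + 1) * (Real.exp 8 * Real.exp κ * Real.exp ((x - 1) * L / 4)) := by gcongr
        _ = _ := by ring
    calc _ ≤ ∫ x : ℝ in (-(1/L))..(1 + 1/L), C * L ^ (n + 1) * (Real.exp 8 * Real.exp κ) * Real.exp ((x - 1) * L / 4) := by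
          refine intervalIntegral.norm_integral_le_of_norm_le hac (Eventually.of_forall fun x hx => hpt x ⟨hx.1.le, hx.2⟩) ?_
          apply Continuous.intervalIntegrable; fun_prop
      _ ≤ C * L ^ (n + 1) * (Real.exp 8 * Real.exp κ) * (8 / L) := by
          rw [intervalIntegral.integral_const_mul]
          gcongr
          exact exp_line_int hL0
      _ = C * Real.exp 8 * 8 * L ^ n * Real.exp κ := by rw [pow_succ]; field_simp
      _ ≤ _ := by gcongr
  have hF : DifferentiableOn ℂ (fun s => iteratedDeriv n riemannZeta s * (k:ℂ) ^ s) (rect (-(1/L)) (1 + 1/L) B U) := by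
    intro s hs
    have him : s.im ≠ 0 := by
      have := hs.2.2.1
      intro h0; linarith
    refine ((zd_diff n him).mul ?_).differentiableWithinAt
    exact (differentiableAt_id).const_cpow (Or.inl (by exact_mod_cast (by omega : k ≠ 0)))
  have := rect_shift hac hBU hF
  refine this.trans ?_
  have a1 := hhor B hB (hBU.trans hU)
  have a2 := hhor U (hB.trans hBU) hU
  linarith

end KKY

namespace KKY
open ArithmeticFunction (vonMangoldt)

/-- remainder -/
noncomputable def RR (N : ℕ) (s : ℂ) : ℂ := -(deriv riemannZeta (1 - s) / riemannZeta (1 - s)) -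
  ∑ k ∈ Ioc 0 N, ((vonMangoldt k : ℝ) : ℂ) * (k : ℂ) ^ (-(1 - s))

lemma RR_bound (n : ℕ) : ∃ C : ℝ, 0 < C ∧ ∀ T L H : ℝ, Big n T L H → ∀ x t : ℝ, 1/L ≤ x →
    ‖RR ⌊2 * T⌋₊ (((-x : ℝ) : ℂ) + t * I)‖ ≤ C * L ^ 2 * (2 * T) ^ (-x) := by
  obtain ⟨C, hC, hz⟩ := zlogsum 1
  refine ⟨C * Real.exp 2, by positivity, fun T L H hT x t hx => ?_⟩
  have hL := hT.L8
  have hL0 : 0 < L := by linarith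
  have hε : 0 < 1 / L := by positivity
  have hε1 : 1 / L ≤ 1 := by rw [div_le_one hL0]; linarith
  have hTb : 8 ^ 10 ≤ T := by nlinarith [hT.HT, hT.Hbig]
  have hT0 : 0 < T := by linarith
  set w : ℂ := 1 - (((-x : ℝ) : ℂ) + t * I) with hw
  have hwre : w.re = 1 + x := by simp [hw]
  unfold RR
  rw [← hw]
  set N := ⌊2 * T⌋₊ with hN
  set A := Real.exp 2 * (2 * T) ^ (-x) with hA
  have hA0 : 0 < A := by positivity
  set g : ℕ → ℝ := fun m => A * ((1 + Real.log m) ^ 1 * (m:ℝ) ^ (-(1 + 1/L))) with hg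
  have hg0 : ∀ m, 0 ≤ g m := by
    intro m
    have := Real.log_natCast_nonneg m
    simp only [hg]; positivity
  refine (hasSum_fin (vm_hasSum (s := w) (by rw [hwre]; linarith)) (Ioc 0 N) (g := g) (B := A * (C / (1/L) ^ (1 + 1))) ?_ hg0 ?_).trans ?_
  · intro m hm
    rcases Nat.eq_zero_or_pos m with rfl | hm0
    · simpa using hg0 0
    have hmN : N < m := by
      rw [Finset.mem_Ioc] at hm; omega
    have hm2 : 2 * T ≤ m := (Nat.lt_of_floor_lt hmN).le
    have hmr : (0:ℝ) < m := by exact_mod_cast hm0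
    have hlm := Real.log_natCast_nonneg m
    rw [norm_mul, Complex.norm_natCast_cpow_of_pos hm0, Complex.norm_real, Complex.neg_re, hwre, Real.norm_eq_abs,
      abs_of_nonneg ArithmeticFunction.vonMangoldt_nonneg]
    have e1 : (m:ℝ) ^ (-(1 + x)) = (m:ℝ) ^ (-(1 + 1/L)) * (m:ℝ) ^ (-(x - 1/L)) := by
      rw [← Real.rpow_add hmr]; congr 1; ring
    have e2 : (m:ℝ) ^ (-(x - 1/L)) ≤ (2 * T) ^ (-(x - 1/L)) :=
      Real.rpow_le_rpow_of_nonpos (by positivity) hm2 (by linarith)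
    have e3 : (2 * T) ^ (-(x - 1/L)) = (2 * T) ^ (-x) * (2 * T) ^ (1/L) := by
      rw [← Real.rpow_add (by positivity)]; congr 1; ring
    have e4 : (2 * T) ^ (1/L) ≤ Real.exp 2 := by
      rw [Real.rpow_def_of_pos (by positivity)]
      apply Real.exp_le_exp.mpr
      rw [mul_one_div, div_le_iff₀ hL0, Real.log_mul (by norm_num) hT0.ne', ← hT.expL, Real.log_exp]
      linarith [Real.log_two_lt_d9]
    have e5 : vonMangoldt m ≤ 1 + Real.log m := by
      linarith [ArithmeticFunction.vonMangoldt_le_log (n := m)]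
    calc _ ≤ (1 + Real.log m) * ((m:ℝ) ^ (-(1 + 1/L)) * ((2 * T) ^ (-x) * Real.exp 2)) := by
          rw [e1]
          have := e2.trans (e3.le.trans (mul_le_mul_of_nonneg_left e4 (by positivity)))
          gcongr
      _ = g m := by simp only [hg, hA]; ring
  · intro M
    have e : range (M + 1) = insert 0 (Ioc 0 M) := by ext k; simp
    have g0 : g 0 = 0 := by
      simp only [hg]
      rw [Nat.cast_zero, Real.zero_rpow (by linarith)]; simp
    calc _ ≤ ∑ m ∈ range (M + 1), g m := by rw [Finset.sum_range_succ]; linarith [hg0 M]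
      _ = ∑ m ∈ Ioc 0 M, g m := by rw [e, Finset.sum_insert (by simp), g0, zero_add]
      _ ≤ _ := by
        simp only [hg]
        rw [← Finset.mul_sum]
        exact mul_le_mul_of_nonneg_left (hz _ hε hε1 M) hA0.le
  · apply le_of_eq
    rw [hA, one_div, inv_pow, div_inv_eq_mul]; ring

lemma log_deriv_diff {s : ℂ} (hs : 1 < s.re) : DifferentiableAt ℂ (fun z => deriv riemannZeta z / riemannZeta z) s := by
  have h1 : s ≠ 1 := by rintro rfl; simp at hs
  have hU : IsOpen {z : ℂ | z ≠ 1} := isOpen_ne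
  have hd : DifferentiableOn ℂ riemannZeta {z : ℂ | z ≠ 1} := fun z hz => (differentiableAt_riemannZeta hz).differentiableWithinAt
  have ha := hd.analyticAt (hU.mem_nhds h1)
  exact ha.deriv.differentiableAt.div ha.differentiableAt (riemannZeta_ne_zero_of_one_le_re hs.le)

lemma RR_diff (N : ℕ) {s : ℂ} (hs : s.re < 0) : DifferentiableAt ℂ (RR N) s := by
  have h1 : DifferentiableAt ℂ (fun s : ℂ => 1 - s) s := (differentiableAt_const _).sub differentiableAt_id
  have h2 : DifferentiableAt ℂ (fun s : ℂ => deriv riemannZeta (1 - s) / riemannZeta (1 - s)) s :=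
    DifferentiableAt.comp s (f := fun s : ℂ => 1 - s) (g := fun z => deriv riemannZeta z / riemannZeta z)
      (log_deriv_diff (by simp; linarith)) h1
  unfold RR
  refine h2.neg.sub ?_
  refine DifferentiableAt.fun_sum fun k hk => ?_
  have hk0 : k ≠ 0 := by rw [Finset.mem_Ioc] at hk; omega
  exact (h1.neg.const_cpow (Or.inl (by exact_mod_cast hk0))).const_mul _

lemma R_int (n : ℕ) : ∃ C : ℝ, 0 < C ∧ ∀ T L H : ℝ, Big n T L H → ∀ B U : ℝ, 1 ≤ B → B ≤ U → U ≤ T + H →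
    ‖∫ y : ℝ in B..U, RR ⌊2 * T⌋₊ (((-(1/L) : ℝ) : ℂ) + y * I) * iteratedDeriv n riemannZeta (((-(1/L) : ℝ) : ℂ) + y * I)‖ ≤ C * (T * L ^ n) := by
  obtain ⟨C1, hC1, hR⟩ := RR_bound n
  obtain ⟨C2, hC2, hz⟩ := zeta_deriv_left n
  refine ⟨8 * (C1 * C2), by positivity, fun T L H hT B U hB hBU hU => ?_⟩
  have hL := hT.L8
  have hL0 : 0 < L := by linarith
  have hε : 0 < 1 / L := by positivity
  have hε1 : 1 / L ≤ 1 := by rw [div_le_one hL0]; linarith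
  have hH0 := hT.H0
  have hTH := hT.HT
  have hHb := hT.Hbig
  have hLH := hT.LleH
  have hT0 : 0 < T := by nlinarith
  set N := ⌊2 * T⌋₊ with hN
  set F : ℂ → ℂ := fun s => RR N s * iteratedDeriv n riemannZeta s with hF
  have hpt : ∀ x Y : ℝ, 1/L ≤ x → x ≤ L → 1 ≤ Y → Y ≤ T + H → ‖F (((-x : ℝ) : ℂ) + Y * I)‖ ≤ C1 * C2 * L ^ (n + 3) * (2 * H) * Real.exp (-x) := by
    intro x Y hx hxL hY hY2
    have hx0 : 0 < x := by linarith
    have a1 := hR T L H hT x Y hx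
    have hle : 4 + Y + x ≤ 2 * T := by linarith
    have a2 := hz L (by linarith) x Y hx (by rw [abs_of_nonneg (by linarith)]; exact hY)
      (by rw [abs_of_nonneg (by linarith), hT.exp2L]; nlinarith)
    rw [abs_of_nonneg (by linarith)] at a2
    have e : ((-x : ℝ) : ℂ) + Y * I = -(x:ℂ) + Y * I := by push_cast; ring
    have a3 : (4 + Y + x) ^ (x + 1/2) ≤ (2 * T) ^ x * (2 * H) := by
      calc _ ≤ (2 * T) ^ (x + 1/2) := Real.rpow_le_rpow (by linarith) hle (by linarith)
        _ = (2 * T) ^ x * (2 * T) ^ (1/2 : ℝ) := Real.rpow_add (by positivity) _ _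
        _ ≤ _ := by
          gcongr
          rw [← Real.sqrt_eq_rpow]
          apply Real.sqrt_le_iff.mpr ⟨by positivity, ?_⟩
          nlinarith [hT.HH]
    have a4 : (2 * Real.pi) ^ (-x) ≤ Real.exp (-x) := by
      rw [Real.rpow_def_of_pos (by positivity)]
      apply Real.exp_le_exp.mpr
      have : 1 ≤ Real.log (2 * Real.pi) := by
        rw [Real.le_log_iff_exp_le (by positivity)]
        linarith [Real.exp_one_lt_d9, Real.pi_gt_three]
      nlinarith
    have a5 : (2 * T) ^ (-x) * (2 * T) ^ x = 1 := by
      rw [← Real.rpow_add (by positivity)]; simp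
    simp only [hF]
    rw [norm_mul]
    calc _ ≤ (C1 * L ^ 2 * (2 * T) ^ (-x)) * (C2 * L ^ (n + 1) * Real.exp (-x) * ((2 * T) ^ x * (2 * H))) := by
          refine mul_le_mul a1 ?_ (norm_nonneg _) (by positivity)
          rw [e]
          refine a2.trans ?_
          gcongr
      _ = C1 * C2 * L ^ (n + 3) * (2 * H) * Real.exp (-x) * ((2 * T) ^ (-x) * (2 * T) ^ x) := by ring
      _ = _ := by rw [a5, mul_one]
  have hac : -L ≤ -(1/L) := by linarith
  have hFd : DifferentiableOn ℂ F (rect (-L) (-(1/L)) B U) := by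
    intro s hs
    have him : s.im ≠ 0 := by
      have := hs.2.2.1
      intro h0; linarith
    exact ((RR_diff N (by linarith [hs.2.1])).mul (zd_diff n him)).differentiableWithinAt
  have hsh := rect_shift hac hBU hFd
  have hhor : ∀ Y : ℝ, 1 ≤ Y → Y ≤ T + H → ‖∫ x : ℝ in (-L)..(-(1/L)), F (x + Y * I)‖ ≤ C1 * C2 * L ^ (n + 3) * (2 * H) * L := by
    intro Y hY hY2
    have := intervalIntegral.norm_integral_le_of_norm_le_const (a := -L) (b := -(1/L)) (C := C1 * C2 * L ^ (n + 3) * (2 * H))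
      (f := fun x : ℝ => F (x + Y * I)) (fun x hx => by
        rw [Set.uIoc_of_le hac] at hx
        have := hpt (-x) Y (by linarith [hx.2]) (by linarith [hx.1]) hY hY2
        rw [neg_neg] at this
        refine this.trans ?_
        have : Real.exp x ≤ 1 := Real.exp_le_one_iff.mpr (by linarith [hx.2])
        exact mul_le_of_le_one_right (by positivity) this)
    refine this.trans ?_
    gcongr
    rw [abs_of_nonneg (by linarith)]; linarith
  have hver : ‖∫ y : ℝ in B..U, F (((-L : ℝ) : ℂ) + y * I)‖ ≤ C1 * C2 * L ^ (n + 3) * (2 * H) * 2 := by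
    have := intervalIntegral.norm_integral_le_of_norm_le_const (a := B) (b := U) (C := C1 * C2 * L ^ (n + 3) * (2 * H) * Real.exp (-L))
      (f := fun y : ℝ => F (((-L : ℝ) : ℂ) + y * I)) (fun y hy => by
        rw [Set.uIoc_of_le hBU] at hy
        exact hpt L y (by linarith) le_rfl (by linarith [hy.1]) (by linarith [hy.2]))
    refine this.trans ?_
    rw [mul_assoc (C1 * C2 * L ^ (n + 3) * (2 * H))]
    gcongr
    rw [Real.exp_neg, hT.expL, abs_of_nonneg (by linarith), inv_mul_le_iff₀ hT0]
    linarith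
  have p : L ^ (n + 3) * H * L ≤ T * L ^ n := by
    have := hT.powH (j := 4) (by omega)
    calc L ^ (n + 3) * H * L = L ^ n * (H * L ^ 4) := by ring
      _ ≤ L ^ n * (H * H) := by gcongr
      _ = _ := by rw [← hT.HH]; ring
  have p2 : L ^ (n + 3) * H * 2 ≤ T * L ^ n := by
    refine le_trans ?_ p
    gcongr; linarith
  have h1 := hhor B hB (hBU.trans hU)
  have h2 := hhor U (hB.trans hBU) hU
  have hfin : ‖∫ y : ℝ in B..U, F (((-(1/L) : ℝ) : ℂ) + y * I)‖ ≤ ‖∫ y : ℝ in B..U, F (((-L : ℝ) : ℂ) + y * I)‖ +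
      ‖(∫ y : ℝ in B..U, F (((-L : ℝ) : ℂ) + y * I)) - ∫ y : ℝ in B..U, F (((-(1/L) : ℝ) : ℂ) + y * I)‖ := norm_le_norm_add_norm_sub _ _
  have hc : 0 < C1 * C2 := by positivity
  have q1 := mul_le_mul_of_nonneg_left p hc.le
  have q2 := mul_le_mul_of_nonneg_left p2 hc.le
  have : C1 * C2 * L ^ (n + 3) * (2 * H) * L = 2 * (C1 * C2 * (L ^ (n + 3) * H * L)) := by ring
  have : C1 * C2 * L ^ (n + 3) * (2 * H) * 2 = 2 * (C1 * C2 * (L ^ (n + 3) * H * 2)) := by ring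
  have : 8 * (C1 * C2) * (T * L ^ n) = 8 * (C1 * C2 * (T * L ^ n)) := by ring
  have hpos : 0 ≤ C1 * C2 * (T * L ^ n) := by positivity
  refine le_trans hfin ?_
  linarith

end KKY

namespace KKY
open ArithmeticFunction (vonMangoldt)

/-- integrand -/
noncomputable def gM (n : ℕ) (L t : ℝ) : ℂ :=
  deriv riemannZeta (((1 + 1/L : ℝ) : ℂ) - t * I) / riemannZeta (((1 + 1/L : ℝ) : ℂ) - t * I) *
    iteratedDeriv n riemannZeta (1 - (((1 + 1/L : ℝ) : ℂ) - t * I))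

lemma one_sub_line (L t : ℝ) : (1:ℂ) - (((1 + 1/L : ℝ) : ℂ) - t * I) = ((-(1/L) : ℝ) : ℂ) + t * I := by
  push_cast; ring

lemma zd_line_cont (n : ℕ) {a : ℝ} (ha : a ≠ 1) : Continuous fun t : ℝ => iteratedDeriv n riemannZeta ((a : ℂ) + t * I) := by
  rw [← continuousOn_univ]
  refine zd_cont n (by fun_prop) fun t _ h => ha ?_
  have := congrArg Complex.re h
  simpa using this

lemma gM_cont (n : ℕ) {L : ℝ} (hL : 0 < L) : Continuous (gM n L) := by
  have hε : 0 < 1 / L := by positivity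
  unfold gM
  have h1 : Continuous fun t : ℝ => deriv riemannZeta (((1 + 1/L : ℝ) : ℂ) - t * I) / riemannZeta (((1 + 1/L : ℝ) : ℂ) - t * I) := by
    rw [continuous_iff_continuousAt]
    intro t
    have := (log_deriv_diff (s := ((1 + 1/L : ℝ) : ℂ) - t * I) (by simpa using hL)).continuousAt
    exact ContinuousAt.comp (f := fun t : ℝ => ((1 + 1/L : ℝ) : ℂ) - t * I) this (by fun_prop)
  refine h1.mul ?_
  simp_rw [one_sub_line]
  exact zd_line_cont n (by linarith)

lemma gM_edge (n : ℕ) : ∃ C : ℝ, 0 < C ∧ ∀ T L H : ℝ, Big n T L H → ∀ t0 h : ℝ, 1 ≤ t0 → t0 ≤ 2 → 0 ≤ h → h ≤ H →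
    ‖(∫ t in t0..T, gM n L t) - ∫ t in (H + h)..(T + h), gM n L t‖ ≤ C * (T * L ^ n) := by
  obtain ⟨C, hC, hg⟩ := g_mean n
  refine ⟨C * 24, by positivity, fun T L H hT t0 h ht1 ht2 hh0 hh1 => ?_⟩
  have hL := hT.L8
  have hL0 : 0 < L := by linarith
  have hH0 := hT.H0
  have hTH := hT.HT
  have hHb := hT.Hbig
  have hLH := hT.LleH
  have hT0 : 0 < T := by nlinarith
  have hc := gM_cont n hL0
  have hi : ∀ a b, IntervalIntegrable (gM n L) MeasureTheory.volume a b := fun a b => hc.intervalIntegrable a b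
  have e : (∫ t in t0..T, gM n L t) - ∫ t in (H + h)..(T + h), gM n L t =
      (∫ t in t0..(H + h), gM n L t) - ∫ t in T..(T + h), gM n L t := by
    have a1 := intervalIntegral.integral_add_adjacent_intervals (hi t0 (H + h)) (hi (H + h) (T + h))
    have a2 := intervalIntegral.integral_add_adjacent_intervals (hi t0 T) (hi T (T + h))
    linear_combination a2 - a1
  have hnm : ∀ a b, 1 ≤ a → a ≤ b → 5 + b ≤ 4 * T → ‖∫ t in a..b, gM n L t‖ ≤ C * L ^ n * (5 + b) ^ (1/2 : ℝ) * ((b - a) + H) := by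
    intro a b ha hab hb
    refine (intervalIntegral.norm_integral_le_integral_norm hab).trans ?_
    have := hg L (by linarith) a b ha hab (by rw [hT.exp2L]; nlinarith)
    simp only [gM, norm_mul]
    refine this.trans ?_
    have := hT.powH (j := 3 * n + 5) (by omega)
    have : 0 ≤ (5 + b) ^ (1/2 : ℝ) := Real.rpow_nonneg (by linarith) _
    gcongr
  have hsq : ∀ b, 0 ≤ b → 5 + b ≤ 4 * T → (5 + b) ^ (1/2 : ℝ) ≤ 2 * H := by
    intro b h0 hb
    rw [← Real.sqrt_eq_rpow]
    refine Real.sqrt_le_iff.mpr ⟨by positivity, ?_⟩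
    nlinarith [hT.HH]
  rw [e]
  have n1 := hnm t0 (H + h) ht1 (by linarith) (by linarith)
  have n2 := hnm T (T + h) (by linarith) (by linarith) (by linarith)
  have s1 := hsq (H + h) (by linarith) (by linarith)
  have s2 := hsq (T + h) (by linarith) (by linarith)
  have k1 : C * L ^ n * (5 + (H + h)) ^ (1/2 : ℝ) * ((H + h - t0) + H) ≤ C * L ^ n * (2 * H) * (3 * H) := by
    gcongr <;> linarith
  have k2 : C * L ^ n * (5 + (T + h)) ^ (1/2 : ℝ) * ((T + h - T) + H) ≤ C * L ^ n * (2 * H) * (3 * H) := by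
    gcongr <;> linarith
  have k3 : C * L ^ n * (2 * H) * (3 * H) = 6 * (C * (T * L ^ n)) := by rw [← hT.HH]; ring
  have k4 : 0 ≤ C * (T * L ^ n) := by positivity
  refine (norm_sub_le _ _).trans ?_
  linarith

lemma T34 {n : ℕ} {T L H : ℝ} (hT : Big n T L H) : T ^ (3/4 : ℝ) * L ^ 5 ≤ T := by
  set q := H ^ (1/2 : ℝ) with hq
  have hH0 := hT.H0
  have hq0 : 0 < q := by positivity
  have hqH : q ^ 2 = H := by
    rw [hq, ← Real.rpow_natCast, ← Real.rpow_mul hH0.le]; norm_num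
  have hqT : q ^ 4 = T := by rw [← hT.HH, ← hqH]; ring
  have h1 : T ^ (3/4 : ℝ) = q ^ 3 := by
    rw [← hqT, ← Real.rpow_natCast q 4, ← Real.rpow_mul hq0.le, ← Real.rpow_natCast]; norm_num
  have h2 : L ^ 5 ≤ q := by
    refine le_of_sq_le_sq ?_ hq0.le
    rw [hqH, ← pow_mul]
    exact hT.powH (by omega)
  calc _ ≤ q ^ 3 * q := by rw [h1]; gcongr
    _ = T := by rw [← hqT]; ring

lemma lam_sum {n : ℕ} {T L H : ℝ} (hT : Big n T L H) :
    ∑ k ∈ Ioc 0 ⌊2 * T⌋₊, vonMangoldt k / k * (k + T ^ (3/4 : ℝ)) ≤ 20 * T := by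
  have hL := hT.L8
  have hTb : 8 ^ 10 ≤ T := by nlinarith [hT.HT, hT.Hbig]
  have hT0 : 0 < T := by linarith
  set N := ⌊2 * T⌋₊ with hN
  have hN1 : 1 ≤ N := Nat.le_floor (by push_cast; linarith)
  have hN2 : (N:ℝ) ≤ 2 * T := Nat.floor_le (by linarith)
  have hN0 : (0:ℝ) < N := by exact_mod_cast hN1
  have h4 : Real.log 4 ≤ 2 := by
    have : Real.log 4 = 2 * Real.log 2 := by
      rw [show (4:ℝ) = 2 ^ 2 by norm_num, Real.log_pow]; norm_num
    linarith [Real.log_two_lt_d9]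
  have h1 := psi_bound N
  have h2 := (abs_le.mp (mertens N hN1)).2
  have hlN : Real.log N ≤ L + 1 := by
    have := Real.log_le_log hN0 hN2
    rw [Real.log_mul (by norm_num) hT0.ne', ← hT.expL, Real.log_exp] at this
    linarith [Real.log_two_lt_d9]
  have e : ∀ k ∈ Ioc 0 N, vonMangoldt k / k * (k + T ^ (3/4 : ℝ)) = vonMangoldt k + vonMangoldt k / k * T ^ (3/4 : ℝ) := by
    intro k hk
    have : (k:ℝ) ≠ 0 := by rw [Finset.mem_Ioc] at hk; exact_mod_cast (by omega : k ≠ 0)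
    field_simp
  rw [Finset.sum_congr rfl e, Finset.sum_add_distrib, ← Finset.sum_mul]
  have h3 : (∑ k ∈ Ioc 0 N, vonMangoldt k / k) * T ^ (3/4 : ℝ) ≤ (L + 7) * T ^ (3/4 : ℝ) := by
    gcongr; linarith
  have h5 : (L + 7) * T ^ (3/4 : ℝ) ≤ T := by
    have := T34 hT
    have hh : L + 7 ≤ L ^ 5 := by
      have : L ^ 2 ≤ L ^ 5 := pow_le_pow_right₀ (by linarith) (by norm_num)
      nlinarith
    calc _ ≤ L ^ 5 * T ^ (3/4 : ℝ) := by gcongr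
      _ ≤ _ := by linarith
  have h6 : (Real.log 4 + 4) * N ≤ 6 * (2 * T) := by
    gcongr; linarith
  linarith

lemma gM_split (n : ℕ) : ∃ C : ℝ, 0 < C ∧ ∀ T L H : ℝ, Big n T L H → ∀ B U : ℝ, 1 ≤ B → B ≤ U → U ≤ T + H →
    ‖(∫ t in B..U, gM n L t) + ∑ k ∈ Ioc 0 ⌊2 * T⌋₊, ((vonMangoldt k / k : ℝ) : ℂ) *
      ∫ y : ℝ in B..U, iteratedDeriv n riemannZeta (((1 + 1/L : ℝ) : ℂ) + y * I) * (k:ℂ) ^ (((1 + 1/L : ℝ) : ℂ) + y * I)‖ ≤ C * (T * L ^ n) := by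
  obtain ⟨C1, hC1, hR⟩ := R_int n
  obtain ⟨C2, hC2, hJ⟩ := Jk_shift n
  refine ⟨C1 + C2 * 20, by positivity, fun T L H hT B U hB hBU hU => ?_⟩
  have hL := hT.L8
  have hL0 : 0 < L := by linarith
  have hε : 0 < 1 / L := by positivity
  have hTb : 8 ^ 10 ≤ T := by nlinarith [hT.HT, hT.Hbig]
  have hT0 : 0 < T := by linarith
  have hH0 := hT.H0
  set N := ⌊2 * T⌋₊ with hN
  have hN2 : (N:ℝ) ≤ 2 * T := Nat.floor_le (by linarith)
  have hz : Continuous fun y : ℝ => iteratedDeriv n riemannZeta (((-(1/L) : ℝ) : ℂ) + y * I) := zd_line_cont n (by linarith)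
  have hRc : Continuous fun y : ℝ => RR N (((-(1/L) : ℝ) : ℂ) + y * I) := by
    rw [continuous_iff_continuousAt]
    intro t
    have := (RR_diff N (s := ((-(1/L) : ℝ) : ℂ) + t * I) (by simpa using hL0)).continuousAt
    exact ContinuousAt.comp (f := fun t : ℝ => ((-(1/L) : ℝ) : ℂ) + t * I) this (by fun_prop)
  have hkc : ∀ k ∈ Ioc 0 N, Continuous fun y : ℝ => iteratedDeriv n riemannZeta (((-(1/L) : ℝ) : ℂ) + y * I) * (k:ℂ) ^ (((-(1/L) : ℝ) : ℂ) + y * I) := by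
    intro k hk
    have hk0 : (k:ℂ) ≠ 0 := by rw [Finset.mem_Ioc] at hk; exact_mod_cast (by omega : k ≠ 0)
    refine hz.mul ?_
    exact Continuous.const_cpow (by fun_prop) (Or.inl hk0)
  have e1 : ∀ t : ℝ, gM n L t = -(RR N (((-(1/L) : ℝ) : ℂ) + t * I) * iteratedDeriv n riemannZeta (((-(1/L) : ℝ) : ℂ) + t * I)) -
      ∑ k ∈ Ioc 0 N, ((vonMangoldt k / k : ℝ) : ℂ) * (iteratedDeriv n riemannZeta (((-(1/L) : ℝ) : ℂ) + t * I) * (k:ℂ) ^ (((-(1/L) : ℝ) : ℂ) + t * I)) := by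
    intro t
    have h1 : ∑ k ∈ Ioc 0 N, ((vonMangoldt k / k : ℝ) : ℂ) * (iteratedDeriv n riemannZeta (((-(1/L) : ℝ) : ℂ) + t * I) * (k:ℂ) ^ (((-(1/L) : ℝ) : ℂ) + t * I)) =
        (∑ k ∈ Ioc 0 N, ((vonMangoldt k : ℝ) : ℂ) * (k : ℂ) ^ (-(1 - (((-(1/L) : ℝ) : ℂ) + t * I)))) * iteratedDeriv n riemannZeta (((-(1/L) : ℝ) : ℂ) + t * I) := by
      rw [Finset.sum_mul]
      refine Finset.sum_congr rfl fun k hk => ?_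
      have hk0 : (k:ℂ) ≠ 0 := by rw [Finset.mem_Ioc] at hk; exact_mod_cast (by omega : k ≠ 0)
      rw [neg_sub, Complex.cpow_sub _ _ hk0, Complex.cpow_one, Complex.ofReal_div, Complex.ofReal_natCast]
      field_simp
    rw [h1]
    unfold gM RR
    rw [one_sub_line]
    have : ((1 + 1/L : ℝ) : ℂ) - t * I = 1 - (((-(1/L) : ℝ) : ℂ) + t * I) := by push_cast; ring
    rw [this]
    ring
  have e2 : ∫ t in B..U, gM n L t = -(∫ t in B..U, RR N (((-(1/L) : ℝ) : ℂ) + t * I) * iteratedDeriv n riemannZeta (((-(1/L) : ℝ) : ℂ) + t * I)) -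
      ∑ k ∈ Ioc 0 N, ((vonMangoldt k / k : ℝ) : ℂ) * ∫ t in B..U, (iteratedDeriv n riemannZeta (((-(1/L) : ℝ) : ℂ) + t * I) * (k:ℂ) ^ (((-(1/L) : ℝ) : ℂ) + t * I)) := by
    simp_rw [e1]
    have c1 : Continuous fun t : ℝ => -(RR N (((-(1/L) : ℝ) : ℂ) + t * I) * iteratedDeriv n riemannZeta (((-(1/L) : ℝ) : ℂ) + t * I)) := (hRc.mul hz).neg
    have c2 : ∀ k ∈ Ioc 0 N, Continuous fun t : ℝ => ((vonMangoldt k / k : ℝ) : ℂ) * (iteratedDeriv n riemannZeta (((-(1/L) : ℝ) : ℂ) + t * I) * (k:ℂ) ^ (((-(1/L) : ℝ) : ℂ) + t * I)) :=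
      fun k hk => continuous_const.mul (hkc k hk)
    have c3 : Continuous fun t : ℝ => ∑ k ∈ Ioc 0 N, ((vonMangoldt k / k : ℝ) : ℂ) * (iteratedDeriv n riemannZeta (((-(1/L) : ℝ) : ℂ) + t * I) * (k:ℂ) ^ (((-(1/L) : ℝ) : ℂ) + t * I)) :=
      continuous_finsetSum _ c2
    rw [intervalIntegral.integral_sub (c1.intervalIntegrable _ _) (c3.intervalIntegrable _ _), intervalIntegral.integral_neg,
      intervalIntegral.integral_finsetSum (fun k hk => (c2 k hk).intervalIntegrable _ _)]
    simp_rw [intervalIntegral.integral_const_mul]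
  rw [e2]
  have hb := hR T L H hT B U hB hBU hU
  have hsum : ‖∑ k ∈ Ioc 0 N, ((vonMangoldt k / k : ℝ) : ℂ) * ((∫ y : ℝ in B..U, iteratedDeriv n riemannZeta (((-(1/L) : ℝ) : ℂ) + y * I) * (k:ℂ) ^ (((-(1/L) : ℝ) : ℂ) + y * I)) -
      ∫ y : ℝ in B..U, iteratedDeriv n riemannZeta (((1 + 1/L : ℝ) : ℂ) + y * I) * (k:ℂ) ^ (((1 + 1/L : ℝ) : ℂ) + y * I))‖ ≤ C2 * 20 * (T * L ^ n) := by
    refine (norm_sum_le _ _).trans ?_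
    calc _ ≤ ∑ k ∈ Ioc 0 N, C2 * L ^ n * (vonMangoldt k / k * (k + T ^ (3/4 : ℝ))) := by
          refine Finset.sum_le_sum fun k hk => ?_
          rw [Finset.mem_Ioc] at hk
          have hkN : (k:ℝ) ≤ N := by exact_mod_cast hk.2
          have := hJ T L H hT k hk.1 (hkN.trans hN2) B U hB hBU (by linarith [hT.HT])
          have hv : 0 ≤ vonMangoldt k / (k:ℝ) := div_nonneg ArithmeticFunction.vonMangoldt_nonneg (Nat.cast_nonneg k)
          rw [norm_mul, Complex.norm_real, Real.norm_eq_abs, abs_of_nonneg hv]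
          calc _ ≤ vonMangoldt k / (k:ℝ) * (C2 * L ^ n * (k + T ^ (3/4 : ℝ))) := mul_le_mul_of_nonneg_left this hv
            _ = _ := by ring
      _ = C2 * L ^ n * ∑ k ∈ Ioc 0 N, (vonMangoldt k / k * (k + T ^ (3/4 : ℝ))) := by rw [Finset.mul_sum]
      _ ≤ C2 * L ^ n * (20 * T) := by
          gcongr; exact lam_sum hT
      _ = _ := by ring
  simp_rw [mul_sub] at hsum
  rw [Finset.sum_sub_distrib] at hsum
  have := norm_add_le (∫ t in B..U, RR N (((-(1/L) : ℝ) : ℂ) + t * I) * iteratedDeriv n riemannZeta (((-(1/L) : ℝ) : ℂ) + t * I)) _ |>.trans (add_le_add hb hsum)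
  rw [← norm_neg] at this
  refine le_trans (le_of_eq ?_) (this.trans (le_of_eq ?_))
  · congr 1; ring
  · ring

end KKY

namespace KKY
open ArithmeticFunction (vonMangoldt)

lemma logk_le {T L H : ℝ} {n : ℕ} (hT : Big n T L H) {k : ℕ} (hk : k ∈ Ioc 0 ⌊2 * T⌋₊) : 1 + Real.log k ≤ 2 * L := by
  have hL := hT.L8
  have hT0 : 0 < T := by rw [← hT.expL]; exact Real.exp_pos _
  have hk' := Finset.mem_Ioc.mp hk
  have h1 : (k:ℝ) ≤ 2 * T := (Nat.le_floor_iff (by positivity)).mp hk'.2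
  have hk0 : (0:ℝ) < k := by exact_mod_cast hk'.1
  have h2 : Real.log k ≤ Real.log (2 * T) := Real.log_le_log hk0 h1
  rw [Real.log_mul (by norm_num) hT0.ne', ← hT.expL, Real.log_exp] at h2
  have := Real.log_two_lt_d9
  linarith

lemma M_avg (n : ℕ) : ∃ C : ℝ, 0 < C ∧ ∀ T L H : ℝ, Big n T L H → ∀ t0 : ℝ, 1 ≤ t0 → t0 ≤ 2 →
    ‖(H:ℂ) * (∫ t in t0..T, gM n L t) + ∑ k ∈ Ioc 0 ⌊2 * T⌋₊, ((vonMangoldt k / k : ℝ) : ℂ) *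
      ((H * (T - H) * (-Real.log k) ^ n : ℝ) : ℂ)‖ ≤ C * (H * (T * L ^ n)) := by
  obtain ⟨C1, hC1, hE⟩ := gM_edge n
  obtain ⟨C2, hC2, hS⟩ := gM_split n
  obtain ⟨C3, hC3, hK⟩ := avg_kernel n
  refine ⟨C1 + C2 + C3 * (2 * (Real.log 4 + 4)), by positivity, fun T L H hT t0 ht1 ht2 => ?_⟩
  have hL := hT.L8
  have hL0 : 0 < L := by linarith
  have hH0 := hT.H0
  have hTH := hT.HT
  have hHb := hT.Hbig
  have hLH := hT.LleH
  have hT0 : 0 < T := by nlinarith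
  set M0 := ∫ t in t0..T, gM n L t with hM0
  set G : ℕ → ℝ → ℂ := fun k y => iteratedDeriv n riemannZeta (((1+1/L:ℝ):ℂ)+y*I)*(k:ℂ)^(((1+1/L:ℝ):ℂ)+y*I) with hG
  have hGc : ∀ k ∈ Ioc 0 ⌊2 * T⌋₊, Continuous (G k) := by
    intro k hk
    have hk' := Finset.mem_Ioc.mp hk
    have hk0 : (k:ℂ) ≠ 0 := by exact_mod_cast (by omega : k ≠ 0)
    have h1 := zd_line_cont n (a := 1 + 1/L) (by have : 0 < 1/L := by positivity
                                                 linarith)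
    refine Continuous.mul h1 ?_
    exact Continuous.const_cpow (by fun_prop) (Or.inl hk0)
  have hJc : ∀ k ∈ Ioc 0 ⌊2 * T⌋₊, Continuous fun h : ℝ => ((vonMangoldt k / k : ℝ) : ℂ) * ∫ t in (H+h)..(T+h), G k t := by
    intro k hk
    have hc := hGc k hk
    have e : (fun h : ℝ => ((vonMangoldt k / k : ℝ) : ℂ) * ∫ t in (H+h)..(T+h), G k t) =
        fun h : ℝ => ((vonMangoldt k / k : ℝ) : ℂ) * ((∫ t in (0:ℝ)..(T+h), G k t) - ∫ t in (0:ℝ)..(H+h), G k t) := by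
      funext h
      rw [intervalIntegral.integral_interval_sub_left (hc.intervalIntegrable _ _) (hc.intervalIntegrable _ _)]
    rw [e]
    have hp : Continuous fun x : ℝ => ∫ t in (0:ℝ)..x, G k t :=
      intervalIntegral.continuous_primitive (fun a b => hc.intervalIntegrable a b) 0
    have p1 : Continuous fun h : ℝ => ∫ t in (0:ℝ)..(T+h), G k t := hp.comp (by fun_prop : Continuous fun h : ℝ => T + h)
    have p2 : Continuous fun h : ℝ => ∫ t in (0:ℝ)..(H+h), G k t := hp.comp (by fun_prop : Continuous fun h : ℝ => H + h)
    exact continuous_const.mul (p1.sub p2)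
  have hpt : ∀ h ∈ Set.uIoc 0 H, ‖M0 + ∑ k ∈ Ioc 0 ⌊2 * T⌋₊, ((vonMangoldt k / k : ℝ) : ℂ) * ∫ t in (H+h)..(T+h), G k t‖ ≤ (C1 + C2) * (T * L ^ n) := by
    intro h hh
    rw [Set.uIoc_of_le hH0.le] at hh
    have a1 := hE T L H hT t0 h ht1 ht2 hh.1.le hh.2
    have a2 := hS T L H hT (H + h) (T + h) (by linarith [hh.1]) (by linarith) (by linarith [hh.2])
    have := norm_add_le_of_le a1 a2
    refine le_trans (le_of_eq ?_) (this.trans (le_of_eq (by ring)))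
    congr 1
    simp only [hM0, hG]
    ring
  have hIntg := intervalIntegral.norm_integral_le_of_norm_le_const hpt
  have hsumc : Continuous fun h : ℝ => ∑ k ∈ Ioc 0 ⌊2 * T⌋₊, ((vonMangoldt k / k : ℝ) : ℂ) * ∫ t in (H+h)..(T+h), G k t :=
    continuous_finsetSum _ fun k hk => hJc k hk
  have hsw : (∫ h in (0:ℝ)..H, (M0 + ∑ k ∈ Ioc 0 ⌊2 * T⌋₊, ((vonMangoldt k / k : ℝ) : ℂ) * ∫ t in (H+h)..(T+h), G k t)) =
      (H:ℂ) * M0 + ∑ k ∈ Ioc 0 ⌊2 * T⌋₊, ((vonMangoldt k / k : ℝ) : ℂ) * ∫ h in (0:ℝ)..H, ∫ t in (H+h)..(T+h), G k t := by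
    rw [intervalIntegral.integral_add (by simp) (hsumc.intervalIntegrable _ _),
      intervalIntegral.integral_finsetSum (fun k hk => (hJc k hk).intervalIntegrable _ _)]
    congr 1
    · simp
    · refine Finset.sum_congr rfl fun k _ => ?_
      rw [intervalIntegral.integral_const_mul]
  rw [hsw, sub_zero, abs_of_pos hH0] at hIntg
  have hdiff : ‖∑ k ∈ Ioc 0 ⌊2 * T⌋₊, ((vonMangoldt k / k : ℝ) : ℂ) * (∫ h in (0:ℝ)..H, ∫ t in (H+h)..(T+h), G k t) -
      ∑ k ∈ Ioc 0 ⌊2 * T⌋₊, ((vonMangoldt k / k : ℝ) : ℂ) * ((H * (T - H) * (-Real.log k) ^ n : ℝ) : ℂ)‖ ≤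
      C3 * (2 * (Real.log 4 + 4)) * (H * (T * L ^ n)) := by
    rw [← Finset.sum_sub_distrib]
    refine (norm_sum_le _ _).trans ?_
    have : ∀ k ∈ Ioc 0 ⌊2 * T⌋₊, ‖((vonMangoldt k / k : ℝ) : ℂ) * (∫ h in (0:ℝ)..H, ∫ t in (H+h)..(T+h), G k t) -
        ((vonMangoldt k / k : ℝ) : ℂ) * ((H * (T - H) * (-Real.log k) ^ n : ℝ) : ℂ)‖ ≤ C3 * L ^ n * H * vonMangoldt k := by
      intro k hk
      have hk' := Finset.mem_Ioc.mp hk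
      have hk0 : (0:ℝ) < k := by exact_mod_cast hk'.1
      have := hK T H L k (by linarith) hLH hT.HH.ge (by linarith) hk'.1 (logk_le hT hk)
      rw [← mul_sub, norm_mul, Complex.norm_real, Real.norm_of_nonneg (div_nonneg ArithmeticFunction.vonMangoldt_nonneg hk0.le)]
      have h2 := mul_le_mul_of_nonneg_left this (div_nonneg (ArithmeticFunction.vonMangoldt_nonneg (n := k)) hk0.le)
      refine h2.trans (le_of_eq ?_)
      field_simp
    refine (Finset.sum_le_sum this).trans ?_
    rw [← Finset.mul_sum]
    have hps := psi_bound ⌊2 * T⌋₊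
    have hfl : (⌊2 * T⌋₊ : ℝ) ≤ 2 * T := Nat.floor_le (by positivity)
    have h4 : 0 ≤ Real.log 4 + 4 := by positivity
    have : ∑ d ∈ Ioc 0 ⌊2 * T⌋₊, vonMangoldt d ≤ (Real.log 4 + 4) * (2 * T) := hps.trans (by gcongr)
    have := mul_le_mul_of_nonneg_left this (by positivity : 0 ≤ C3 * L ^ n * H)
    linarith
  have := norm_sub_le_of_le hIntg hdiff
  refine le_trans (le_of_eq ?_) (this.trans (le_of_eq (by ring)))
  congr 1
  ring

lemma M_real (n : ℕ) (hn : 1 ≤ n) : ∃ C : ℝ, 0 < C ∧ ∀ T L H : ℝ, Big n T L H →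
    |(T - H) * (∑ k ∈ Ioc 0 ⌊2 * T⌋₊, vonMangoldt k * Real.log k ^ n / k) -
      T * Real.log (T / (2 * Real.pi)) ^ (n + 1) / (n + 1)| ≤ C * (T * L ^ n) := by
  refine ⟨2 * (Real.log 4 + 5) * 2 ^ n + 2 ^ (n+1) + 3 * 2 ^ n, by positivity, fun T L H hT => ?_⟩
  have hL := hT.L8
  have hL0 : 0 < L := by linarith
  have hH0 := hT.H0
  have hTH := hT.HT
  have hHb := hT.Hbig
  have hLH := hT.LleH
  have hT0 : 0 < T := by nlinarith
  have hT1 : 1 ≤ T := by nlinarith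
  have hN1 : 1 ≤ ⌊2 * T⌋₊ := Nat.one_le_floor_iff _ |>.mpr (by linarith)
  have hm := mertens_pow n hn ⌊2 * T⌋₊ hN1
  set S := ∑ k ∈ Ioc 0 ⌊2 * T⌋₊, vonMangoldt k * Real.log k ^ n / k with hS
  set a := Real.log (⌊2 * T⌋₊ : ℝ) with ha
  set b := Real.log (T / (2 * Real.pi)) with hb
  have hfl : (⌊2 * T⌋₊ : ℝ) ≤ 2 * T := Nat.floor_le (by positivity)
  have hfl2 : T ≤ (⌊2 * T⌋₊ : ℝ) := by linarith [Nat.lt_floor_add_one (2 * T)]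
  have hlogT : Real.log T = L := by rw [← hT.expL, Real.log_exp]
  have ha1 : L ≤ a := by rw [← hlogT]; exact Real.log_le_log hT0 hfl2
  have ha2 : a ≤ L + 1 := by
    have : a ≤ Real.log (2 * T) := Real.log_le_log (by linarith) hfl
    rw [Real.log_mul (by norm_num) hT0.ne', hlogT] at this
    linarith [Real.log_two_lt_d9]
  have hpi := Real.pi_gt_three
  have hpi2 := Real.pi_lt_d2
  have hb0 : b = L - Real.log (2 * Real.pi) := by rw [hb, Real.log_div hT0.ne' (by positivity), hlogT]
  have hl1 : 0 ≤ Real.log (2 * Real.pi) := Real.log_nonneg (by linarith)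
  have hl2 : Real.log (2 * Real.pi) ≤ 2 := by
    rw [Real.log_le_iff_le_exp (by positivity)]
    have e1 := Real.exp_one_gt_d9
    have : Real.exp 2 = Real.exp 1 * Real.exp 1 := by rw [← Real.exp_add]; norm_num
    rw [this]; nlinarith
  have hab : |a ^ (n+1) - b ^ (n+1)| ≤ 3 * (n + 1) * (2 * L) ^ n := by
    have := abs_pow_sub_pow_le a b (n + 1)
    have e : |a - b| ≤ 3 := by rw [abs_le]; constructor <;> linarith
    have e2 : max |a| |b| ≤ 2 * L := by
      refine max_le ?_ ?_ <;> rw [abs_le] <;> constructor <;> linarith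
    refine this.trans ?_
    simp only [Nat.add_sub_cancel]
    push_cast
    gcongr
  have hn0 : (0:ℝ) < n + 1 := by positivity
  have hap : a ^ n ≤ (2 * L) ^ n := by gcongr <;> linarith
  have hap1 : a ^ (n+1) ≤ (2 * L) ^ (n+1) := by gcongr <;> linarith
  have ha0 : 0 ≤ a := by linarith
  have e : (T - H) * S - T * b ^ (n+1) / (n+1) = (T - H) * (S - a ^ (n+1) / (n+1)) - H * (a ^ (n+1) / (n+1)) +
      T * ((a ^ (n+1) - b ^ (n+1)) / (n+1)) := by ring
  have hlog4 : 0 ≤ Real.log 4 := Real.log_nonneg (by norm_num)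
  have b1 : |(T - H) * (S - a ^ (n+1) / (n+1))| ≤ T * (2 * (Real.log 4 + 5) * (2 * L) ^ n) := by
    rw [abs_mul, abs_of_nonneg (by linarith)]
    refine mul_le_mul (by linarith) (hm.trans (by gcongr)) (abs_nonneg _) hT0.le
  have b2 : |H * (a ^ (n+1) / (n+1))| ≤ T * (2 ^ (n+1) * L ^ n) := by
    rw [abs_of_nonneg (by positivity)]
    have : a ^ (n+1) / (n+1) ≤ (2 * L) ^ (n+1) := by
      refine (div_le_self (by positivity) ?_).trans hap1
      linarith [(Nat.cast_nonneg n : (0:ℝ) ≤ n)]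
    have h1 : H * (a ^ (n+1) / (n+1)) ≤ H * (2 * L) ^ (n+1) := by gcongr
    refine h1.trans ?_
    have : H * L ≤ T := by rw [← hT.HH]; nlinarith
    have := mul_le_mul_of_nonneg_right this (by positivity : 0 ≤ 2 ^ (n+1) * L ^ n)
    refine le_trans (le_of_eq ?_) this
    rw [mul_pow]; ring
  have b3 : |T * ((a ^ (n+1) - b ^ (n+1)) / (n+1))| ≤ T * (3 * (2 * L) ^ n) := by
    rw [abs_mul, abs_of_pos hT0, abs_div, abs_of_pos hn0]
    gcongr
    rw [div_le_iff₀ hn0]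
    linarith
  rw [e]
  refine (abs_add_le _ _).trans ?_
  have := abs_sub ((T - H) * (S - a ^ (n+1) / (n+1))) (H * (a ^ (n+1) / (n+1)))
  rw [mul_pow] at b1 b3
  nlinarith

lemma M_main (n : ℕ) (hn : 1 ≤ n) : ∃ C : ℝ, 0 < C ∧ ∀ T L H : ℝ, Big n T L H → ∀ t0 : ℝ, 1 ≤ t0 → t0 ≤ 2 →
    ‖(∫ t in t0..T, gM n L t) - (-1:ℂ) ^ (n+1) * ((T * Real.log (T / (2 * Real.pi)) ^ (n + 1) / (n + 1) : ℝ) : ℂ)‖ ≤ C * (T * L ^ n) := by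
  obtain ⟨C1, hC1, hA⟩ := M_avg n
  obtain ⟨C2, hC2, hR⟩ := M_real n hn
  refine ⟨C1 + C2, by positivity, fun T L H hT t0 ht1 ht2 => ?_⟩
  have a1 := hA T L H hT t0 ht1 ht2
  have a2 := hR T L H hT
  have hH0 := hT.H0
  have hHc : (H:ℂ) ≠ 0 := by exact_mod_cast hH0.ne'
  set M0 := ∫ t in t0..T, gM n L t
  set S := ∑ k ∈ Ioc 0 ⌊2 * T⌋₊, vonMangoldt k * Real.log k ^ n / k with hS
  have e : ∑ k ∈ Ioc 0 ⌊2 * T⌋₊, ((vonMangoldt k / k : ℝ) : ℂ) * ((H * (T - H) * (-Real.log k) ^ n : ℝ) : ℂ) =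
      (H:ℂ) * ((-1:ℂ) ^ n * (((T - H) * S : ℝ) : ℂ)) := by
    have : (-1:ℂ) ^ n = (((-1:ℝ) ^ n : ℝ) : ℂ) := by push_cast; rfl
    rw [this, ← Complex.ofReal_mul, ← Complex.ofReal_mul, hS]
    simp_rw [← Complex.ofReal_mul]
    rw [← Complex.ofReal_sum, Finset.mul_sum, Finset.mul_sum, Finset.mul_sum]
    congr 1
    refine Finset.sum_congr rfl fun k _ => ?_
    rw [neg_pow]
    ring
  rw [e, ← mul_add, norm_mul, Complex.norm_real, Real.norm_of_nonneg hH0.le, mul_left_comm] at a1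
  have a3 := le_of_mul_le_mul_left a1 hH0
  rw [← Real.norm_eq_abs, ← Complex.norm_real] at a2
  have a4 : ‖(-1:ℂ) ^ n * (((T - H) * S - T * Real.log (T / (2 * Real.pi)) ^ (n + 1) / (n + 1) : ℝ) : ℂ)‖ ≤ C2 * (T * L ^ n) := by
    rw [norm_mul, norm_pow, norm_neg, norm_one, one_pow, one_mul]; exact a2
  have := norm_sub_le_of_le a3 a4
  refine le_trans (le_of_eq ?_) (this.trans (le_of_eq (by ring)))
  congr 1
  rw [Complex.ofReal_sub]
  ring

end KKY

namespace KKY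

lemma zeta_poly : ∃ C : ℝ, 1 ≤ C ∧ ∀ s : ℂ, -10 ≤ s.re → 1 ≤ |s.im| → ‖riemannZeta s‖ ≤ C * (12 + |s.im|) ^ 11 := by
  obtain ⟨C1, hC1, hl⟩ := zeta_left
  obtain ⟨C2, hC2, hs⟩ := zeta_strip
  refine ⟨3 + C1 * 3 + C2 * 2, by linarith, fun s h1 h2 => ?_⟩
  have hY : 1 ≤ 12 + |s.im| := by linarith
  have hY1 : (1:ℝ) ≤ (12 + |s.im|) ^ 11 := one_le_pow₀ hY
  have e : s = (s.re : ℂ) + s.im * I := (Complex.re_add_im s).symm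
  have p0 : 0 ≤ (12 + |s.im|) ^ 11 := by linarith
  rcases le_or_gt (3/2) s.re with h | h
  · have := zeta_right (s := s) (by linarith)
    have h3 : 1 / (s.re - 1) ≤ 2 := by rw [div_le_iff₀ (by linarith)]; linarith
    nlinarith [mul_nonneg (by linarith : 0 ≤ C1 * 3) p0, mul_nonneg (by linarith : 0 ≤ C2 * 2) p0]
  rcases le_or_gt (-(1/2)) s.re with h' | h'
  · have := hs (1/2) (by norm_num) le_rfl s.re s.im h' (by linarith) (by linarith)
    rw [← e] at this
    have h3 : (4 + |s.im|) ^ ((1 - s.re + 1/2) / 2) ≤ (12 + |s.im|) ^ 11 := by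
      have a1 : (4 + |s.im|) ^ ((1 - s.re + 1/2) / 2) ≤ (4 + |s.im|) ^ (11:ℝ) :=
        Real.rpow_le_rpow_of_exponent_le (by linarith) (by linarith)
      have a2 : (4 + |s.im|) ^ (11:ℝ) = (4 + |s.im|) ^ 11 := by exact_mod_cast Real.rpow_natCast _ 11
      rw [a2] at a1
      exact a1.trans (by gcongr; norm_num)
    have h4 : C2 / (1/2) * (4 + |s.im|) ^ ((1 - s.re + 1/2) / 2) ≤ C2 * 2 * (12 + |s.im|) ^ 11 := by
      rw [show C2 / (1/2) = C2 * 2 by ring]; gcongr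
    nlinarith [mul_nonneg (by linarith : 0 ≤ 3 + C1 * 3) p0]
  · have := hl (-s.re) s.im (by linarith)
    rw [show (-((-s.re : ℝ) : ℂ)) = (s.re : ℂ) by push_cast; ring, ← e] at this
    have h3 : (2 + |s.im| + -s.re) ^ (-s.re + 1/2) ≤ (12 + |s.im|) ^ 11 := by
      have a1 : (2 + |s.im| + -s.re) ^ (-s.re + 1/2) ≤ (2 + |s.im| + -s.re) ^ (11:ℝ) :=
        Real.rpow_le_rpow_of_exponent_le (by linarith) (by linarith)
      have a2 : (2 + |s.im| + -s.re) ^ (11:ℝ) = (2 + |s.im| + -s.re) ^ 11 := by exact_mod_cast Real.rpow_natCast _ 11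
      rw [a2] at a1
      exact a1.trans (pow_le_pow_left₀ (by linarith) (by linarith) _)
    have h4 : (2 * Real.pi) ^ (-(-s.re)) ≤ 1 :=
      Real.rpow_le_one_of_one_le_of_nonpos (by linarith [Real.pi_gt_three]) (by linarith)
    have h5 : 1 + 1 / (-s.re) ≤ 3 := by
      have : 1 / (-s.re) ≤ 2 := by rw [div_le_iff₀ (by linarith)]; linarith
      linarith
    have h6 : C1 * (2 * Real.pi) ^ (-(-s.re)) * (2 + |s.im| + -s.re) ^ (-s.re + 1/2) * (1 + 1 / (-s.re)) ≤
        C1 * 1 * (12 + |s.im|) ^ 11 * 3 := by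
      have : 0 ≤ 1 / (-s.re) := by apply div_nonneg <;> linarith
      have : 0 ≤ (2 + |s.im| + -s.re) ^ (-s.re + 1/2) := Real.rpow_nonneg (by linarith) _
      gcongr
    nlinarith [mul_nonneg (by linarith : 0 ≤ 3 + C2 * 2) p0]

lemma zeta_two_lower {s : ℂ} (hs : s.re = 2) : 1/4 ≤ ‖riemannZeta s‖ := by
  have h := zeta_deriv_hasSum 0 (s := s) (by linarith)
  simp only [pow_zero, one_mul, iteratedDeriv_zero] at h
  have h1 := h.update 1 0
  have h2 := hasSum_zeta_two.update 1 0
  have := h1.norm_le_of_bounded h2 fun k => by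
    by_cases hk : k = 1
    · subst hk; simp
    · rw [Function.update_of_ne hk, Function.update_of_ne hk]
      rcases Nat.eq_zero_or_pos k with h0 | h0
      · subst h0
        have : -s ≠ 0 := by intro h; have := congrArg Complex.re h; simp [hs] at this
        simp [Complex.zero_cpow this]
      · rw [Complex.norm_natCast_cpow_of_pos h0]
        simp only [Complex.neg_re, hs]
        rw [Real.rpow_neg (by positivity), one_div]
        exact_mod_cast le_rfl
  simp only [Nat.cast_one, Complex.one_cpow] at this
  have h3 : ‖(1:ℂ)‖ ≤ ‖riemannZeta s‖ + ‖0 - 1 + riemannZeta s‖ := by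
    calc ‖(1:ℂ)‖ = ‖riemannZeta s - (0 - 1 + riemannZeta s)‖ := by congr 1; ring
      _ ≤ _ := norm_sub_le _ _
  rw [norm_one] at h3
  have hpi := Real.pi_lt_d2
  have hpi0 := Real.pi_pos
  have hsq : Real.pi ^ 2 ≤ 10 := by nlinarith
  rw [one_pow, div_one] at this
  have h4 := h3.trans (add_le_add le_rfl this)
  linarith

lemma factor_all {U : Set ℂ} (hU : IsOpen U) {f : ℂ → ℂ} (hf : DifferentiableOn ℂ f U) (Z : Finset ℂ)
    (hZ : ∀ ρ ∈ Z, ρ ∈ U) (hord : ∀ ρ ∈ Z, analyticOrderAt f ρ ≠ ⊤) :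
    ∃ (m : ℂ → ℕ) (h : ℂ → ℂ), DifferentiableOn ℂ h U ∧ (∀ ρ ∈ Z, h ρ ≠ 0) ∧
      ∀ z ∈ U, f z = (∏ ρ ∈ Z, (z - ρ) ^ m ρ) * h z := by
  classical
  induction Z using Finset.induction_on with
  | empty => exact ⟨fun _ => 0, f, hf, by simp, by simp⟩
  | insert ρ Z hρ ih =>
    obtain ⟨m, h, hd, hne, heq⟩ := ih (fun r hr => hZ r (mem_insert_of_mem hr)) (fun r hr => hord r (mem_insert_of_mem hr))
    have hρU := hZ ρ (mem_insert_self _ _)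
    have ho : analyticOrderAt h ρ ≠ ⊤ := by
      intro htop
      rw [analyticOrderAt_eq_top] at htop
      refine hord ρ (mem_insert_self _ _) (analyticOrderAt_eq_top.mpr ?_)
      filter_upwards [htop, hU.mem_nhds hρU] with z hz hzU
      rw [heq z hzU, hz, mul_zero]
    obtain ⟨k, kd, kne, keq⟩ := factor_zero hU hd hρU ho
    refine ⟨fun r => if r = ρ then analyticOrderNatAt h ρ else m r, k, kd, ?_, ?_⟩
    · intro r hr hk
      rcases Finset.mem_insert.mp hr with rfl | hr'
      · exact kne hk
      · apply hne r hr'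
        rw [keq r (hZ r hr), hk, mul_zero]
    · intro z hz
      rw [heq z hz, Finset.prod_insert hρ, keq z hz]
      have : ∏ x ∈ Z, (z - x) ^ (if x = ρ then analyticOrderNatAt h ρ else m x) = ∏ x ∈ Z, (z - x) ^ m x := by
        refine Finset.prod_congr rfl fun x hx => ?_
        rw [if_neg (fun hxx : x = ρ => hρ (hxx ▸ hx))]
      rw [this]
      simp only [if_true]
      ring

lemma local_ld {f : ℂ → ℂ} {c : ℂ} {M : ℝ} (hM : 0 < M) (hf : DifferentiableOn ℂ f (Metric.ball c 13))
    (hc : f c ≠ 0) (hb : ∀ z ∈ Metric.closedBall c 12, ‖f z‖ ≤ Real.exp M * ‖f c‖) (Z : Finset ℂ)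
    (hZ : ∀ ρ ∈ Z, ρ ∈ Metric.closedBall c 3) (hZ' : ∀ z ∈ Metric.closedBall c 3, f z = 0 → z ∈ Z)
    {η : ℝ} (hη : 0 < η) {s : ℂ} (hs : s ∈ Metric.closedBall c (5/2)) (hsd : ∀ ρ ∈ Z, η ≤ ‖s - ρ‖) :
    ‖deriv f s / f s‖ ≤ 96 * M + M / η := by
  have hsub : Metric.closedBall c 3 ⊆ Metric.ball c 13 := Metric.closedBall_subset_ball (by norm_num)
  have hfa : AnalyticOnNhd ℂ f (Metric.ball c 13) := hf.analyticOnNhd Metric.isOpen_ball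
  have hcm : c ∈ Metric.ball c 13 := Metric.mem_ball_self (by norm_num)
  have hord : ∀ ρ ∈ Z, analyticOrderAt f ρ ≠ ⊤ := by
    intro ρ hρ htop
    rw [analyticOrderAt_eq_top] at htop
    exact hc (hfa.eqOn_zero_of_preconnected_of_eventuallyEq_zero (convex_ball c 13).isPreconnected (hsub (hZ ρ hρ)) htop hcm)
  obtain ⟨m, h, hd, hne, heq⟩ := factor_all Metric.isOpen_ball hf Z (fun ρ hρ => hsub (hZ ρ hρ)) hord
  set N := ∑ ρ ∈ Z, m ρ with hN
  have hcf : ‖f c‖ ≤ 3 ^ N * ‖h c‖ := by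
    rw [heq c hcm, norm_mul, norm_prod, hN, ← Finset.prod_pow_eq_pow_sum]
    gcongr with ρ hρ
    rw [norm_pow]
    have := hZ ρ hρ
    rw [Metric.mem_closedBall, dist_comm, dist_eq_norm] at this
    gcongr
  have hsph : ∀ z ∈ frontier (Metric.ball c 12), ‖h z‖ ≤ Real.exp M * ‖f c‖ / 9 ^ N := by
    intro z hz
    rw [frontier_ball c (by norm_num)] at hz
    have hz12 := Metric.sphere_subset_closedBall hz
    have hz13 : z ∈ Metric.ball c 13 := Metric.closedBall_subset_ball (by norm_num) hz12
    rw [le_div_iff₀ (by positivity)]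
    refine le_trans ?_ (hb z hz12)
    rw [heq z hz13, norm_mul, norm_prod, mul_comm, hN, ← Finset.prod_pow_eq_pow_sum]
    gcongr with ρ hρ
    rw [norm_pow]
    have h1 := hZ ρ hρ
    rw [Metric.mem_closedBall] at h1
    rw [Metric.mem_sphere] at hz
    have := dist_triangle z ρ c
    rw [dist_eq_norm z ρ] at this
    gcongr
    linarith
  have hall : ∀ z ∈ Metric.closedBall c 12, ‖h z‖ ≤ Real.exp M * ‖h c‖ / 3 ^ N := by
    intro z hz
    have hcl : closure (Metric.ball c 12) = Metric.closedBall c 12 := closure_ball c (by norm_num)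
    have := Complex.norm_le_of_forall_mem_frontier_norm_le Metric.isBounded_ball
      (f := h) (U := Metric.ball c 12) (DifferentiableOn.diffContOnCl (hd.mono (by
        rw [hcl]; exact Metric.closedBall_subset_ball (by norm_num)))) hsph (z := z) (by rwa [hcl])
    refine this.trans ?_
    rw [div_le_div_iff₀ (by positivity) (by positivity)]
    have e9 : (9:ℝ) ^ N = 3 ^ N * 3 ^ N := by rw [← mul_pow]; norm_num
    rw [e9]
    have := mul_le_mul_of_nonneg_left hcf (by positivity : 0 ≤ Real.exp M * 3 ^ N)
    linarith
  have hhc : 0 < ‖h c‖ := by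
    rw [norm_pos_iff]; intro h0; exact hc (by rw [heq c hcm, h0, mul_zero])
  have hNM : (N:ℝ) ≤ M := by
    have := hall c (Metric.mem_closedBall_self (by norm_num))
    rw [le_div_iff₀ (by positivity), mul_comm] at this
    have := le_of_mul_le_mul_right this hhc
    have h2 : Real.exp N ≤ 3 ^ N := by
      rw [← Real.exp_one_pow]
      have := Real.exp_one_lt_d9
      gcongr; linarith
    exact Real.exp_le_exp.mp (h2.trans this)
  have hbc := bc_logderiv (f := h) (c := c) (R := 3) (r := 5/2) (M := M) (by norm_num) (by norm_num) hM
    (hd.mono (Metric.ball_subset_ball (by norm_num))) (by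
      intro z hz h0
      have hz3 := Metric.ball_subset_closedBall hz
      exact hne z (hZ' z hz3 (by rw [heq z (hsub hz3), h0, mul_zero])) h0) (by
      intro z hz
      refine (hall z (Metric.ball_subset_closedBall (Metric.ball_subset_ball (by norm_num) hz))).trans ?_
      exact div_le_self (by positivity) (one_le_pow₀ (by norm_num))) s hs
  have hs13 : s ∈ Metric.ball c 13 := Metric.closedBall_subset_ball (by norm_num) hs
  have hsZ : ∀ ρ ∈ Z, s - ρ ≠ 0 := fun ρ hρ h0 => by
    have := hsd ρ hρ; rw [h0, norm_zero] at this; linarith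
  have hhs : h s ≠ 0 := by
    intro h0
    have h3 : s ∈ Metric.closedBall c 3 := Metric.closedBall_subset_closedBall (by norm_num) hs
    exact hne s (hZ' s h3 (by rw [heq s hs13, h0, mul_zero])) h0
  have hev : f =ᶠ[nhds s] fun z => (∏ ρ ∈ Z, (z - ρ) ^ m ρ) * h z := by
    filter_upwards [Metric.isOpen_ball.mem_nhds hs13] with z hz using heq z hz
  have hld : deriv f s / f s = ∑ ρ ∈ Z, (m ρ : ℂ) / (s - ρ) + deriv h s / h s := by
    have h1 : deriv f s / f s = logDeriv (fun z => (∏ ρ ∈ Z, (z - ρ) ^ m ρ) * h z) s := by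
      rw [logDeriv_apply, hev.deriv_eq, hev.eq_of_nhds]
    rw [h1, logDeriv_mul s (Finset.prod_ne_zero_iff.mpr fun ρ hρ => pow_ne_zero _ (hsZ ρ hρ)) hhs (by fun_prop)
      (hd.differentiableAt (Metric.isOpen_ball.mem_nhds hs13)), logDeriv_prod (f := fun ρ z => (z - ρ) ^ m ρ) (fun ρ hρ => pow_ne_zero _ (hsZ ρ hρ)) (fun ρ _ => by fun_prop)]
    congr 1
    refine Finset.sum_congr rfl fun ρ _ => ?_
    rw [logDeriv_fun_pow (by fun_prop), logDeriv_apply]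
    simp [div_eq_mul_inv]
  rw [hld]
  refine (norm_add_le _ _).trans ?_
  have hsum : ‖∑ ρ ∈ Z, (m ρ : ℂ) / (s - ρ)‖ ≤ M / η := by
    refine (norm_sum_le _ _).trans ?_
    have : ∀ ρ ∈ Z, ‖(m ρ : ℂ) / (s - ρ)‖ ≤ (m ρ : ℝ) / η := by
      intro ρ hρ
      rw [norm_div, Complex.norm_natCast]
      have := hsd ρ hρ
      gcongr
    refine (Finset.sum_le_sum this).trans ?_
    rw [← Finset.sum_div, ← Nat.cast_sum]
    gcongr
  have : 8 * 3 / (3 - 5/2) ^ 2 * M = 96 * M := by ring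
  linarith

lemma zero_strip {ρ : ℂ} (h0 : riemannZeta ρ = 0) (him : ρ.im ≠ 0) : IsNontrivialZero ρ := by
  refine ⟨h0, ?_, ?_⟩
  · by_contra h
    push Not at h
    have hfe := zeta_fe him
    rw [h0] at hfe
    rcases mul_eq_zero.mp hfe.symm with h1 | h1
    · exact chi_ne_zero (by simpa using him) h1
    · exact riemannZeta_ne_zero_of_one_le_re (by simpa using h) h1
  · by_contra h
    push Not at h
    exact riemannZeta_ne_zero_of_one_le_re h h0

lemma zeta_ld_top (δ : ℝ) (hδ : 0 < δ) : ∃ C : ℝ, 0 < C ∧ ∀ T : ℝ, 20 ≤ T → AdmissibleHeight δ T →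
    ∀ σ : ℝ, -(1/2) ≤ σ → σ ≤ 2 → ‖deriv riemannZeta (σ + T * I) / riemannZeta (σ + T * I)‖ ≤ C * Real.log T ^ 2 := by
  obtain ⟨C0, hC0, hp⟩ := zeta_poly
  refine ⟨(Real.log (4 * C0) + 33) * (96 + 1 / δ), by
    have := Real.log_nonneg (by linarith : 1 ≤ 4 * C0)
    positivity, fun T hT hA σ h1 h2 => ?_⟩
  set L := Real.log T with hL
  have hL1 : 1 ≤ L := by
    rw [hL, Real.le_log_iff_exp_le (by linarith)]
    linarith [Real.exp_one_lt_d9]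
  have hlc := Real.log_nonneg (by linarith : 1 ≤ 4 * C0)
  set M := Real.log (4 * C0) + 33 * L with hMd
  have hM : 0 < M := by positivity
  set c : ℂ := 2 + T * I with hc
  have hcre : c.re = 2 := by simp [hc]
  have hcim : c.im = T := by simp [hc]
  have him : ∀ z : ℂ, ∀ r : ℝ, ‖z - c‖ ≤ r → |z.im - T| ≤ r ∧ |z.re - 2| ≤ r := by
    intro z r hz
    have a1 := (Complex.abs_im_le_norm (z - c)).trans hz
    have a2 := (Complex.abs_re_le_norm (z - c)).trans hz
    rw [Complex.sub_im, hcim] at a1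
    rw [Complex.sub_re, hcre] at a2
    exact ⟨a1, a2⟩
  have hlow := zeta_two_lower hcre
  have hfin := IsCompact.inter_riemannZetaZeros_finite (isCompact_closedBall c 3)
  have hZm : ∀ ρ, ρ ∈ hfin.toFinset ↔ ρ ∈ Metric.closedBall c 3 ∧ riemannZeta ρ = 0 := by
    intro ρ; rw [Set.Finite.mem_toFinset]; rfl
  have hη : 0 < δ / L := by positivity
  have := local_ld (f := riemannZeta) (c := c) (M := M) hM (by
      intro z hz
      rw [Metric.mem_ball, dist_eq_norm] at hz
      have := (him z 13 hz.le).1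
      rw [abs_le] at this
      exact (zeta_diff_of_im (by linarith : z.im ≠ 0)).differentiableWithinAt) (by
      intro h0; rw [h0, norm_zero] at hlow; linarith) (by
      intro z hz
      rw [Metric.mem_closedBall, dist_eq_norm] at hz
      obtain ⟨a1, a2⟩ := him z 12 hz
      rw [abs_le] at a1 a2
      have hzi : |z.im| = z.im := abs_of_nonneg (by linarith)
      have := hp z (by linarith) (by rw [hzi]; linarith)
      rw [hzi] at this
      have b1 : (12 + z.im) ^ 11 ≤ (T ^ 3) ^ 11 := by
        refine pow_le_pow_left₀ (by linarith) ?_ _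
        nlinarith [mul_self_nonneg (T - 20), mul_nonneg (by linarith : 0 ≤ T - 20) (mul_self_nonneg T)]
      have b2 : Real.exp M = 4 * C0 * (T ^ 3) ^ 11 := by
        rw [hMd, Real.exp_add, Real.exp_log (by linarith), mul_comm 33 L, Real.exp_mul, hL, Real.exp_log (by linarith), ← pow_mul]
        congr 1
        exact_mod_cast Real.rpow_natCast T 33
      rw [b2]
      have b3 : C0 * (12 + z.im) ^ 11 ≤ C0 * (T ^ 3) ^ 11 := by gcongr
      have b4 : 0 ≤ C0 * (T ^ 3) ^ 11 := by positivity
      have := mul_le_mul_of_nonneg_left hlow (by positivity : 0 ≤ 4 * (C0 * (T ^ 3) ^ 11))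
      linarith) hfin.toFinset
    (fun ρ hρ => ((hZm ρ).mp hρ).1) (fun z hz h0 => (hZm z).mpr ⟨hz, h0⟩) hη (s := σ + T * I) (by
      rw [Metric.mem_closedBall, dist_eq_norm, hc, show ((σ:ℂ) + T * I) - (2 + T * I) = ((σ - 2 : ℝ) : ℂ) by push_cast; ring,
        Complex.norm_real, Real.norm_eq_abs, abs_le]
      constructor <;> linarith) (by
      intro ρ hρ
      obtain ⟨a, b⟩ := (hZm ρ).mp hρ
      rw [Metric.mem_closedBall, dist_eq_norm] at a
      have := (him ρ 3 a).1
      rw [abs_le] at this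
      have hn := hA ρ (zero_strip b (by linarith))
      refine hn.trans ?_
      have := Complex.abs_im_le_norm (σ + T * I - ρ)
      simpa using this)
  refine this.trans ?_
  have hMle : M ≤ (Real.log (4 * C0) + 33) * L := by nlinarith
  have e1 : M / (δ / L) = M * L * (1 / δ) := by field_simp
  rw [e1]
  have hd : 0 < 1 / δ := by positivity
  have f1 : M * L * (1 / δ) ≤ (Real.log (4 * C0) + 33) * L * L * (1 / δ) := by gcongr
  have f2 : 96 * M ≤ 96 * ((Real.log (4 * C0) + 33) * L * L) := by
    have : (Real.log (4 * C0) + 33) * L * 1 ≤ (Real.log (4 * C0) + 33) * L * L := by gcongr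
    linarith
  nlinarith

end KKY

namespace KKY

lemma zeta_order_ne_top {ρ : ℂ} (h : 0 < ρ.im) : analyticOrderAt riemannZeta ρ ≠ ⊤ := by
  intro htop
  rw [analyticOrderAt_eq_top] at htop
  have hU : Convex ℝ {z : ℂ | 0 < z.im} := convex_halfSpace_im_gt 0
  have ha : AnalyticOnNhd ℂ riemannZeta {z : ℂ | 0 < z.im} := fun z hz => zeta_analyticAt (ne_of_gt hz)
  have := ha.eqOn_zero_of_preconnected_of_eventuallyEq_zero hU.isPreconnected h htop (x := 2 + I) (by simp)
  exact riemannZeta_ne_zero_of_one_le_re (by simp) this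

lemma zero_order {ρ : ℂ} (h : 0 < ρ.im) : zetaZeroOrder ρ = analyticOrderNatAt riemannZeta ρ := by
  have htop := zeta_order_ne_top h
  have ha := zeta_analyticAt (ne_of_gt h)
  have hm := Nat.cast_analyticOrderNatAt htop
  set m := analyticOrderNatAt riemannZeta ρ
  have h1 : ∀ i < m, iteratedDeriv i riemannZeta ρ = 0 :=
    (natCast_le_analyticOrderAt_iff_iteratedDeriv_eq_zero ha).mp hm.le
  have h2 : iteratedDeriv m riemannZeta ρ ≠ 0 := by
    intro h0
    have : ((m + 1 : ℕ) : ℕ∞) ≤ analyticOrderAt riemannZeta ρ := by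
      rw [natCast_le_analyticOrderAt_iff_iteratedDeriv_eq_zero ha]
      intro i hi
      rcases Nat.lt_succ_iff_lt_or_eq.mp hi with h | h
      · exact h1 i h
      · rw [h]; exact h0
    rw [← hm] at this
    have := Nat.cast_le.mp this
    omega
  unfold zetaZeroOrder
  refine le_antisymm (Nat.sInf_le h2) (le_csInf ⟨m, h2⟩ fun k hk => ?_)
  by_contra hlt
  exact hk (h1 k (by omega))

lemma Big.T20 {n : ℕ} {T L H : ℝ} (hT : Big n T L H) : 20 ≤ T := by
  have := hT.HT
  have := hT.Hbig
  nlinarith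

lemma Big.logT {n : ℕ} {T L H : ℝ} (hT : Big n T L H) : Real.log T = L := by
  rw [← hT.expL, Real.log_exp]

lemma zd_horiz (n : ℕ) : ∃ C : ℝ, 0 < C ∧ ∀ T L H : ℝ, Big n T L H → ∀ σ t : ℝ, -(1/L) ≤ σ → 1 ≤ t → t ≤ T →
    ‖iteratedDeriv n riemannZeta (σ + t * I)‖ ≤ C * (L ^ (n+1) * H) := by
  obtain ⟨C1, hC1, h1⟩ := zeta_deriv_strip n
  obtain ⟨C2, hC2, h2⟩ := zeta_deriv_right n
  refine ⟨C1 * (2 * Real.exp 1) + C2, by positivity, fun T L H hT σ t hσ ht1 ht2 => ?_⟩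
  have hL := hT.L8
  have hL0 : 0 < L := by linarith
  have hH0 := hT.H0
  have hHb := hT.Hbig
  have hT20 := hT.T20
  have ht : |t| = t := abs_of_pos (by linarith)
  rcases le_or_gt σ (1 + 1/L) with h | h
  · have := h1 L (by linarith) σ t hσ h (by rw [ht]; exact ht1) (by rw [ht, hT.exp2L]; nlinarith)
    rw [ht] at this
    have b1 : (5 + t) ^ ((1 - σ) / 2) ≤ 2 * H * Real.exp 1 := by
      have a1 : (5 + t) ^ ((1 - σ) / 2) ≤ (5 + t) ^ ((1:ℝ)/2 + (1/2) / L) := by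
        refine Real.rpow_le_rpow_of_exponent_le (by linarith) ?_
        have : (1/2) / L = 1 / L / 2 := by ring
        rw [this]; linarith
      rw [Real.rpow_add (by linarith)] at a1
      have a2 := rpow_small (y := 5 + t) (L := L) (c := 1/2) (by linarith) hL0 (by norm_num) (by rw [hT.exp2L]; nlinarith)
      have a3 : (5 + t) ^ ((1:ℝ)/2) ≤ 2 * H := by
        rw [← Real.sqrt_eq_rpow]
        refine Real.sqrt_le_iff.mpr ⟨by positivity, ?_⟩
        nlinarith [hT.HH]
      norm_num at a2
      refine a1.trans ?_
      norm_num at a3 ⊢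
      have := Real.rpow_nonneg (by linarith : 0 ≤ 5 + t) (1/2/L)
      exact mul_le_mul a3 a2 this (by positivity)
    have b2 : C1 * L ^ (n+1) * (5 + t) ^ ((1 - σ) / 2) ≤ C1 * L ^ (n+1) * (2 * H * Real.exp 1) := by gcongr
    have : 0 ≤ C2 * (L ^ (n+1) * H) := by positivity
    linarith
  · have := h2 (1/L) (by positivity) (by rw [div_le_iff₀ hL0]; linarith) (σ + t * I) (by simp; simpa using h.le)
    have e : C2 / (1/L) ^ (n+1) = C2 * L ^ (n+1) := by rw [one_div, inv_pow, div_inv_eq_mul]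
    rw [e] at this
    have b : C2 * L ^ (n+1) * 1 ≤ C2 * L ^ (n+1) * H := by gcongr; linarith
    have : 0 ≤ C1 * (2 * Real.exp 1) * (L ^ (n+1) * H) := by positivity
    linarith

/-- The gamma-factor part of the left edge. -/
noncomputable def XF (n : ℕ) (s : ℂ) : ℂ :=
  deriv chi (1 - s) / chi (1 - s) * iteratedDeriv n riemannZeta s

lemma XF_diff (n : ℕ) {s : ℂ} (hs : s.im ≠ 0) : DifferentiableAt ℂ (XF n) s := by
  have hs' : (1 - s).im ≠ 0 := by simpa using hs
  have hU : IsOpen {z : ℂ | z.im ≠ 0} := isOpen_ne_fun Complex.continuous_im continuous_const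
  have hd : DifferentiableOn ℂ chi {z : ℂ | z.im ≠ 0} := fun z hz => (chi_diff hz).differentiableWithinAt
  have h1 : DifferentiableAt ℂ (deriv chi) (1 - s) := (hd.deriv hU).differentiableAt (hU.mem_nhds hs')
  have h2 : DifferentiableAt ℂ (fun z => deriv chi z / chi z) (1 - s) := h1.div (chi_diff hs') (chi_ne_zero hs')
  have h3 : DifferentiableAt ℂ (fun z => deriv chi (1 - z) / chi (1 - z)) s :=
    DifferentiableAt.comp (g := fun z => deriv chi z / chi z) s h2 (by fun_prop)
  exact h3.mul (zd_diff n hs)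

lemma left_split (n : ℕ) {L t : ℝ} (hL : 0 < L) (ht : 1 ≤ t) :
    deriv riemannZeta (((-(1/L) : ℝ) : ℂ) + t * I) / riemannZeta (((-(1/L) : ℝ) : ℂ) + t * I) *
      iteratedDeriv n riemannZeta (((-(1/L) : ℝ) : ℂ) + t * I) = -XF n (((-(1/L) : ℝ) : ℂ) + t * I) - gM n L t := by
  have hε : 0 < 1 / L := by positivity
  unfold gM XF
  rw [one_sub_line]
  set s : ℂ := ((-(1/L) : ℝ) : ℂ) + t * I with hs
  have e : (((1 + 1/L : ℝ) : ℂ) - t * I) = 1 - s := by rw [hs]; push_cast; ring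
  rw [e]
  have him : s.im = t := by simp [hs]
  have hre : (1 - s).re = 1 + 1 / L := by rw [← e]; simp
  have hsi : s.im ≠ 0 := by rw [him]; linarith
  have hsi' : (1 - s).im ≠ 0 := by simpa using hsi
  have hz : riemannZeta (1 - s) ≠ 0 := riemannZeta_ne_zero_of_one_le_re (by rw [hre]; linarith)
  have hx := chi_ne_zero hsi'
  have hev : riemannZeta =ᶠ[nhds s] fun z => chi (1 - z) * riemannZeta (1 - z) := by
    have hU : IsOpen {z : ℂ | z.im ≠ 0} := isOpen_ne_fun Complex.continuous_im continuous_const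
    filter_upwards [hU.mem_nhds hsi] with z hz using zeta_fe hz
  have h1 : HasDerivAt (fun z : ℂ => 1 - z) (-1) s := by simpa using (hasDerivAt_id s).const_sub 1
  have h2 : HasDerivAt (fun z => chi (1 - z)) (deriv chi (1 - s) * (-1)) s := (chi_diff hsi').hasDerivAt.comp s h1
  have h3 : HasDerivAt (fun z => riemannZeta (1 - z)) (deriv riemannZeta (1 - s) * (-1)) s := (zeta_diff_of_im hsi').hasDerivAt.comp s h1
  have h4 := (h2.mul h3).deriv
  have h5 : deriv riemannZeta s = deriv chi (1 - s) * (-1) * riemannZeta (1 - s) + chi (1 - s) * (deriv riemannZeta (1 - s) * (-1)) := by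
    rw [hev.deriv_eq]; exact h4
  rw [h5, zeta_fe hsi]
  field_simp
  ring

lemma X_part (n : ℕ) (hn : 1 ≤ n) : ∃ C : ℝ, 0 < C ∧ ∀ T L H : ℝ, Big n T L H → ∀ t0 : ℝ, 1 ≤ t0 → t0 ≤ 2 →
    ‖∫ y : ℝ in t0..T, XF n (((-(1/L) : ℝ) : ℂ) + y * I)‖ ≤ C * (T * L ^ n) := by
  obtain ⟨C1, hC1, h1⟩ := chi_logderiv
  obtain ⟨C2, hC2, h2⟩ := zd_horiz n
  obtain ⟨C3, hC3, h3⟩ := zeta_deriv_right n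
  refine ⟨2 * C1 * C3 + 12 * (C1 * C2), by positivity, fun T L H hT t0 ht1 ht2 => ?_⟩
  have hL := hT.L8
  have hL0 : 0 < L := by linarith
  have hH0 := hT.H0
  have hT20 := hT.T20
  have hε : 0 < 1 / L := by positivity
  have hε1 : 1 / L ≤ 1 := by rw [div_le_iff₀ hL0]; linarith
  have hchi : ∀ σ t : ℝ, -(1/L) ≤ σ → σ ≤ 2 → 1 ≤ t → t ≤ T → ‖deriv chi (1 - (σ + t * I)) / chi (1 - (σ + t * I))‖ ≤ C1 * (2 * L) := by
    intro σ t a1 a2 a3 a4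
    have ht : |(1 - ((σ:ℂ) + t * I)).im| = t := by simp; linarith
    have := h1 (1 - (σ + t * I)) (by simp; linarith) (by simp; linarith) (by rw [ht]; exact a3)
    rw [ht] at this
    refine this.trans ?_
    gcongr
    have : Real.log (9 + t) ≤ Real.log (T * T) := Real.log_le_log (by linarith) (by nlinarith)
    rw [Real.log_mul (by linarith) (by linarith), hT.logT] at this
    linarith
  have hsh := rect_shift (F := XF n) (a := -(1/L)) (c := 2) (b := t0) (d := T) (by linarith) (by linarith) (by
    intro z hz
    exact (XF_diff n (by have := hz.2.2.1; linarith)).differentiableWithinAt)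
  have hhor : ∀ t : ℝ, 1 ≤ t → t ≤ T → ‖∫ x : ℝ in (-(1/L))..2, XF n (x + t * I)‖ ≤ 6 * (C1 * C2) * (T * L ^ n) := by
    intro t a1 a2
    have hb : ∀ x ∈ Set.uIoc (-(1/L)) 2, ‖XF n (x + t * I)‖ ≤ C1 * (2 * L) * (C2 * (L ^ (n+1) * H)) := by
      intro x hx
      rw [Set.uIoc_of_le (by linarith)] at hx
      unfold XF
      rw [norm_mul]
      exact mul_le_mul (hchi x t hx.1.le hx.2 a1 a2) (h2 T L H hT x t hx.1.le a1 a2) (norm_nonneg _) (by positivity)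
    have := intervalIntegral.norm_integral_le_of_norm_le_const hb
    rw [abs_of_pos (by linarith)] at this
    refine this.trans ?_
    have hp : L ^ 2 ≤ H := hT.powH (by omega)
    have q : C1 * (2 * L) * (C2 * (L ^ (n+1) * H)) * (2 - -(1/L)) ≤ C1 * (2 * L) * (C2 * (L ^ (n+1) * H)) * 3 := by
      gcongr; linarith
    refine q.trans ?_
    have : L ^ 2 * H ≤ T := by rw [← hT.HH]; nlinarith
    have := mul_le_mul_of_nonneg_left this (by positivity : 0 ≤ 6 * (C1 * C2) * L ^ n)
    refine le_trans (le_of_eq ?_) (this.trans (le_of_eq ?_)) <;> ring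
  have hr : ‖∫ y : ℝ in t0..T, XF n ((2:ℝ) + y * I)‖ ≤ 2 * C1 * C3 * (T * L ^ n) := by
    have hb : ∀ y ∈ Set.uIoc t0 T, ‖XF n ((2:ℝ) + y * I)‖ ≤ C1 * (2 * L) * C3 := by
      intro y hy
      rw [Set.uIoc_of_le (by linarith)] at hy
      unfold XF
      rw [norm_mul]
      refine mul_le_mul (hchi 2 y (by linarith) le_rfl (by linarith [hy.1]) hy.2) ?_ (norm_nonneg _) (by positivity)
      have := h3 1 one_pos le_rfl ((2:ℝ) + y * I) (by simp; norm_num)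
      simpa using this
    have := intervalIntegral.norm_integral_le_of_norm_le_const hb
    rw [abs_of_pos (by linarith)] at this
    refine this.trans ?_
    have hLn : L ≤ L ^ n := le_self_pow₀ (by linarith) (by omega)
    calc C1 * (2 * L) * C3 * (T - t0) ≤ C1 * (2 * L ^ n) * C3 * T := by
          gcongr <;> linarith
      _ = _ := by ring
  have a1 := hhor t0 ht1 (by linarith)
  have a2 := hhor T (by linarith) le_rfl
  have := norm_le_norm_add_norm_sub' (∫ y : ℝ in t0..T, XF n (((-(1/L) : ℝ) : ℂ) + y * I)) (∫ y : ℝ in t0..T, XF n ((2:ℝ) + y * I))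
  linarith

end KKY

namespace KKY

lemma big_exists (n : ℕ) : ∃ T1 : ℝ, ∀ T : ℝ, T1 ≤ T → Big n T (Real.log T) (Real.sqrt T) := by
  have h1 := (Real.isLittleO_pow_log_id_atTop (n := 2 * (3 * n + 10))).bound one_pos
  have h2 := eventually_ge_atTop (Real.exp 8)
  obtain ⟨T1, hT1⟩ := eventually_atTop.mp (h1.and h2)
  refine ⟨T1, fun T hT => ?_⟩
  obtain ⟨a, b⟩ := hT1 T hT
  have hT0 : 0 < T := (Real.exp_pos 8).trans_le b
  have hL : 8 ≤ Real.log T := (Real.le_log_iff_exp_le hT0).mpr b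
  refine ⟨hL, Real.exp_log hT0, Real.sqrt_pos.mpr hT0, Real.sq_sqrt hT0.le, ?_⟩
  refine Real.le_sqrt_of_sq_le ?_
  rw [one_mul, id, Real.norm_of_nonneg (by positivity), Real.norm_of_nonneg hT0.le] at a
  rw [← pow_mul, mul_comm _ 2]
  exact a

lemma zeros_finite (T : ℝ) : {ρ : ℂ | IsNontrivialZero ρ ∧ 0 < ρ.im ∧ ρ.im ≤ T}.Finite := by
  have hK : IsCompact (Set.Icc (0:ℝ) 1 ×ℂ Set.Icc (0:ℝ) T) := isCompact_Icc.reProdIm isCompact_Icc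
  refine (IsCompact.inter_riemannZetaZeros_finite hK).subset fun ρ hρ => ⟨?_, hρ.1.1⟩
  rw [Complex.mem_reProdIm]
  exact ⟨⟨hρ.1.2.1.le, hρ.1.2.2.le⟩, ⟨hρ.2.1.le, hρ.2.2⟩⟩

lemma t0_exists : ∃ t0 : ℝ, 1 < t0 ∧ t0 < 2 ∧ ∀ ρ : ℂ, riemannZeta ρ = 0 → ρ.im ≠ t0 := by
  have hf := (zeros_finite 2).image Complex.im
  obtain ⟨t, ht, hn⟩ := (Set.Ioo_infinite (by norm_num : (1:ℝ) < 2)).exists_notMem_finite hf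
  refine ⟨t, ht.1, ht.2, fun ρ h0 hρ => hn ⟨ρ, ⟨zero_strip h0 (by rw [hρ]; linarith [ht.1]), ?_, ?_⟩, hρ⟩⟩
  · rw [hρ]; linarith [ht.1]
  · rw [hρ]; exact ht.2.le

lemma bottom_bdd {t0 : ℝ} (h1 : 1 < t0) (hz : ∀ ρ : ℂ, riemannZeta ρ = 0 → ρ.im ≠ t0) :
    ∃ B : ℝ, 0 < B ∧ ∀ σ : ℝ, -1 ≤ σ → σ ≤ 2 → ‖deriv riemannZeta (σ + t0 * I) / riemannZeta (σ + t0 * I)‖ ≤ B := by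
  have hne : ∀ σ ∈ Set.Icc (-1:ℝ) 2, (σ:ℂ) + t0 * I ≠ 1 := by
    intro σ _ h
    have := congrArg Complex.im h
    simp at this; linarith
  have c1 := zd_cont 1 (γ := fun σ : ℝ => (σ:ℂ) + t0 * I) (S := Set.Icc (-1:ℝ) 2) (by fun_prop) hne
  have c0 := zd_cont 0 (γ := fun σ : ℝ => (σ:ℂ) + t0 * I) (S := Set.Icc (-1:ℝ) 2) (by fun_prop) hne
  simp only [iteratedDeriv_one, iteratedDeriv_zero] at c1 c0
  have c := c1.div c0 fun σ _ h0 => hz _ h0 (by simp)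
  obtain ⟨B, hB⟩ := isCompact_Icc.exists_bound_of_continuousOn c
  refine ⟨|B| + 1, by positivity, fun σ a b => ?_⟩
  have := hB σ ⟨a, b⟩
  simp only [Pi.div_apply] at this
  exact this.trans (by linarith [le_abs_self B])

lemma contour {n : ℕ} {δ T L H t0 : ℝ} (hδ : 0 < δ) (hT : Big n T L H) (hA : AdmissibleHeight δ T) (h1 : 1 < t0) (h2 : t0 < 2)
    (hz : ∀ ρ : ℂ, riemannZeta ρ = 0 → ρ.im ≠ t0) :
    rectInt (fun z => deriv riemannZeta z / riemannZeta z * iteratedDeriv n riemannZeta z) (-(1/L)) 2 t0 T =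
      2 * Real.pi * I * (zetaZeroSum n T - zetaZeroSum n t0) := by
  classical
  have hL := hT.L8
  have hL0 : 0 < L := by linarith
  have hT20 := hT.T20
  have hε : 0 < 1 / L := by positivity
  have hfT := zeros_finite T
  have hft := zeros_finite t0
  have hsub : hft.toFinset ⊆ hfT.toFinset := by
    intro ρ hρ
    rw [Set.Finite.mem_toFinset] at hρ ⊢
    exact ⟨hρ.1, hρ.2.1, hρ.2.2.trans (by linarith)⟩
  have hZ : ∀ ρ, ρ ∈ hfT.toFinset \ hft.toFinset ↔ IsNontrivialZero ρ ∧ t0 < ρ.im ∧ ρ.im ≤ T := by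
    intro ρ
    rw [Finset.mem_sdiff, Set.Finite.mem_toFinset, Set.Finite.mem_toFinset]
    constructor
    · rintro ⟨⟨a, b, c⟩, d⟩
      refine ⟨a, ?_, c⟩
      by_contra h
      push Not at h
      exact d ⟨a, b, h⟩
    · rintro ⟨a, b, c⟩
      exact ⟨⟨a, by linarith, c⟩, fun h => by linarith [h.2.2]⟩
  have hsum : zetaZeroSum n T - zetaZeroSum n t0 =
      ∑ ρ ∈ hfT.toFinset \ hft.toFinset, (analyticOrderNatAt riemannZeta ρ : ℂ) * iteratedDeriv n riemannZeta ρ := by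
    unfold zetaZeroSum
    rw [finsum_mem_eq_finite_toFinset_sum _ hfT, finsum_mem_eq_finite_toFinset_sum _ hft, ← Finset.sum_sdiff hsub, add_sub_cancel_right]
    refine Finset.sum_congr rfl fun ρ hρ => ?_
    rw [zero_order (by linarith [((hZ ρ).mp hρ).2.1])]
  rw [hsum]
  have hU : IsOpen {z : ℂ | 0 < z.im} := isOpen_lt continuous_const Complex.continuous_im
  have hlog : 0 < Real.log T := Real.log_pos (by linarith)
  refine arg_principle hU (f := iteratedDeriv n riemannZeta)
    (fun z hz => (zd_diff n (ne_of_gt hz)).differentiableWithinAt) (by linarith) (by linarith) ?_ _ riemannZeta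
    (fun z hz => (zeta_diff_of_im (ne_of_gt hz)).differentiableWithinAt) ?_ ?_ ?_
  · intro z hz
    have := hz.2.2.1
    show 0 < z.im
    linarith
  · intro ρ hρ
    obtain ⟨a, b, c⟩ := (hZ ρ).mp hρ
    refine ⟨by linarith [a.2.1], by linarith [a.2.2], b, lt_of_le_of_ne c fun h => ?_⟩
    have := hA ρ a
    rw [h, sub_self, abs_zero] at this
    have : 0 < δ / Real.log T := by positivity
    linarith
  · intro z hzr h0
    rw [hZ]
    have := hzr.2.2.1
    exact ⟨zero_strip h0 (by linarith), lt_of_le_of_ne hzr.2.2.1 (hz z h0).symm, hzr.2.2.2⟩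
  · intro ρ hρ
    exact zeta_order_ne_top (by linarith [((hZ ρ).mp hρ).2.1])

lemma edges (n : ℕ) (hn : 1 ≤ n) (δ : ℝ) (hδ : 0 < δ) (t0 : ℝ) (h1 : 1 < t0) (h2 : t0 < 2)
    (hz : ∀ ρ : ℂ, riemannZeta ρ = 0 → ρ.im ≠ t0) : ∃ C : ℝ, 0 < C ∧ ∀ T L H : ℝ, Big n T L H → AdmissibleHeight δ T →
    ‖(zetaZeroSum n T - zetaZeroSum n t0) - (1 / (2 * Real.pi) : ℂ) * ∫ t in t0..T, gM n L t‖ ≤ C * (T * L ^ n) := by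
  obtain ⟨B, hB, hbot⟩ := bottom_bdd h1 hz
  obtain ⟨C1, hC1, htop⟩ := zeta_ld_top δ hδ
  obtain ⟨C2, hC2, hzd⟩ := zd_horiz n
  obtain ⟨C3, hC3, hr⟩ := zeta_deriv_right n
  obtain ⟨C4, hC4, hvm⟩ := vm_right
  obtain ⟨C5, hC5, hX⟩ := X_part n hn
  refine ⟨3 * B * C2 + 3 * C1 * C2 + C4 * C3 + C5, by positivity, fun T L H hT hA => ?_⟩
  have hL := hT.L8
  have hL0 : 0 < L := by linarith
  have hH0 := hT.H0
  have hT20 := hT.T20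
  have hε : 0 < 1 / L := by positivity
  have hε1 : 1 / L ≤ 1/2 := by rw [div_le_iff₀ hL0]; linarith
  have hc := contour hδ hT hA h1 h2 hz
  unfold rectInt at hc
  set F : ℂ → ℂ := fun z => deriv riemannZeta z / riemannZeta z * iteratedDeriv n riemannZeta z with hF
  set M := ∫ t in t0..T, gM n L t with hM
  set D := zetaZeroSum n T - zetaZeroSum n t0
  have hXc : ContinuousOn (fun y : ℝ => XF n (((-(1/L) : ℝ) : ℂ) + y * I)) (Set.uIcc t0 T) := by
    intro y hy
    rw [Set.uIcc_of_le (by linarith)] at hy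
    have := (XF_diff n (s := ((-(1/L) : ℝ) : ℂ) + y * I) (by simp; linarith [hy.1])).continuousAt
    exact (ContinuousAt.comp (f := fun y : ℝ => ((-(1/L) : ℝ) : ℂ) + y * I) this (by fun_prop)).continuousWithinAt
  have hleft : (∫ y : ℝ in t0..T, F (((-(1/L) : ℝ) : ℂ) + y * I)) = -(∫ y : ℝ in t0..T, XF n (((-(1/L) : ℝ) : ℂ) + y * I)) - M := by
    have hi : IntervalIntegrable (fun y : ℝ => -XF n (((-(1/L) : ℝ) : ℂ) + y * I)) MeasureTheory.volume t0 T :=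
      hXc.intervalIntegrable.neg
    rw [← intervalIntegral.integral_neg, hM, ← intervalIntegral.integral_sub hi ((gM_cont n hL0).intervalIntegrable _ _)]
    refine intervalIntegral.integral_congr fun y hy => ?_
    rw [Set.uIcc_of_le (by linarith)] at hy
    exact left_split n hL0 (by linarith [hy.1])
  have hLH : L ^ 3 ≤ H := hT.powH (by omega)
  have hhor : ∀ (t K : ℝ), 1 ≤ t → t ≤ T → 0 ≤ K → (∀ σ : ℝ, -(1/2) ≤ σ → σ ≤ 2 →
      ‖deriv riemannZeta (σ + t * I) / riemannZeta (σ + t * I)‖ ≤ K * L ^ 2) →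
      ‖∫ x : ℝ in (-(1/L))..2, F (x + t * I)‖ ≤ 3 * K * C2 * (T * L ^ n) := by
    intro t K a1 a2 hK hb
    have hb' : ∀ x ∈ Set.uIoc (-(1/L)) 2, ‖F (x + t * I)‖ ≤ K * L ^ 2 * (C2 * (L ^ (n+1) * H)) := by
      intro x hx
      rw [Set.uIoc_of_le (by linarith)] at hx
      rw [hF]
      simp only [norm_mul]
      exact mul_le_mul (hb x (by linarith [hx.1]) hx.2) (hzd T L H hT x t hx.1.le a1 a2) (norm_nonneg _) (by positivity)
    have := intervalIntegral.norm_integral_le_of_norm_le_const hb'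
    rw [abs_of_pos (by linarith)] at this
    refine this.trans ?_
    have q : K * L ^ 2 * (C2 * (L ^ (n+1) * H)) * (2 - -(1/L)) ≤ K * L ^ 2 * (C2 * (L ^ (n+1) * H)) * 3 := by
      gcongr; linarith
    refine q.trans ?_
    have : L ^ 3 * H ≤ T := by rw [← hT.HH]; nlinarith
    have := mul_le_mul_of_nonneg_left this (by positivity : 0 ≤ 3 * K * C2 * L ^ n)
    refine le_trans (le_of_eq ?_) (this.trans (le_of_eq ?_)) <;> ring
  have e1 := hhor t0 B h1.le (by linarith) hB.le (fun σ a b => (hbot σ (by linarith) b).trans (by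
    have : 1 ≤ L ^ 2 := one_le_pow₀ (by linarith)
    nlinarith))
  have e2 := hhor T C1 (by linarith) le_rfl hC1.le (fun σ a b => by
    have := htop T hT20 hA σ a b
    rwa [hT.logT] at this)
  have e3 : ‖∫ y : ℝ in t0..T, F ((2:ℝ) + y * I)‖ ≤ C4 * C3 * (T * L ^ n) := by
    have hb : ∀ y ∈ Set.uIoc t0 T, ‖F ((2:ℝ) + y * I)‖ ≤ C4 * C3 := by
      intro y hy
      rw [hF]
      simp only [norm_mul]
      have a1 := hr 1 one_pos le_rfl ((2:ℝ) + y * I) (by simp; norm_num)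
      have a2 := hvm 1 one_pos le_rfl ((2:ℝ) + y * I) (by simp; norm_num)
      rw [one_pow, div_one] at a1 a2
      exact mul_le_mul a2 a1 (norm_nonneg _) hC4.le
    have := intervalIntegral.norm_integral_le_of_norm_le_const hb
    rw [abs_of_pos (by linarith)] at this
    refine this.trans ?_
    have : T - t0 ≤ T * L ^ n := by
      have : 1 ≤ L ^ n := one_le_pow₀ (by linarith)
      nlinarith
    gcongr
  have e4 := hX T L H hT t0 h1.le h2.le
  rw [hleft] at hc
  set b1 := ∫ x : ℝ in (-(1/L))..2, F (x + t0 * I)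
  set b2 := ∫ x : ℝ in (-(1/L))..2, F (x + T * I)
  set b3 := ∫ y : ℝ in t0..T, F ((2:ℝ) + y * I)
  set b4 := ∫ y : ℝ in t0..T, XF n (((-(1/L) : ℝ) : ℂ) + y * I)
  have hpi : (Real.pi : ℂ) ≠ 0 := by exact_mod_cast Real.pi_ne_zero
  have hfin : D - (1 / (2 * Real.pi) : ℂ) * M = (b1 - b2 + I * b3 + I * b4) / (2 * Real.pi * I) := by
    have hI := Complex.I_ne_zero
    rw [eq_div_iff (by simp [hpi])]
    have : (D - (1 / (2 * Real.pi) : ℂ) * M) * (2 * Real.pi * I) = 2 * Real.pi * I * D - I * M := by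
      field_simp
    rw [this, ← hc]
    ring
  rw [hfin, norm_div]
  have hden : 1 ≤ ‖(2 * Real.pi * I : ℂ)‖ := by
    simp only [norm_mul, Complex.norm_I, mul_one, Complex.norm_ofNat, Complex.norm_real, Real.norm_of_nonneg Real.pi_pos.le]
    linarith [Real.pi_gt_three]
  refine (div_le_self (norm_nonneg _) hden).trans ?_
  have n1 := norm_add_le (b1 - b2 + I * b3) (I * b4)
  have n2 := norm_add_le (b1 - b2) (I * b3)
  have n3 := norm_sub_le b1 b2
  rw [norm_mul, Complex.norm_I, one_mul] at n1 n2
  linarith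

end KKY

open KKY in
theorem kky_final (n : ℕ) (hn : 1 ≤ n) (δ : ℝ) (hδ : 0 < δ) :
    ∃ K : ℝ, 0 < K ∧ ∃ T₀ : ℝ, ∀ T : ℝ, T₀ ≤ T → AdmissibleHeight δ T →
      ‖zetaZeroSum n T - (-1 : ℂ) ^ (n + 1) * (1 / ((n : ℂ) + 1)) *
        (((T / (2 * Real.pi)) * Real.log (T / (2 * Real.pi)) ^ (n + 1) : ℝ) : ℂ)‖ ≤ K * T * Real.log T ^ n := by
  obtain ⟨t0, h1, h2, hz⟩ := t0_exists
  obtain ⟨C1, hC1, hE⟩ := edges n hn δ hδ t0 h1 h2 hz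
  obtain ⟨C2, hC2, hM⟩ := M_main n hn
  obtain ⟨T1, hT1⟩ := big_exists n
  refine ⟨C1 + C2 + ‖zetaZeroSum n t0‖, by positivity, T1, fun T hT hA => ?_⟩
  have hB := hT1 T hT
  have a1 := hE T _ _ hB hA
  have a2 := hM T _ _ hB t0 h1.le h2.le
  have hT20 := hB.T20
  have hL := hB.L8
  set L := Real.log T
  set M := ∫ t in t0..T, gM n L t
  set Q : ℝ := T * Real.log (T / (2 * Real.pi)) ^ (n + 1) / (n + 1) with hQ
  have hpi := Real.pi_gt_three
  have hp : ‖(1 / (2 * Real.pi) : ℂ)‖ ≤ 1 := by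
    rw [show (1 / (2 * Real.pi) : ℂ) = ((1 / (2 * Real.pi) : ℝ) : ℂ) by push_cast; rfl, Complex.norm_real, Real.norm_of_nonneg (by positivity),
      div_le_one (by positivity)]
    linarith
  have a3 : ‖(1 / (2 * Real.pi) : ℂ) * (M - (-1:ℂ) ^ (n+1) * (Q : ℂ))‖ ≤ C2 * (T * L ^ n) := by
    rw [norm_mul]
    calc _ ≤ 1 * (C2 * (T * L ^ n)) := mul_le_mul hp a2 (norm_nonneg _) zero_le_one
      _ = _ := one_mul _
  have e : (-1 : ℂ) ^ (n + 1) * (1 / ((n : ℂ) + 1)) * (((T / (2 * Real.pi)) * Real.log (T / (2 * Real.pi)) ^ (n + 1) : ℝ) : ℂ) =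
      (1 / (2 * Real.pi) : ℂ) * ((-1:ℂ) ^ (n+1) * (Q : ℂ)) := by
    rw [hQ]
    set l := Real.log (T / (2 * Real.pi))
    have hpc : (Real.pi : ℂ) ≠ 0 := by exact_mod_cast Real.pi_ne_zero
    have hn1 : (n:ℂ) + 1 ≠ 0 := by exact_mod_cast Nat.succ_ne_zero n
    push_cast
    field_simp
  rw [e]
  have e2 : zetaZeroSum n T - (1 / (2 * Real.pi) : ℂ) * ((-1:ℂ) ^ (n+1) * (Q : ℂ)) =
      (zetaZeroSum n T - zetaZeroSum n t0 - (1 / (2 * Real.pi) : ℂ) * M) +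
      (1 / (2 * Real.pi) : ℂ) * (M - (-1:ℂ) ^ (n+1) * (Q : ℂ)) + zetaZeroSum n t0 := by ring
  rw [e2]
  have hLn : 1 ≤ L ^ n := one_le_pow₀ (by linarith)
  have hTL : 1 ≤ T * L ^ n := by nlinarith
  have n1 := norm_add_le_of_le (norm_add_le_of_le a1 a3) (le_refl ‖zetaZeroSum n t0‖)
  refine n1.trans ?_
  have := mul_le_mul_of_nonneg_left hTL (norm_nonneg (zetaZeroSum n t0))
  linarith

/-- Kaptan–Karabulut–Yıldırım: the leading order asymptotic
`∑_{0<γ≤T} ζ^{(n)}(ρ) = (-1)^{n+1} (1/(n+1)) (T/2π) log^{n+1}(T/2π) + O(T log^n T)`. -/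
theorem kky_leading_term (n : ℕ) (hn : 1 ≤ n) (δ : ℝ) (hδ : 0 < δ) :
    ∃ K > (0 : ℝ), ∃ T₀ : ℝ, ∀ T ≥ T₀, AdmissibleHeight δ T →
      ‖zetaZeroSum n T -
          (-1 : ℂ) ^ (n + 1) * (1 / ((n : ℂ) + 1)) *
            (((T / (2 * Real.pi)) * Real.log (T / (2 * Real.pi)) ^ (n + 1) : ℝ) : ℂ)‖ ≤
        K * T * Real.log T ^ n := by
  obtain ⟨K, hK, T₀, h⟩ := kky_final n hn δ hδ
  exact ⟨K, hK, T₀, fun T hT hA => h T hT hA⟩
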